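/- arXiv:2311.00963 — 7 statements merged into one kernel-verified Lean document; each statement's English description precedes it below -/
import Mathlib

section
/- Let d ≥ 3 be an integer. Let Λ ⊆ ℝ be the set of all real numbers t such that there exists a square-free polynomial f ∈ ℂ[x,y] of total degree d, whose homogeneous components of degree less than d-1 vanish, whose homogeneous component of degree d-1 is nonzero, and with lct₀(f) = t. Then Λ = {2/(d-1)} ∪ { (2k+1)/(kd+1) : k an integer with ⌊(d-1)/2⌋ ≤ k ≤ d-2 } ∪ { (2k+1)/(kd) : k an integer with ⌊(d+1)/2⌋ ≤ k ≤ d-1 }. -/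
open MeasureTheory MvPolynomial

/-- The log canonical threshold at the origin of a function `f : ℂ × ℂ → ℂ`,
defined via the complex singularity exponent. -/
noncomputable def lct₀ (f : ℂ × ℂ → ℂ) : ℝ :=
  sSup { c : ℝ | 0 ≤ c ∧ ∃ ε : ℝ, 0 < ε ∧
    IntegrableOn (fun p : ℂ × ℂ => ‖f p‖ ^ (-2 * c)) (Metric.ball (0 : ℂ × ℂ) ε) volume }

/-- Evaluation of a bivariate polynomial as a function on `ℂ × ℂ`. -/
noncomputable def evalFun (f : MvPolynomial (Fin 2) ℂ) : ℂ × ℂ → ℂ :=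
  fun p => MvPolynomial.eval ![p.1, p.2] f

/-- Multiplication by a nonzero complex number `x` scales Lebesgue measure by `‖x‖ ^ 2`. -/
lemma lintegral_comp_mul_left_complex (x : ℂ) (hx : x ≠ 0) (g : ℂ → ENNReal) :
    ∫⁻ y, g y = ENNReal.ofReal (‖x‖ ^ 2) * ∫⁻ u, g (x * u) := by
  have hdet : LinearMap.det (LinearMap.mul ℝ ℂ x) = ‖x‖ ^ 2 := by
    have h := Algebra.norm_complex_apply x
    rw [Algebra.norm_apply, Complex.normSq_eq_norm_sq] at h
    exact h
  have hpos : 0 < ‖x‖ ^ 2 := by positivity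
  have h := Measure.map_linearMap_addHaar_eq_smul_addHaar (volume : Measure ℂ)
    (f := LinearMap.mul ℝ ℂ x) (by rw [hdet]; exact hpos.ne')
  have h2 := lintegral_map_equiv (μ := volume) g (MeasurableEquiv.mulLeft₀ x hx)
  have h3 : Measure.map (MeasurableEquiv.mulLeft₀ x hx) (volume : Measure ℂ)
      = ENNReal.ofReal |(‖x‖ ^ 2)⁻¹| • volume := by
    rw [← hdet, ← h]; rfl
  rw [h3, lintegral_smul_measure] at h2
  have h4 : ∀ u, MeasurableEquiv.mulLeft₀ x hx u = x * u := fun u => rfl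
  simp only [h4] at h2
  rw [← h2, smul_eq_mul, ← mul_assoc, ← ENNReal.ofReal_mul hpos.le,
    abs_of_pos (inv_pos.2 hpos), mul_inv_cancel₀ hpos.ne', ENNReal.ofReal_one, one_mul]

lemma lintegral_ball_norm_sub_rpow_lt_top {s : ℝ} (hs : -2 < s) (z₀ : ℂ) (r : ℝ) :
    ∫⁻ z in Metric.ball z₀ r, ENNReal.ofReal (‖z - z₀‖ ^ s) < ⊤ := by
  have hint : IntegrableOn (fun z : ℂ => ‖z‖ ^ s) (Metric.ball 0 r) := by
    refine integrableOn_ball_of_norm_le_rpow (C := 1) (α := -s) (by simp)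
      (by rw [Complex.finrank_real_complex]; push_cast; linarith) ?_
      (measurable_norm.pow_const s).aestronglyMeasurable
    refine Filter.Eventually.of_forall fun x => ?_
    rw [Real.norm_of_nonneg (by positivity), neg_neg, one_mul]
  have h0 : ∫⁻ z in Metric.ball (0 : ℂ) r, ENNReal.ofReal (‖z‖ ^ s) < ⊤ := by
    have := hint.2
    rw [hasFiniteIntegral_iff_ofReal (Filter.Eventually.of_forall fun x => by positivity)] at this
    exact this
  have h1 := lintegral_add_right_eq_self (μ := volume)
    (fun z => (Metric.ball z₀ r).indicator (fun z => ENNReal.ofReal (‖z - z₀‖ ^ s)) z) z₀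
  rw [lintegral_indicator measurableSet_ball] at h1
  rw [← h1]
  rw [← lintegral_indicator measurableSet_ball] at h0
  convert h0 using 3 with z
  by_cases hz : ‖z‖ < r <;> simp [Set.indicator, hz]

/-- The complex beta integral converges. -/
lemma lintegral_norm_rpow_mul_norm_one_add_rpow_lt_top {a c : ℝ} (ha0 : 0 < a) (ha : a < 1)
    (hc0 : 0 < c) (hc : c < 1) (hac : 1 < a + c) :
    ∫⁻ z : ℂ, ENNReal.ofReal (‖z‖ ^ (-2 * a) * ‖1 + z‖ ^ (-2 * c)) < ⊤ := by
  set A := Metric.ball (0 : ℂ) (1 / 2)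
  set B := Metric.ball (-1 : ℂ) (1 / 2)
  have hfin1 := lintegral_ball_norm_sub_rpow_lt_top (s := -2 * a) (by linarith) 0 (1 / 2)
  have hfin2 := lintegral_ball_norm_sub_rpow_lt_top (s := -2 * c) (by linarith) (-1) (1 / 2)
  have hfin3 := finite_integral_one_add_norm (E := ℂ) (μ := volume) (r := 2 * a + 2 * c)
    (by rw [Complex.finrank_real_complex]; push_cast; linarith)
  have hmA : MeasurableSet A := measurableSet_ball
  have hmB : MeasurableSet B := measurableSet_ball
  set f1 : ℂ → ENNReal := A.indicator fun z =>
    ENNReal.ofReal ((1 / 2 : ℝ) ^ (-2 * c)) * ENNReal.ofReal (‖z - 0‖ ^ (-2 * a))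
  set f2 : ℂ → ENNReal := B.indicator fun z =>
    ENNReal.ofReal ((1 / 2 : ℝ) ^ (-2 * a)) * ENNReal.ofReal (‖z - (-1)‖ ^ (-2 * c))
  set f3 : ℂ → ENNReal := fun z => ENNReal.ofReal ((1 / 5 : ℝ) ^ (-(2 * a + 2 * c))) *
    ENNReal.ofReal ((1 + ‖z‖) ^ (-(2 * a + 2 * c)))
  have hbound : ∀ z, ENNReal.ofReal (‖z‖ ^ (-2 * a) * ‖1 + z‖ ^ (-2 * c)) ≤ f1 z + (f2 z + f3 z) := by
    intro z
    have t1 : (1 : ℝ) ≤ ‖1 + z‖ + ‖z‖ := by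
      have := norm_sub_le (1 + z) z
      simpa using this
    have t2 : ‖z‖ ≤ 1 + ‖1 + z‖ := by
      have := norm_sub_le (1 + z) 1
      rw [add_sub_cancel_left, norm_one] at this
      linarith
    by_cases hA : z ∈ A
    · have hz : ‖z‖ < 1 / 2 := by simpa [A] using hA
      refine le_add_right ?_
      simp only [f1, Set.indicator_of_mem hA, sub_zero]
      rw [← ENNReal.ofReal_mul (by positivity), mul_comm]
      refine ENNReal.ofReal_le_ofReal ?_
      gcongr ?_ * _
      exact Real.rpow_le_rpow_of_nonpos (by norm_num) (by linarith) (by linarith)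
    by_cases hB : z ∈ B
    · have hz : ‖1 + z‖ < 1 / 2 := by simpa [B, dist_eq_norm, add_comm] using hB
      refine le_add_left (le_add_right ?_)
      simp only [f2, Set.indicator_of_mem hB]
      rw [← ENNReal.ofReal_mul (by positivity), sub_neg_eq_add, add_comm z 1]
      refine ENNReal.ofReal_le_ofReal ?_
      gcongr ?_ * _
      exact Real.rpow_le_rpow_of_nonpos (by norm_num) (by linarith) (by linarith)
    · have hz : 1 / 2 ≤ ‖z‖ := by simpa [A] using hA
      have hz' : 1 / 2 ≤ ‖1 + z‖ := by simpa [B, dist_eq_norm, add_comm] using hB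
      refine le_add_left (le_add_left ?_)
      simp only [f3]
      rw [← ENNReal.ofReal_mul (by positivity), ← Real.mul_rpow (by positivity) (by positivity),
        neg_add, Real.rpow_add (by positivity), ← neg_mul, ← neg_mul]
      refine ENNReal.ofReal_le_ofReal ?_
      gcongr ?_ * ?_
      · exact Real.rpow_le_rpow_of_nonpos (by positivity) (by linarith) (by linarith)
      · exact Real.rpow_le_rpow_of_nonpos (by positivity) (by linarith) (by linarith)
  refine (lintegral_mono hbound).trans_lt ?_
  have hmf1 : Measurable f1 := Measurable.indicator (by fun_prop) hmA
  have hmf2 : Measurable f2 := Measurable.indicator (by fun_prop) hmB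
  rw [lintegral_add_left hmf1, lintegral_add_left hmf2]
  refine ENNReal.add_lt_top.2 ⟨?_, ENNReal.add_lt_top.2 ⟨?_, ?_⟩⟩
  · rw [lintegral_indicator hmA, lintegral_const_mul' _ _ ENNReal.ofReal_ne_top]
    exact ENNReal.mul_lt_top ENNReal.ofReal_lt_top hfin1
  · rw [lintegral_indicator hmB, lintegral_const_mul' _ _ ENNReal.ofReal_ne_top]
    exact ENNReal.mul_lt_top ENNReal.ofReal_lt_top hfin2
  · rw [lintegral_const_mul' _ _ ENNReal.ofReal_ne_top]
    exact ENNReal.mul_lt_top ENNReal.ofReal_lt_top hfin3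

lemma lintegral_norm_rpow_mul_norm_add_mul_rpow (a c : ℝ) {p q : ℂ} (hp : p ≠ 0) (hq : q ≠ 0) :
    ∫⁻ x : ℂ, ENNReal.ofReal (‖x‖ ^ (-2 * a) * ‖p + x * q‖ ^ (-2 * c)) =
      ENNReal.ofReal (‖p‖ ^ (2 - 2 * a - 2 * c) * ‖q‖ ^ (2 * a - 2)) *
        ∫⁻ z : ℂ, ENNReal.ofReal (‖z‖ ^ (-2 * a) * ‖1 + z‖ ^ (-2 * c)) := by
  have hp' : 0 < ‖p‖ := norm_pos_iff.2 hp
  have hq' : 0 < ‖q‖ := norm_pos_iff.2 hq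
  rw [lintegral_comp_mul_left_complex (p / q) (div_ne_zero hp hq)]
  have key : ∀ z : ℂ, ENNReal.ofReal (‖p / q * z‖ ^ (-2 * a) * ‖p + p / q * z * q‖ ^ (-2 * c)) =
      ENNReal.ofReal (‖p / q‖ ^ (-2 * a) * ‖p‖ ^ (-2 * c)) *
        ENNReal.ofReal (‖z‖ ^ (-2 * a) * ‖1 + z‖ ^ (-2 * c)) := by
    intro z
    have : p + p / q * z * q = p * (1 + z) := by field_simp
    rw [this, norm_mul, norm_mul p, Real.mul_rpow (by positivity) (by positivity),
      Real.mul_rpow (by positivity) (by positivity), ← ENNReal.ofReal_mul (by positivity)]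
    congr 1
    ring
  simp_rw [key]
  rw [lintegral_const_mul' _ _ ENNReal.ofReal_ne_top, ← mul_assoc,
    ← ENNReal.ofReal_mul (by positivity)]
  congr 2
  rw [norm_div, Real.div_rpow hp'.le hq'.le, div_pow, div_eq_mul_inv, div_eq_mul_inv,
    ← Real.rpow_natCast, ← Real.rpow_natCast, ← Real.rpow_neg hq'.le, ← Real.rpow_neg hq'.le]
  have e1 : ‖p‖ ^ (2 - 2 * a - 2 * c) =
      ‖p‖ ^ ((2 : ℕ) : ℝ) * ‖p‖ ^ (-2 * a) * ‖p‖ ^ (-2 * c) := by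
    rw [← Real.rpow_add hp', ← Real.rpow_add hp']; congr 1; push_cast; ring
  have e2 : ‖q‖ ^ (2 * a - 2) = ‖q‖ ^ (-((2 : ℕ) : ℝ)) * ‖q‖ ^ (-(-2 * a)) := by
    rw [← Real.rpow_add hq']; congr 1; push_cast; ring
  rw [e1, e2]
  ring

/-- Integration over `ℂ²` in the coordinates `(x, y) = (x, x * u)` of the blow-up of the origin. -/
lemma lintegral_prod_eq_blowup {G : ℂ × ℂ → ENNReal} (hG : Measurable G) :
    ∫⁻ z, G z = ∫⁻ x : ℂ, ∫⁻ u : ℂ, ENNReal.ofReal (‖x‖ ^ 2) * G (x, x * u) := by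
  rw [Measure.volume_eq_prod, lintegral_prod _ hG.aemeasurable]
  have h0 : ∀ᵐ x : ℂ, x ≠ 0 := compl_mem_ae_iff.2 (measure_singleton 0)
  refine lintegral_congr_ae ?_
  filter_upwards [h0] with x hx
  rw [lintegral_const_mul' _ _ ENNReal.ofReal_ne_top]
  exact lintegral_comp_mul_left_complex x hx _

/-- The integral of `‖x‖ ^ (-2a) ‖P(u) + x Q(u)‖ ^ (-2c)` over `u ∈ S` and `‖x‖ < ε`. -/
noncomputable def chartIntegral (a c : ℝ) (P Q : Polynomial ℂ) (ε : ℝ) (S : Set ℂ) : ENNReal :=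
  ∫⁻ u in S, ∫⁻ x in Metric.ball (0 : ℂ) ε,
    ENNReal.ofReal (‖x‖ ^ (-2 * a) * ‖P.eval u + x * Q.eval u‖ ^ (-2 * c))

lemma chartIntegral_mono {a c : ℝ} {P Q : Polynomial ℂ} {ε ε' : ℝ} {S S' : Set ℂ}
    (hε : ε ≤ ε') (hS : S ⊆ S') : chartIntegral a c P Q ε S ≤ chartIntegral a c P Q ε' S' := by
  refine (lintegral_mono_set hS).trans (lintegral_mono fun u => ?_)
  exact lintegral_mono_set (Metric.ball_subset_ball hε)

lemma chartIntegral_lt_top_of_common_factor {a c : ℝ} (ha : a < 1) (hc0 : 0 < c) {j : ℕ}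
    (hj : c * j < 1) (u₀ : ℂ) {P₁ Q₁ : Polynomial ℂ} (hP₁ : P₁.eval u₀ ≠ 0) :
    ∃ δ > 0, chartIntegral a c ((Polynomial.X - Polynomial.C u₀) ^ j * P₁)
      ((Polynomial.X - Polynomial.C u₀) ^ j * Q₁) δ (Metric.ball u₀ δ) < ⊤ := by
  set κ := ‖P₁.eval u₀‖ / 2
  have hκ : 0 < κ := half_pos (norm_pos_iff.2 hP₁)
  have hcont : Continuous fun z : ℂ × ℂ => ‖P₁.eval z.2 + z.1 * Q₁.eval z.2‖ := by fun_prop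
  have hev : ∀ᶠ z in nhds ((0 : ℂ), u₀), κ < ‖P₁.eval z.2 + z.1 * Q₁.eval z.2‖ := by
    refine hcont.continuousAt.eventually (lt_mem_nhds ?_)
    simpa [κ] using hP₁
  obtain ⟨δ, hδ, hball⟩ := Metric.eventually_nhds_iff_ball.1 hev
  refine ⟨δ, hδ, ?_⟩
  have hx := lintegral_ball_norm_sub_rpow_lt_top (s := -2 * a) (by linarith) 0 δ
  have hu := lintegral_ball_norm_sub_rpow_lt_top (s := j * (-2 * c)) (by linarith) u₀ δ
  simp only [sub_zero] at hx
  have hle : chartIntegral a c ((Polynomial.X - Polynomial.C u₀) ^ j * P₁)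
      ((Polynomial.X - Polynomial.C u₀) ^ j * Q₁) δ (Metric.ball u₀ δ) ≤
      ∫⁻ u in Metric.ball u₀ δ, ENNReal.ofReal (κ ^ (-2 * c)) *
        (∫⁻ x in Metric.ball (0 : ℂ) δ, ENNReal.ofReal (‖x‖ ^ (-2 * a))) *
        ENNReal.ofReal (‖u - u₀‖ ^ (j * (-2 * c))) := by
    refine setLIntegral_mono' measurableSet_ball fun u hu => ?_
    rw [mul_assoc, mul_comm (lintegral _ _), ← mul_assoc, ← ENNReal.ofReal_mul (by positivity),
      ← lintegral_const_mul' _ _ ENNReal.ofReal_ne_top]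
    refine setLIntegral_mono' measurableSet_ball fun x hx => ?_
    rw [← ENNReal.ofReal_mul (by positivity)]
    refine ENNReal.ofReal_le_ofReal ?_
    rw [mul_comm]
    gcongr
    have hz : ((x, u) : ℂ × ℂ) ∈ Metric.ball ((0 : ℂ), u₀) δ := by
      rw [← ball_prod_same]; exact ⟨hx, hu⟩
    have := hball _ hz
    have hfac : Polynomial.eval u ((Polynomial.X - Polynomial.C u₀) ^ j * P₁) +
        x * Polynomial.eval u ((Polynomial.X - Polynomial.C u₀) ^ j * Q₁) =
        (u - u₀) ^ j * (P₁.eval u + x * Q₁.eval u) := by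
      simp; ring
    rw [hfac, norm_mul, norm_pow, Real.mul_rpow (by positivity) (by positivity), mul_comm,
      ← Real.rpow_natCast_mul (norm_nonneg _)]
    gcongr ?_ * _
    exact Real.rpow_le_rpow_of_nonpos hκ this.le (by linarith)
  refine hle.trans_lt ?_
  rw [lintegral_const_mul' _ _ (ENNReal.mul_ne_top ENNReal.ofReal_ne_top hx.ne)]
  exact ENNReal.mul_lt_top (ENNReal.mul_lt_top ENNReal.ofReal_lt_top hx) hu

lemma chartIntegral_lt_top_of_weight_lt {a c : ℝ} (ha0 : 0 < a) (ha : a < 1)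
    (hc0 : 0 < c) (hc : c < 1) (hac : 1 < a + c) {m e : ℕ}
    (hme : m * (a + c - 1) + e * (1 - a) < 1) (u₀ : ℂ) {P₁ Q₁ : Polynomial ℂ}
    (hP₁ : P₁.eval u₀ ≠ 0) (hQ₁ : Q₁.eval u₀ ≠ 0) :
    ∃ δ > 0, chartIntegral a c ((Polynomial.X - Polynomial.C u₀) ^ m * P₁)
      ((Polynomial.X - Polynomial.C u₀) ^ e * Q₁) δ (Metric.ball u₀ δ) < ⊤ := by
  set κ := min (‖P₁.eval u₀‖ / 2) (‖Q₁.eval u₀‖ / 2)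
  have hP' := norm_pos_iff.2 hP₁
  have hQ' := norm_pos_iff.2 hQ₁
  have hκ : 0 < κ := lt_min (half_pos hP') (half_pos hQ')
  have hcP : Continuous fun z : ℂ => ‖P₁.eval z‖ := by fun_prop
  have hcQ : Continuous fun z : ℂ => ‖Q₁.eval z‖ := by fun_prop
  have hev : ∀ᶠ z in nhds u₀, κ < ‖P₁.eval z‖ ∧ κ < ‖Q₁.eval z‖ := by
    refine (hcP.continuousAt.eventually (lt_mem_nhds ?_)).and
      (hcQ.continuousAt.eventually (lt_mem_nhds ?_))
    · exact (min_le_left _ _).trans_lt (half_lt_self hP')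
    · exact (min_le_right _ _).trans_lt (half_lt_self hQ')
  obtain ⟨δ, hδ, hball⟩ := Metric.eventually_nhds_iff_ball.1 hev
  refine ⟨δ, hδ, ?_⟩
  have hK := lintegral_norm_rpow_mul_norm_one_add_rpow_lt_top ha0 ha hc0 hc hac
  set K := ∫⁻ z : ℂ, ENNReal.ofReal (‖z‖ ^ (-2 * a) * ‖1 + z‖ ^ (-2 * c))
  set α := 2 - 2 * a - 2 * c
  set β := 2 * a - 2
  have hu := lintegral_ball_norm_sub_rpow_lt_top (s := m * α + e * β)
    (by simp only [α, β]; linarith) u₀ δ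
  have hne : ∀ᵐ u : ℂ, u ≠ u₀ := compl_mem_ae_iff.2 (measure_singleton u₀)
  have hle : chartIntegral a c ((Polynomial.X - Polynomial.C u₀) ^ m * P₁)
      ((Polynomial.X - Polynomial.C u₀) ^ e * Q₁) δ (Metric.ball u₀ δ) ≤
      ∫⁻ u in Metric.ball u₀ δ, ENNReal.ofReal (κ ^ α * κ ^ β) * K *
        ENNReal.ofReal (‖u - u₀‖ ^ (m * α + e * β)) := by
    refine setLIntegral_mono_ae' measurableSet_ball ?_
    filter_upwards [hne] with u hne hu
    obtain ⟨h1, h2⟩ := hball u hu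
    have hw : 0 < ‖u - u₀‖ := norm_pos_iff.2 (sub_ne_zero.2 hne)
    have hp : Polynomial.eval u ((Polynomial.X - Polynomial.C u₀) ^ m * P₁) =
        (u - u₀) ^ m * P₁.eval u := by simp
    have hq : Polynomial.eval u ((Polynomial.X - Polynomial.C u₀) ^ e * Q₁) =
        (u - u₀) ^ e * Q₁.eval u := by simp
    rw [hp, hq]
    refine (setLIntegral_le_lintegral _ _).trans ?_
    rw [lintegral_norm_rpow_mul_norm_add_mul_rpow a c
      (mul_ne_zero (pow_ne_zero _ (sub_ne_zero.2 hne)) (norm_pos_iff.1 (hκ.trans h1)))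
      (mul_ne_zero (pow_ne_zero _ (sub_ne_zero.2 hne)) (norm_pos_iff.1 (hκ.trans h2)))]
    rw [mul_assoc, mul_comm K, ← mul_assoc, ← ENNReal.ofReal_mul (by positivity)]
    gcongr ENNReal.ofReal ?_ * _
    rw [norm_mul, norm_mul, norm_pow, norm_pow, Real.mul_rpow (by positivity) (by positivity),
      Real.mul_rpow (by positivity) (by positivity), ← Real.rpow_natCast_mul (norm_nonneg _),
      ← Real.rpow_natCast_mul (norm_nonneg _), Real.rpow_add hw]
    have i1 : ‖P₁.eval u‖ ^ α ≤ κ ^ α :=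
      Real.rpow_le_rpow_of_nonpos hκ h1.le (by simp only [α]; linarith)
    have i2 : ‖Q₁.eval u‖ ^ β ≤ κ ^ β :=
      Real.rpow_le_rpow_of_nonpos hκ h2.le (by simp only [β]; linarith)
    calc _ = (‖P₁.eval u‖ ^ α * ‖Q₁.eval u‖ ^ β) *
          (‖u - u₀‖ ^ (m * α) * ‖u - u₀‖ ^ (e * β)) := by ring
      _ ≤ _ := by gcongr
  refine hle.trans_lt ?_
  rw [lintegral_const_mul' _ _ (ENNReal.mul_ne_top ENNReal.ofReal_ne_top hK.ne)]
  exact ENNReal.mul_lt_top (ENNReal.mul_lt_top ENNReal.ofReal_lt_top hK) hu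

/-- The numerical condition on the multiplicities `m` of `P` and `e` of `Q` at a point under which
`‖x‖ ^ (-2a) ‖P(u) + x Q(u)‖ ^ (-2c)` is integrable nearby. -/
def GoodMult (a c : ℝ) (m e : ℕ) : Prop :=
  m = 0 ∨ (m = 1 ∧ 1 ≤ e) ∨ m * (a + c - 1) + e * (1 - a) < 1

lemma exists_chartIntegral_ball_lt_top {a c : ℝ} (ha0 : 0 < a) (ha : a < 1)
    (hc0 : 0 < c) (hc : c < 1) (hac : 1 < a + c) {P Q : Polynomial ℂ} (hP : P ≠ 0) (hQ : Q ≠ 0)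
    (u₀ : ℂ) (hgood : GoodMult a c (P.rootMultiplicity u₀) (Q.rootMultiplicity u₀)) :
    ∃ δ > 0, chartIntegral a c P Q δ (Metric.ball u₀ δ) < ⊤ := by
  obtain ⟨P₁, hP₁, hP₁'⟩ := P.exists_eq_pow_rootMultiplicity_mul_and_not_dvd hP u₀
  obtain ⟨Q₁, hQ₁, hQ₁'⟩ := Q.exists_eq_pow_rootMultiplicity_mul_and_not_dvd hQ u₀
  rw [Polynomial.dvd_iff_isRoot] at hP₁' hQ₁'
  rcases hgood with h | ⟨h, h'⟩ | h
  · have := chartIntegral_lt_top_of_common_factor (a := a) (c := c) ha hc0 (j := 0) (by simp) u₀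
      (P₁ := P₁) (Q₁ := Q) hP₁'
    rw [h, pow_zero, one_mul] at hP₁
    rwa [pow_zero, one_mul, one_mul, ← hP₁] at this
  · obtain ⟨Q₂, hQ₂⟩ : (Polynomial.X - Polynomial.C u₀) ^ 1 ∣ Q :=
      (Polynomial.le_rootMultiplicity_iff hQ).1 h'
    have := chartIntegral_lt_top_of_common_factor (a := a) (c := c) ha hc0 (j := 1) (by simpa) u₀
      (P₁ := P₁) (Q₁ := Q₂) hP₁'
    rw [h] at hP₁
    rwa [← hP₁, ← hQ₂] at this
  · have := chartIntegral_lt_top_of_weight_lt ha0 ha hc0 hc hac h u₀ hP₁' hQ₁'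
    rwa [← hP₁, ← hQ₁] at this

lemma exists_chartIntegral_lt_top_of_isCompact {a c : ℝ} (ha0 : 0 < a) (ha : a < 1)
    (hc0 : 0 < c) (hc : c < 1) (hac : 1 < a + c) {P Q : Polynomial ℂ} (hP : P ≠ 0) (hQ : Q ≠ 0)
    (hgood : ∀ u, GoodMult a c (P.rootMultiplicity u) (Q.rootMultiplicity u)) {S : Set ℂ}
    (hS : IsCompact S) :
    ∃ ε > 0, chartIntegral a c P Q ε S < ⊤ := by
  refine hS.induction_on (p := fun S => ∃ ε > 0, chartIntegral a c P Q ε S < ⊤)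
    ⟨1, one_pos, by simp [chartIntegral]⟩ ?_ ?_ ?_
  · rintro s t hst ⟨ε, hε, h⟩
    exact ⟨ε, hε, (chartIntegral_mono le_rfl hst).trans_lt h⟩
  · rintro s t ⟨ε, hε, h⟩ ⟨ε', hε', h'⟩
    refine ⟨min ε ε', lt_min hε hε', (lintegral_union_le _ _ _).trans_lt ?_⟩
    exact ENNReal.add_lt_top.2
      ⟨(chartIntegral_mono (min_le_left _ _) subset_rfl).trans_lt h,
        (chartIntegral_mono (min_le_right _ _) subset_rfl).trans_lt h'⟩
  · intro u _
    obtain ⟨δ, hδ, h⟩ := exists_chartIntegral_ball_lt_top ha0 ha hc0 hc hac hP hQ u (hgood u)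
    exact ⟨_, mem_nhdsWithin_of_mem_nhds (Metric.ball_mem_nhds u hδ), δ, hδ, h⟩

lemma lintegral_sector_le_chartIntegral {F : ℂ × ℂ → ℂ} (hFm : Measurable F) {D : ℕ}
    {P Q : Polynomial ℂ} (hF : ∀ x u, F (x, x * u) = x ^ D * (P.eval u + x * Q.eval u))
    (c ε M : ℝ) :
    ∫⁻ z in {z : ℂ × ℂ | ‖z.1‖ < ε ∧ ‖z.2‖ ≤ M * ‖z.1‖}, ENNReal.ofReal (‖F z‖ ^ (-2 * c)) ≤
      chartIntegral (c * D - 1) c P Q ε (Metric.closedBall 0 M) := by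
  have hms : MeasurableSet {z : ℂ × ℂ | ‖z.1‖ < ε ∧ ‖z.2‖ ≤ M * ‖z.1‖} :=
    (measurableSet_lt (f := fun z : ℂ × ℂ => ‖z.1‖) (g := fun _ => ε)
      (by fun_prop) (by fun_prop)).inter
      (measurableSet_le (f := fun z : ℂ × ℂ => ‖z.2‖) (g := fun z => M * ‖z.1‖)
        (by fun_prop) (by fun_prop))
  have hm1 : Measurable fun z : ℂ × ℂ => ENNReal.ofReal (‖F z‖ ^ (-2 * c)) :=
    ((hFm.norm).pow_const _).ennreal_ofReal
  rw [← lintegral_indicator hms, lintegral_prod_eq_blowup (hm1.indicator hms)]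
  unfold chartIntegral
  have hcont : Continuous fun z : ℂ × ℂ => ‖P.eval z.2 + z.1 * Q.eval z.2‖ := by fun_prop
  have hm2 : Measurable fun z : ℂ × ℂ =>
      ENNReal.ofReal (‖z.2‖ ^ (-2 * (c * D - 1)) * ‖P.eval z.1 + z.2 * Q.eval z.1‖ ^ (-2 * c)) :=
    (((measurable_norm.comp measurable_snd).pow_const _).mul
      ((hcont.measurable.comp measurable_swap).pow_const _)).ennreal_ofReal
  rw [lintegral_lintegral_swap (μ := volume.restrict (Metric.closedBall 0 M))
    (ν := volume.restrict (Metric.ball 0 ε)) hm2.aemeasurable, ← lintegral_indicator measurableSet_ball]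
  have h0 : ∀ᵐ x : ℂ, x ≠ 0 := compl_mem_ae_iff.2 (measure_singleton 0)
  refine lintegral_mono_ae ?_
  filter_upwards [h0] with x hx
  have hx' : 0 < ‖x‖ := norm_pos_iff.2 hx
  by_cases hxε : ‖x‖ < ε
  · rw [Set.indicator_of_mem (by simpa using hxε), ← lintegral_indicator measurableSet_closedBall]
    refine lintegral_mono fun u => ?_
    by_cases hu : ‖u‖ ≤ M
    · rw [Set.indicator_of_mem (show (x, x * u) ∈ {z : ℂ × ℂ | ‖z.1‖ < ε ∧ ‖z.2‖ ≤ M * ‖z.1‖} from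
          ⟨hxε, by simp only [norm_mul]; rw [mul_comm]; gcongr⟩), Set.indicator_of_mem (by simpa using hu),
        ← ENNReal.ofReal_mul (by positivity), hF, norm_mul, norm_pow,
        Real.mul_rpow (by positivity) (by positivity), ← mul_assoc,
        ← Real.rpow_natCast_mul hx'.le, ← Real.rpow_natCast, ← Real.rpow_add hx']
      apply le_of_eq
      congr 3
      push_cast; ring
    · rw [Set.indicator_of_notMem, mul_zero]
      · exact zero_le
      · rintro ⟨_, h⟩
        rw [norm_mul, mul_comm] at h
        exact hu (le_of_mul_le_mul_right h hx')
  · refine le_trans (le_of_eq ?_) (zero_le)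
    simp [hxε]

/-- Integrability near the origin from the integrals in the two charts of the blow-up. -/
lemma exists_integrableOn_ball_of_chartIntegral_lt_top {F : ℂ × ℂ → ℂ} (hFm : Measurable F) {D : ℕ}
    {P Q P' Q' : Polynomial ℂ} (hF : ∀ x u, F (x, x * u) = x ^ D * (P.eval u + x * Q.eval u))
    (hF' : ∀ y v, F (y * v, y) = y ^ D * (P'.eval v + y * Q'.eval v)) {c ε ε' δ : ℝ}
    (hε : 0 < ε) (hε' : 0 < ε') (hδ : 0 < δ)
    (h : chartIntegral (c * D - 1) c P Q ε (Metric.closedBall 0 δ⁻¹) < ⊤)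
    (h' : chartIntegral (c * D - 1) c P' Q' ε' (Metric.closedBall 0 δ) < ⊤) :
    ∃ ε : ℝ, 0 < ε ∧
      IntegrableOn (fun p : ℂ × ℂ => ‖F p‖ ^ (-2 * c)) (Metric.ball (0 : ℂ × ℂ) ε) := by
  refine ⟨min ε ε', lt_min hε hε', ((hFm.norm).pow_const _).aestronglyMeasurable, ?_⟩
  rw [hasFiniteIntegral_iff_ofReal (Filter.Eventually.of_forall fun x => by positivity)]
  have h1 := (lintegral_sector_le_chartIntegral hFm hF c ε δ⁻¹).trans_lt h
  have h2 := (lintegral_sector_le_chartIntegral (F := F ∘ Prod.swap) (hFm.comp measurable_swap)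
    (fun y v => hF' y v) c ε' δ).trans_lt h'
  set S1 := {z : ℂ × ℂ | ‖z.1‖ < ε ∧ ‖z.2‖ ≤ δ⁻¹ * ‖z.1‖}
  set S2 := {z : ℂ × ℂ | ‖z.1‖ < ε' ∧ ‖z.2‖ ≤ δ * ‖z.1‖}
  have h3 : ∫⁻ z in Prod.swap ⁻¹' S2, ENNReal.ofReal (‖F z‖ ^ (-2 * c)) < ⊤ := by
    have := (Measure.measurePreserving_swap (μ := (volume : Measure ℂ)) (ν := (volume : Measure ℂ))
      ).setLIntegral_comp_preimage_emb MeasurableEquiv.prodComm.measurableEmbedding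
      (fun z => ENNReal.ofReal (‖(F ∘ Prod.swap) z‖ ^ (-2 * c))) S2
    rw [← Measure.volume_eq_prod] at this
    rw [← this] at h2
    simpa using h2
  refine (lintegral_mono_set (t := S1 ∪ Prod.swap ⁻¹' S2) ?_).trans_lt
    ((lintegral_union_le _ _ _).trans_lt (ENNReal.add_lt_top.2 ⟨h1, h3⟩))
  intro z hz
  rw [mem_ball_zero_iff, Prod.norm_def, max_lt_iff] at hz
  by_cases hle : ‖z.2‖ ≤ δ⁻¹ * ‖z.1‖
  · exact Or.inl ⟨hz.1.trans_le (min_le_left _ _), hle⟩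
  · refine Or.inr ⟨hz.2.trans_le (min_le_right _ _), ?_⟩
    simp only [Prod.fst_swap, Prod.snd_swap]
    rw [not_le, inv_mul_lt_iff₀ hδ] at hle
    exact hle.le

/-- If `‖P(u) + x Q(u)‖ ≤ C s ^ N` whenever `‖x‖ < s ^ A` and `‖u - u₀‖ < s ^ B`, then any exponent
`c` of local integrability is at most `(2A + B) / (DA + N)`. -/
lemma mul_le_of_integrableOn {F : ℂ × ℂ → ℂ} (hFm : Measurable F) {D : ℕ}
    {P Q : Polynomial ℂ} (hF : ∀ x u, F (x, x * u) = x ^ D * (P.eval u + x * Q.eval u))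
    (hQ : Q ≠ 0) {c ε : ℝ} (hc : 0 ≤ c) (hε : 0 < ε)
    (hint : IntegrableOn (fun p : ℂ × ℂ => ‖F p‖ ^ (-2 * c)) (Metric.ball (0 : ℂ × ℂ) ε))
    (u₀ : ℂ) {A B N : ℕ} (hA : 1 ≤ A) {C : ℝ} (hC : 0 < C)
    (hbound : ∀ s : ℝ, 0 < s → s < 1 → ∀ x u : ℂ, ‖x‖ < s ^ A → ‖u - u₀‖ < s ^ B →
      ‖P.eval u + x * Q.eval u‖ ≤ C * s ^ N) :
    c * (D * A + N) ≤ 2 * A + B := by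
  by_contra! hlt
  set η : ℝ := 2 * (c * (D * A + N) - (2 * A + B))
  have hη : 0 < η := by simp only [η]; linarith
  have hfin := hint.2
  rw [hasFiniteIntegral_iff_ofReal (Filter.Eventually.of_forall fun x => by positivity)] at hfin
  set I := ∫⁻ z in Metric.ball (0 : ℂ × ℂ) ε, ENNReal.ofReal (‖F z‖ ^ (-2 * c))
  have hm1 : Measurable fun z : ℂ × ℂ => ENNReal.ofReal (‖F z‖ ^ (-2 * c)) :=
    ((hFm.norm).pow_const _).ennreal_ofReal
  have hx0 : ∀ᵐ x : ℂ, x ≠ 0 := compl_mem_ae_iff.2 (measure_singleton 0)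
  have hx1 : ∀ᵐ x : ℂ, P + Polynomial.C x * Q ≠ 0 := by
    refine compl_mem_ae_iff.2 (Set.Subsingleton.measure_zero ?_ _)
    intro x (hx : P + _ = 0) y (hy : P + _ = 0)
    have : Polynomial.C (x - y) * Q = 0 := by
      rw [Polynomial.C_sub]; linear_combination hx - hy
    rcases mul_eq_zero.1 this with h | h
    · exact sub_eq_zero.1 (Polynomial.C_eq_zero.1 h)
    · exact absurd h hQ
  have key : ∀ s : ℝ, 0 < s → s < min 1 (ε / (‖u₀‖ + 2)) →
      ENNReal.ofReal (1 / 64 * C ^ (-2 * c) * s ^ (-η)) ≤ I := by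
    intro s hs hs'
    have hs1 : s < 1 := hs'.trans_le (min_le_left _ _)
    have hs2 : s * (‖u₀‖ + 2) < ε :=
      (lt_div_iff₀ (by positivity)).1 (hs'.trans_le (min_le_right _ _))
    have hsA : s ^ A ≤ s := pow_le_of_le_one hs.le hs1.le (by omega)
    have hsB : s ^ B ≤ 1 := pow_le_one₀ hs.le hs1.le
    have hsA0 : 0 < s ^ A := by positivity
    set X := Metric.ball (((3 / 4 * s ^ A : ℝ)) : ℂ) (s ^ A / 4)
    set U := Metric.ball u₀ (s ^ B)
    set κ := ENNReal.ofReal ((s ^ A / 2) ^ 2 * ((s ^ A) ^ D * (C * s ^ N)) ^ (-2 * c))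
    have hX : ∀ x ∈ X, s ^ A / 2 ≤ ‖x‖ ∧ ‖x‖ < s ^ A := by
      intro x hx
      rw [Metric.mem_ball, dist_eq_norm] at hx
      have e : ‖((3 / 4 * s ^ A : ℝ) : ℂ)‖ = 3 / 4 * s ^ A := by
        rw [Complex.norm_real, Real.norm_of_nonneg (by positivity)]
      have t1 := norm_sub_norm_le x ((3 / 4 * s ^ A : ℝ) : ℂ)
      have t2 := norm_sub_norm_le ((3 / 4 * s ^ A : ℝ) : ℂ) x
      rw [norm_sub_rev] at t2
      rw [e] at t1 t2
      constructor <;> linarith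
    have hle : ∫⁻ _ in X, ∫⁻ _ in U, κ ≤ I := by
      simp only [I]
      rw [← lintegral_indicator measurableSet_ball (fun z => ENNReal.ofReal (‖F z‖ ^ (-2 * c))),
        lintegral_prod_eq_blowup (hm1.indicator measurableSet_ball),
        ← lintegral_indicator measurableSet_ball]
      refine lintegral_mono_ae ?_
      filter_upwards [hx0, hx1] with x hx0 hx1
      by_cases hxX : x ∈ X
      swap
      · rw [Set.indicator_of_notMem hxX]; exact zero_le
      rw [Set.indicator_of_mem hxX, ← lintegral_indicator measurableSet_ball]
      have hu1 : ∀ᵐ u : ℂ, ¬ (P + Polynomial.C x * Q).IsRoot u :=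
        compl_mem_ae_iff.2 ((Polynomial.finite_setOfPred_isRoot hx1).measure_zero _)
      refine lintegral_mono_ae ?_
      filter_upwards [hu1] with u hu1
      by_cases huU : u ∈ U
      swap
      · rw [Set.indicator_of_notMem huU]; exact zero_le
      obtain ⟨hxl, hxr⟩ := hX x hxX
      rw [Metric.mem_ball, dist_eq_norm] at huU
      have hu_norm : ‖u‖ ≤ ‖u₀‖ + 1 := by
        have := norm_sub_norm_le u u₀
        linarith
      have hmem : (x, x * u) ∈ Metric.ball (0 : ℂ × ℂ) ε := by
        rw [mem_ball_zero_iff, Prod.norm_def, max_lt_iff]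
        have : 0 ≤ ‖u₀‖ := norm_nonneg _
        refine ⟨by nlinarith, ?_⟩
        simp only [norm_mul]
        calc ‖x‖ * ‖u‖ ≤ s * (‖u₀‖ + 1) := by gcongr; linarith
          _ < ε := by nlinarith
      rw [Set.indicator_of_mem hmem, Set.indicator_of_mem (by simpa [U, dist_eq_norm] using huU),
        ← ENNReal.ofReal_mul (by positivity)]
      refine ENNReal.ofReal_le_ofReal ?_
      have hne : F (x, x * u) ≠ 0 := by
        rw [hF]
        refine mul_ne_zero (pow_ne_zero _ hx0) fun h => hu1 ?_
        simpa [Polynomial.IsRoot] using h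
      gcongr ?_ ^ 2 * ?_
      refine Real.rpow_le_rpow_of_nonpos (norm_pos_iff.2 hne) ?_ (by linarith)
      rw [hF, norm_mul, norm_pow]
      gcongr
      exact hbound s hs hs1 x u hxr huU
    refine le_trans ?_ hle
    rw [lintegral_const, lintegral_const, Measure.restrict_apply_univ, Measure.restrict_apply_univ,
      Complex.volume_ball, Complex.volume_ball]
    have hpi : (1 : ENNReal) ≤ (NNReal.pi : ENNReal) := by
      exact_mod_cast (show (1 : ℝ) ≤ Real.pi by linarith [Real.pi_gt_three])
    have hval : 1 / 64 * C ^ (-2 * c) * s ^ (-η) =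
        (s ^ A / 2) ^ 2 * ((s ^ A) ^ D * (C * s ^ N)) ^ (-2 * c) * (s ^ B) ^ 2 *
          (s ^ A / 4) ^ 2 := by
      have e1 : s ^ (-η) = (s ^ A) ^ 4 * (s ^ B) ^ 2 * (s ^ (A * D + N)) ^ (-2 * c) := by
        rw [← pow_mul, ← pow_mul, ← Real.rpow_natCast, ← Real.rpow_natCast,
          ← Real.rpow_natCast_mul hs.le, ← Real.rpow_add hs, ← Real.rpow_add hs]
        congr 1
        simp only [η]; push_cast; ring
      have e2 : (s ^ A) ^ D * (C * s ^ N) = C * s ^ (A * D + N) := by ring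
      rw [e1, e2, Real.mul_rpow hC.le (by positivity)]
      ring
    rw [hval, ENNReal.ofReal_mul (by positivity), ENNReal.ofReal_mul (by positivity),
      ENNReal.ofReal_pow (p := s ^ B) (by positivity),
      ENNReal.ofReal_pow (p := s ^ A / 4) (by positivity)]
    gcongr
    · exact le_mul_of_one_le_right (zero_le) hpi
    · exact le_mul_of_one_le_right (zero_le) hpi
  have ht : Filter.Tendsto (fun s : ℝ => 1 / 64 * C ^ (-2 * c) * s ^ (-η)) (nhdsWithin 0 (Set.Ioi 0))
      Filter.atTop :=
    (tendsto_rpow_neg_nhdsGT_zero (neg_lt_zero.2 hη)).const_mul_atTop (by positivity)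
  have hsmall : ∀ᶠ s in nhdsWithin (0 : ℝ) (Set.Ioi 0), s < min 1 (ε / (‖u₀‖ + 2)) :=
    nhdsWithin_le_nhds (gt_mem_nhds (lt_min one_pos (by positivity)))
  obtain ⟨s, hs1, hs2, hs3⟩ :=
    ((ht.eventually_gt_atTop I.toReal).and (hsmall.and self_mem_nhdsWithin)).exists
  have := key s hs3 hs2
  rw [ENNReal.ofReal_le_iff_le_toReal hfin.ne] at this
  linarith

lemma lct₀_eq_of_forall {F : ℂ × ℂ → ℂ} {c₀ L : ℝ} (hc₀ : 0 ≤ c₀) (hL : c₀ < L)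
    (hint : ∀ c, c₀ < c → c < L → ∃ ε : ℝ, 0 < ε ∧
      IntegrableOn (fun p : ℂ × ℂ => ‖F p‖ ^ (-2 * c)) (Metric.ball (0 : ℂ × ℂ) ε) volume)
    (hub : ∀ c ε : ℝ, 0 ≤ c → 0 < ε →
      IntegrableOn (fun p : ℂ × ℂ => ‖F p‖ ^ (-2 * c)) (Metric.ball (0 : ℂ × ℂ) ε) volume →
      c ≤ L) : lct₀ F = L := by
  refine csSup_eq_of_forall_le_of_forall_lt_exists_gt ?_ ?_ ?_
  · obtain ⟨c, h1, h2⟩ := exists_between hL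
    exact ⟨c, hc₀.trans h1.le, hint c h1 h2⟩
  · rintro c ⟨hc, ε, hε, h⟩
    exact hub c ε hc hε h
  · intro w hw
    obtain ⟨c, h1, h2⟩ := exists_between (max_lt hw hL)
    exact ⟨c, ⟨hc₀.trans ((le_max_right _ _).trans h1.le),
      hint c ((le_max_right _ _).trans_lt h1) h2⟩, (le_max_left _ _).trans_lt h1⟩

lemma lct₀_comp_swap (F : ℂ × ℂ → ℂ) : lct₀ (F ∘ Prod.swap) = lct₀ F := by
  unfold lct₀
  congr! 7 with c ε
  have h := (Measure.measurePreserving_swap (μ := (volume : Measure ℂ))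
    (ν := (volume : Measure ℂ))).integrableOn_comp_preimage
    MeasurableEquiv.prodComm.measurableEmbedding (f := fun p => ‖F p‖ ^ (-2 * c))
    (s := Metric.ball 0 ε)
  rw [← Measure.volume_eq_prod] at h
  rw [← h]
  have : Prod.swap ⁻¹' Metric.ball (0 : ℂ × ℂ) ε = Metric.ball (0 : ℂ × ℂ) ε := by
    ext z
    simp [Prod.norm_def, and_comm]
  rw [this]
  rfl

/-- The function `F` on `ℂ²` is described in the two charts of the blow-up of the origin by
`x ^ D * (P(u) + x Q(u))` and `y ^ D * (P'(v) + y Q'(v))`. -/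
structure IsBlowupOf (F : ℂ × ℂ → ℂ) (D : ℕ) (P Q P' Q' : Polynomial ℂ) : Prop where
  measurable : Measurable F
  fst_chart : ∀ x u, F (x, x * u) = x ^ D * (P.eval u + x * Q.eval u)
  snd_chart : ∀ y v, F (y * v, y) = y ^ D * (P'.eval v + y * Q'.eval v)
  P_ne_zero : P ≠ 0
  Q_ne_zero : Q ≠ 0
  P'_ne_zero : P' ≠ 0
  Q'_ne_zero : Q' ≠ 0

lemma IsBlowupOf.exists_integrableOn_ball {F : ℂ × ℂ → ℂ} {D : ℕ} {P Q P' Q' : Polynomial ℂ}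
    (h : IsBlowupOf F D P Q P' Q') (hD : 2 ≤ D) {c : ℝ} (hc : 2 / (D + 1) < c) (hc' : c < 2 / D)
    (hgood : ∀ u, GoodMult (c * D - 1) c (P.rootMultiplicity u) (Q.rootMultiplicity u))
    (hgood' : GoodMult (c * D - 1) c (P'.rootMultiplicity 0) (Q'.rootMultiplicity 0)) :
    ∃ ε : ℝ, 0 < ε ∧
      IntegrableOn (fun p : ℂ × ℂ => ‖F p‖ ^ (-2 * c)) (Metric.ball (0 : ℂ × ℂ) ε) volume := by
  have hD' : (2 : ℝ) ≤ D := by exact_mod_cast hD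
  rw [div_lt_iff₀ (by positivity)] at hc
  rw [lt_div_iff₀ (by positivity)] at hc'
  have hc0 : 0 < c := by by_contra! hle; nlinarith
  have hc1 : c < 1 := by nlinarith
  obtain ⟨δ, hδ, hδ'⟩ := exists_chartIntegral_ball_lt_top (a := c * D - 1) (by nlinarith)
    (by linarith) hc0 hc1 (by linarith) h.P'_ne_zero h.Q'_ne_zero 0 hgood'
  obtain ⟨ε, hε, hε'⟩ := exists_chartIntegral_lt_top_of_isCompact (a := c * D - 1) (by nlinarith)
    (by linarith) hc0 hc1 (by linarith) h.P_ne_zero h.Q_ne_zero hgood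
    (isCompact_closedBall 0 (δ / 2)⁻¹)
  exact exists_integrableOn_ball_of_chartIntegral_lt_top h.measurable h.fst_chart h.snd_chart hε hδ
    (half_pos hδ) hε' ((chartIntegral_mono le_rfl
      (Metric.closedBall_subset_ball (half_lt_self hδ))).trans_lt hδ')

lemma goodMult_of_two_mul_le {D m e : ℕ} (hD : 2 ≤ D) (hm : 2 * m ≤ D) (he : 2 ≤ m → e ≤ 1) {c : ℝ}
    (hc : 2 / (D + 1) < c) (hc' : c < 2 / D) : GoodMult (c * D - 1) c m e := by
  have hD' : (2 : ℝ) ≤ D := by exact_mod_cast hD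
  rw [div_lt_iff₀ (by positivity)] at hc
  rw [lt_div_iff₀ (by positivity)] at hc'
  have hc0 : 0 < c := by by_contra! hle; nlinarith
  by_cases hem : e ≤ m
  · refine Or.inr (Or.inr ?_)
    have h1 : (e : ℝ) ≤ m := by exact_mod_cast hem
    have h2 : 2 * (m : ℝ) ≤ D := by exact_mod_cast hm
    nlinarith [mul_nonneg (sub_nonneg.2 h1) (sub_pos.2 hc').le, mul_nonneg (sub_nonneg.2 h2) hc0.le]
  · by_cases h0 : m = 0
    · exact Or.inl h0
    · exact Or.inr (Or.inl (by omega))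

lemma Polynomial.exists_norm_eval_le_of_norm_sub_lt (P : Polynomial ℂ) (u₀ : ℂ) :
    ∃ C > 0, ∀ u, ‖u - u₀‖ < 1 → ‖P.eval u‖ ≤ C := by
  obtain ⟨C, hC⟩ := (isCompact_closedBall u₀ 1).exists_bound_of_continuousOn
    (f := fun u => P.eval u) (by fun_prop)
  refine ⟨max C 1, by positivity, fun u hu => (hC u ?_).trans (le_max_left _ _)⟩
  rw [mem_closedBall_iff_norm]
  exact hu.le

lemma IsBlowupOf.lct₀_eq_two_div {F : ℂ × ℂ → ℂ} {D : ℕ} {P Q P' Q' : Polynomial ℂ}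
    (h : IsBlowupOf F D P Q P' Q') (hD : 2 ≤ D)
    (hm : ∀ u, 2 * P.rootMultiplicity u ≤ D)
    (he : ∀ u, 2 ≤ P.rootMultiplicity u → Q.rootMultiplicity u ≤ 1)
    (hm' : 2 * P'.rootMultiplicity 0 ≤ D)
    (he' : 2 ≤ P'.rootMultiplicity 0 → Q'.rootMultiplicity 0 ≤ 1) :
    lct₀ F = 2 / D := by
  have hD' : (2 : ℝ) ≤ D := by exact_mod_cast hD
  refine lct₀_eq_of_forall (c₀ := 2 / (D + 1)) (by positivity) (by gcongr; linarith)
    (fun c hc hc' => ?_) (fun c ε hc hε hint => ?_)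
  · exact h.exists_integrableOn_ball hD hc hc'
      (fun u => goodMult_of_two_mul_le hD (hm u) (he u) hc hc')
      (goodMult_of_two_mul_le hD hm' he' hc hc')
  · obtain ⟨C₁, hC₁, h₁⟩ := P.exists_norm_eval_le_of_norm_sub_lt 0
    obtain ⟨C₂, hC₂, h₂⟩ := Q.exists_norm_eval_le_of_norm_sub_lt 0
    have := mul_le_of_integrableOn h.measurable h.fst_chart h.Q_ne_zero hc hε hint 0
      (A := 1) (B := 0) (N := 0) le_rfl (C := C₁ + C₂) (by positivity) ?_
    · rw [le_div_iff₀ (by positivity)]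
      push_cast at this
      linarith
    · intro s hs hs1 x u hx hu
      rw [pow_zero] at hu
      rw [pow_one] at hx
      calc _ ≤ ‖P.eval u‖ + ‖x‖ * ‖Q.eval u‖ := by rw [← norm_mul]; exact norm_add_le _ _
        _ ≤ C₁ + 1 * C₂ := by
          gcongr
          · exact h₁ u hu
          · linarith
          · exact h₂ u hu
        _ = _ := by ring

lemma IsBlowupOf.lct₀_eq_of_lt_two_mul {F : ℂ × ℂ → ℂ} {D : ℕ} {P Q P' Q' : Polynomial ℂ}
    (h : IsBlowupOf F D P Q P' Q') (hD : 2 ≤ D) {u₀ : ℂ} {m e : ℕ}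
    (hm₀ : P.rootMultiplicity u₀ = m) (he₀ : Q.rootMultiplicity u₀ = e)
    (hDm : D < 2 * m) (he1 : e ≤ 1)
    (hm : ∀ u, u ≠ u₀ → 2 * P.rootMultiplicity u ≤ D)
    (he : ∀ u, 2 ≤ P.rootMultiplicity u → Q.rootMultiplicity u ≤ 1)
    (hm' : 2 * P'.rootMultiplicity 0 ≤ D)
    (he' : 2 ≤ P'.rootMultiplicity 0 → Q'.rootMultiplicity 0 ≤ 1) :
    lct₀ F = (2 * (m - e : ℕ) + 1) / (D * (m - e : ℕ) + m) := by
  have hD' : (2 : ℝ) ≤ D := by exact_mod_cast hD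
  have hDm' : (D : ℝ) + 1 ≤ 2 * m := by exact_mod_cast hDm
  have he1' : (e : ℝ) ≤ 1 := by exact_mod_cast he1
  have hem : e ≤ m := by omega
  have hA0 : (0 : ℝ) ≤ (m - e : ℕ) := by positivity
  have hAe : ((m - e : ℕ) : ℝ) = m - e := by push_cast [hem]; rfl
  have hpos : (0 : ℝ) < D * (m - e : ℕ) + m := by
    have : (0 : ℝ) < m := by linarith
    positivity
  have hL : (2 * (m - e : ℕ) + 1) / (D * (m - e : ℕ) + m) ≤ (2 : ℝ) / D := by
    rw [div_le_div_iff₀ hpos (by positivity)]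
    nlinarith
  refine lct₀_eq_of_forall (c₀ := 2 / (D + 1)) (by positivity) ?_
    (fun c hc hc' => ?_) (fun c ε hc hε hint => ?_)
  · rw [div_lt_div_iff₀ (by positivity) hpos]
    nlinarith
  · refine h.exists_integrableOn_ball hD hc (hc'.trans_le hL) (fun u => ?_)
      (goodMult_of_two_mul_le hD hm' he' hc (hc'.trans_le hL))
    by_cases hu : u = u₀
    · refine Or.inr (Or.inr ?_)
      rw [hu, hm₀, he₀]
      rw [lt_div_iff₀ hpos, hAe] at hc'
      linarith
    · exact goodMult_of_two_mul_le hD (hm u hu) (he u) hc (hc'.trans_le hL)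
  · obtain ⟨P₁, hP₁⟩ := P.pow_rootMultiplicity_dvd u₀
    obtain ⟨Q₁, hQ₁⟩ := Q.pow_rootMultiplicity_dvd u₀
    rw [hm₀] at hP₁
    rw [he₀] at hQ₁
    obtain ⟨C₁, hC₁, h₁⟩ := P₁.exists_norm_eval_le_of_norm_sub_lt u₀
    obtain ⟨C₂, hC₂, h₂⟩ := Q₁.exists_norm_eval_le_of_norm_sub_lt u₀
    have := mul_le_of_integrableOn h.measurable h.fst_chart h.Q_ne_zero hc hε hint u₀
      (A := m - e) (B := 1) (N := m) (by omega) (C := C₁ + C₂) (by positivity) ?_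
    · rw [le_div_iff₀ hpos]
      push_cast at this ⊢
      exact this
    · intro s hs hs1 x u hx hu
      rw [pow_one] at hu
      have hP : P.eval u = (u - u₀) ^ m * P₁.eval u := by rw [hP₁]; simp
      have hQ : Q.eval u = (u - u₀) ^ e * Q₁.eval u := by rw [hQ₁]; simp
      calc _ ≤ ‖u - u₀‖ ^ m * ‖P₁.eval u‖ + ‖x‖ * (‖u - u₀‖ ^ e * ‖Q₁.eval u‖) := by
            rw [hP, hQ, ← norm_pow, ← norm_pow, ← norm_mul, ← norm_mul, ← norm_mul]
            exact norm_add_le _ _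
        _ ≤ s ^ m * C₁ + s ^ (m - e) * (s ^ e * C₂) := by
          gcongr
          · exact h₁ u (hu.trans hs1)
          · exact h₂ u (hu.trans hs1)
        _ = _ := by
          rw [← mul_assoc, ← pow_add, Nat.sub_add_cancel hem]
          ring

/-- Dehomogenization with respect to the first variable. -/
noncomputable def dehomFst : MvPolynomial (Fin 2) ℂ →ₐ[ℂ] Polynomial ℂ :=
  aeval ![1, Polynomial.X]

/-- Dehomogenization with respect to the second variable. -/
noncomputable def dehomSnd : MvPolynomial (Fin 2) ℂ →ₐ[ℂ] Polynomial ℂ :=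
  aeval ![Polynomial.X, 1]

/-- Exchange of the two variables. -/
noncomputable def swapVars : MvPolynomial (Fin 2) ℂ ≃ₐ[ℂ] MvPolynomial (Fin 2) ℂ :=
  renameEquiv ℂ (Equiv.swap 0 1)

@[simp] lemma swapVars_X_zero : swapVars (X 0) = X 1 := by simp [swapVars]

@[simp] lemma swapVars_X_one : swapVars (X 1) = X 0 := by simp [swapVars]

lemma dehomSnd_swapVars (g : MvPolynomial (Fin 2) ℂ) : dehomSnd (swapVars g) = dehomFst g := by
  have : dehomSnd.comp (swapVars : MvPolynomial (Fin 2) ℂ →ₐ[ℂ] MvPolynomial (Fin 2) ℂ) =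
      dehomFst := by
    ext i : 1
    fin_cases i <;> simp [dehomSnd, dehomFst]
  exact DFunLike.congr_fun this g

lemma dehomFst_swapVars (g : MvPolynomial (Fin 2) ℂ) : dehomFst (swapVars g) = dehomSnd g := by
  have : dehomFst.comp (swapVars : MvPolynomial (Fin 2) ℂ →ₐ[ℂ] MvPolynomial (Fin 2) ℂ) =
      dehomSnd := by
    ext i : 1
    fin_cases i <;> simp [dehomSnd, dehomFst]
  exact DFunLike.congr_fun this g

lemma MvPolynomial.IsHomogeneous.swapVars {g : MvPolynomial (Fin 2) ℂ} {n : ℕ}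
    (hg : g.IsHomogeneous n) : (swapVars g).IsHomogeneous n := by
  simpa [_root_.swapVars] using hg.rename_isHomogeneous (f := Equiv.swap (0 : Fin 2) 1)

lemma evalFun_swapVars (f : MvPolynomial (Fin 2) ℂ) :
    evalFun (swapVars f) = evalFun f ∘ Prod.swap := by
  funext p
  simp only [evalFun, swapVars, renameEquiv_apply, eval_rename, Function.comp_apply,
    Prod.fst_swap, Prod.snd_swap]
  congr 2
  ext i
  fin_cases i <;> simp

lemma MvPolynomial.IsHomogeneous.eval_fst_chart {g : MvPolynomial (Fin 2) ℂ} {n : ℕ}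
    (hg : g.IsHomogeneous n) (x u : ℂ) :
    eval ![x, x * u] g = x ^ n * (dehomFst g).eval u := by
  have h1 : (dehomFst g).eval u = MvPolynomial.eval ![1, u] g := by
    have : (Polynomial.aeval u).comp dehomFst = MvPolynomial.aeval ![1, u] := by
      ext i : 1
      fin_cases i <;> simp [dehomFst]
    have := DFunLike.congr_fun this g
    simpa [Polynomial.coe_aeval_eq_eval, aeval_eq_eval] using this
  rw [h1, eval_eq', eval_eq', Finset.mul_sum]
  refine Finset.sum_congr rfl fun d hd => ?_
  have hdeg : d 0 + d 1 = n := by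
    rw [hg.degree_eq_sum_deg_support hd, ← Fin.sum_univ_two]
    exact (Finset.sum_subset (Finset.subset_univ _) fun i _ hi => by simpa using hi).symm
  simp only [Fin.prod_univ_two, Matrix.cons_val_zero, Matrix.cons_val_one]
  rw [← hdeg]
  ring

lemma homogenize_dehomSnd {g : MvPolynomial (Fin 2) ℂ} {n : ℕ} (hg : g.IsHomogeneous n) :
    (dehomSnd g).homogenize n = g :=
  Polynomial.homogenize_eq_of_isHomogeneous hg rfl

lemma natDegree_dehomSnd_le {g : MvPolynomial (Fin 2) ℂ} {n : ℕ} (hg : g.IsHomogeneous n) :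
    (dehomSnd g).natDegree ≤ n := by
  refine (aeval_natDegree_le (n := 1) g hg.totalDegree_le _ fun i => ?_).trans_eq (mul_one n)
  fin_cases i <;> simp

lemma natDegree_dehomFst_le {g : MvPolynomial (Fin 2) ℂ} {n : ℕ} (hg : g.IsHomogeneous n) :
    (dehomFst g).natDegree ≤ n := by
  rw [← dehomSnd_swapVars]
  exact natDegree_dehomSnd_le hg.swapVars

lemma dehomSnd_ne_zero {g : MvPolynomial (Fin 2) ℂ} {n : ℕ} (hg : g.IsHomogeneous n)
    (h0 : g ≠ 0) : dehomSnd g ≠ 0 := by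
  intro h
  rw [← homogenize_dehomSnd hg, h, Polynomial.homogenize_zero] at h0
  exact h0 rfl

lemma dehomFst_ne_zero {g : MvPolynomial (Fin 2) ℂ} {n : ℕ} (hg : g.IsHomogeneous n)
    (h0 : g ≠ 0) : dehomFst g ≠ 0 := by
  rw [← dehomSnd_swapVars]
  exact dehomSnd_ne_zero hg.swapVars (by simpa using h0)

lemma sq_homogenize_dvd_of_sq_dvd_dehomSnd {g : MvPolynomial (Fin 2) ℂ} {n : ℕ}
    (hg : g.IsHomogeneous n) {v : ℂ} (h : (Polynomial.X - Polynomial.C v) ^ 2 ∣ dehomSnd g) :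
    (Polynomial.X - Polynomial.C v).homogenize 1 ^ 2 ∣ g := by
  by_cases h0 : g = 0
  · simp [h0]
  obtain ⟨r, hr⟩ := h
  have hdeg := natDegree_dehomSnd_le hg
  have hne := dehomSnd_ne_zero hg h0
  rw [hr] at hdeg hne
  rw [Polynomial.natDegree_mul (left_ne_zero_of_mul hne) (right_ne_zero_of_mul hne)] at hdeg
  simp only [Polynomial.natDegree_pow, Polynomial.natDegree_X_sub_C] at hdeg
  have := homogenize_dehomSnd hg
  obtain ⟨k, rfl⟩ : ∃ k, n = 1 + 1 + k := ⟨n - 2, by omega⟩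
  rw [hr, Polynomial.homogenize_mul _ _ (by simp) (by omega), sq, Polynomial.homogenize_mul _ _
    (by simp) (by simp), ← sq] at this
  exact ⟨_, this.symm⟩

lemma not_isUnit_homogenize_X_sub_C (v : ℂ) :
    ¬ IsUnit ((Polynomial.X - Polynomial.C v).homogenize 1) := by
  intro h
  have := h.map (eval ![v, 1])
  rw [Polynomial.homogenize_sub, Polynomial.homogenize_X one_ne_zero,
    Polynomial.homogenize_C] at this
  simp at this

lemma rootMultiplicity_dehomSnd_le_one {g h : MvPolynomial (Fin 2) ℂ} {n k : ℕ}
    (hg : g.IsHomogeneous n) (hh : h.IsHomogeneous k) (hg0 : g ≠ 0) (hh0 : h ≠ 0)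
    (hsq : Squarefree (g + h)) (v : ℂ) (hm : 2 ≤ (dehomSnd g).rootMultiplicity v) :
    (dehomSnd h).rootMultiplicity v ≤ 1 := by
  by_contra! he
  have h1 := sq_homogenize_dvd_of_sq_dvd_dehomSnd hg
    ((Polynomial.le_rootMultiplicity_iff (dehomSnd_ne_zero hg hg0)).1 hm)
  have h2 := sq_homogenize_dvd_of_sq_dvd_dehomSnd hh
    ((Polynomial.le_rootMultiplicity_iff (dehomSnd_ne_zero hh hh0)).1 he)
  refine not_isUnit_homogenize_X_sub_C v (hsq _ ?_)
  rw [← sq]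
  exact dvd_add h1 h2

lemma Squarefree.swapVars {f : MvPolynomial (Fin 2) ℂ} (hf : Squarefree f) :
    Squarefree (swapVars f) := by
  intro p hp
  have := hf (_root_.swapVars.symm p) ?_
  · simpa using this
  · simpa using map_dvd _root_.swapVars.symm hp

lemma rootMultiplicity_dehomFst_le_one {g h : MvPolynomial (Fin 2) ℂ} {n k : ℕ}
    (hg : g.IsHomogeneous n) (hh : h.IsHomogeneous k) (hg0 : g ≠ 0) (hh0 : h ≠ 0)
    (hsq : Squarefree (g + h)) (v : ℂ) (hm : 2 ≤ (dehomFst g).rootMultiplicity v) :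
    (dehomFst h).rootMultiplicity v ≤ 1 := by
  rw [← dehomSnd_swapVars] at hm ⊢
  refine rootMultiplicity_dehomSnd_le_one hg.swapVars hh.swapVars (by simpa using hg0)
    (by simpa using hh0) ?_ v hm
  rw [← map_add]
  exact hsq.swapVars

lemma isBlowupOf_evalFun_add {g h : MvPolynomial (Fin 2) ℂ} {D : ℕ}
    (hg : g.IsHomogeneous D) (hh : h.IsHomogeneous (D + 1)) (hg0 : g ≠ 0) (hh0 : h ≠ 0) :
    IsBlowupOf (evalFun (g + h)) D (dehomFst g) (dehomFst h) (dehomSnd g) (dehomSnd h) := by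
  have key : ∀ {g h : MvPolynomial (Fin 2) ℂ}, g.IsHomogeneous D → h.IsHomogeneous (D + 1) →
      ∀ x u, evalFun (g + h) (x, x * u) =
        x ^ D * ((dehomFst g).eval u + x * (dehomFst h).eval u) := by
    intro g h hg hh x u
    simp only [evalFun, map_add]
    rw [hg.eval_fst_chart, hh.eval_fst_chart]
    ring
  refine ⟨?_, key hg hh, fun y v => ?_, dehomFst_ne_zero hg hg0, dehomFst_ne_zero hh hh0,
    dehomSnd_ne_zero hg hg0, dehomSnd_ne_zero hh hh0⟩
  · refine Continuous.measurable ((MvPolynomial.continuous_eval _).comp ?_)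
    refine continuous_pi fun i => ?_
    fin_cases i <;> simp <;> fun_prop
  · have := key hg.swapVars hh.swapVars y v
    rw [← map_add, evalFun_swapVars, dehomFst_swapVars, dehomFst_swapVars] at this
    exact this

/-- Distinct points of the line carry total multiplicity at most the degree. -/
lemma rootMultiplicity_dehomFst_add_le {g : MvPolynomial (Fin 2) ℂ} {n : ℕ}
    (hg : g.IsHomogeneous n) (hg0 : g ≠ 0) {u v : ℂ} (huv : u ≠ v) :
    (dehomFst g).rootMultiplicity u + (dehomFst g).rootMultiplicity v ≤ n := by
  have hne := dehomFst_ne_zero hg hg0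
  have hcop : IsCoprime ((Polynomial.X - Polynomial.C u) ^ (dehomFst g).rootMultiplicity u)
      ((Polynomial.X - Polynomial.C v) ^ (dehomFst g).rootMultiplicity v) :=
    (Polynomial.isCoprime_X_sub_C_of_isUnit_sub (sub_ne_zero.2 huv).isUnit).pow
  have hdvd := hcop.mul_dvd ((dehomFst g).pow_rootMultiplicity_dvd u)
    ((dehomFst g).pow_rootMultiplicity_dvd v)
  have := (Polynomial.natDegree_le_of_dvd hdvd hne).trans (natDegree_dehomFst_le hg)
  rw [Polynomial.natDegree_mul (pow_ne_zero _ (Polynomial.X_sub_C_ne_zero _))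
    (pow_ne_zero _ (Polynomial.X_sub_C_ne_zero _))] at this
  simpa using this

lemma rootMultiplicity_dehomFst_add_rootMultiplicity_dehomSnd_le {g : MvPolynomial (Fin 2) ℂ}
    {n : ℕ} (hg : g.IsHomogeneous n) (hg0 : g ≠ 0) (u : ℂ) :
    (dehomFst g).rootMultiplicity u + (dehomSnd g).rootMultiplicity 0 ≤ n := by
  set m := (dehomSnd g).rootMultiplicity 0
  obtain ⟨r, hr⟩ := (dehomSnd g).pow_rootMultiplicity_dvd 0
  rw [Polynomial.C_0, sub_zero] at hr
  have hne := dehomSnd_ne_zero hg hg0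
  have hdeg := natDegree_dehomSnd_le hg
  rw [hr] at hne hdeg
  rw [Polynomial.natDegree_mul (left_ne_zero_of_mul hne) (right_ne_zero_of_mul hne),
    Polynomial.natDegree_X_pow] at hdeg
  obtain ⟨k, rfl⟩ : ∃ k, n = m + k := ⟨n - m, by omega⟩
  have hg' := homogenize_dehomSnd hg
  rw [hr, Polynomial.homogenize_mul _ _ (by simp [m]) (by omega),
    Polynomial.homogenize_X_pow le_rfl] at hg'
  have hF : dehomFst g = dehomFst (r.homogenize k) := by
    rw [← hg']
    simp [dehomFst]
  have hle : (dehomFst g).natDegree ≤ k := by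
    rw [hF]; exact natDegree_dehomFst_le (Polynomial.isHomogeneous_homogenize r)
  have := Polynomial.natDegree_le_of_dvd ((dehomFst g).pow_rootMultiplicity_dvd u)
    (dehomFst_ne_zero hg hg0)
  simp at this
  omega

lemma lct₀_evalFun_add_eq_two_div {g h : MvPolynomial (Fin 2) ℂ} {D : ℕ} (hD : 2 ≤ D)
    (hg : g.IsHomogeneous D) (hh : h.IsHomogeneous (D + 1)) (hg0 : g ≠ 0) (hh0 : h ≠ 0)
    (hsq : Squarefree (g + h)) (hm : ∀ u, 2 * (dehomFst g).rootMultiplicity u ≤ D)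
    (hm' : 2 * (dehomSnd g).rootMultiplicity 0 ≤ D) :
    lct₀ (evalFun (g + h)) = 2 / D :=
  (isBlowupOf_evalFun_add hg hh hg0 hh0).lct₀_eq_two_div hD hm
    (fun u hu => rootMultiplicity_dehomFst_le_one hg hh hg0 hh0 hsq u hu) hm'
    (fun hu => rootMultiplicity_dehomSnd_le_one hg hh hg0 hh0 hsq 0 hu)

lemma lct₀_evalFun_add_eq_of_lt_two_mul {g h : MvPolynomial (Fin 2) ℂ} {D : ℕ} (hD : 2 ≤ D)
    (hg : g.IsHomogeneous D) (hh : h.IsHomogeneous (D + 1)) (hg0 : g ≠ 0) (hh0 : h ≠ 0)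
    (hsq : Squarefree (g + h)) {u : ℂ} {m e : ℕ} (hm : (dehomFst g).rootMultiplicity u = m)
    (he : (dehomFst h).rootMultiplicity u = e) (hDm : D < 2 * m) :
    lct₀ (evalFun (g + h)) = (2 * (m - e : ℕ) + 1) / (D * (m - e : ℕ) + m) := by
  refine (isBlowupOf_evalFun_add hg hh hg0 hh0).lct₀_eq_of_lt_two_mul hD hm he hDm ?_ ?_
    (fun v hv => rootMultiplicity_dehomFst_le_one hg hh hg0 hh0 hsq v hv) ?_
    (fun hv => rootMultiplicity_dehomSnd_le_one hg hh hg0 hh0 hsq 0 hv)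
  · rw [← he]
    exact rootMultiplicity_dehomFst_le_one hg hh hg0 hh0 hsq u (by omega)
  · intro v hv
    have := rootMultiplicity_dehomFst_add_le hg hg0 hv
    omega
  · have := rootMultiplicity_dehomFst_add_rootMultiplicity_dehomSnd_le hg hg0 u
    omega

/-- The possible thresholds of a square-free sum of binary forms of degrees `D` and `D + 1`. -/
lemma lct₀_evalFun_add_mem_of_lt_two_mul {g h : MvPolynomial (Fin 2) ℂ} {D : ℕ} (hD : 2 ≤ D)
    (hg : g.IsHomogeneous D) (hh : h.IsHomogeneous (D + 1)) (hg0 : g ≠ 0) (hh0 : h ≠ 0)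
    (hsq : Squarefree (g + h)) {u : ℂ} (hDm : D < 2 * (dehomFst g).rootMultiplicity u) :
    (∃ k : ℕ, D / 2 ≤ k ∧ k + 1 ≤ D ∧
      lct₀ (evalFun (g + h)) = (2 * k + 1) / (k * (D + 1) + 1)) ∨
    ∃ k : ℕ, (D + 2) / 2 ≤ k ∧ k ≤ D ∧
      lct₀ (evalFun (g + h)) = (2 * k + 1) / (k * (D + 1)) := by
  obtain ⟨m, hm⟩ : ∃ m, (dehomFst g).rootMultiplicity u = m := ⟨_, rfl⟩
  have hmD : m ≤ D := by
    have := rootMultiplicity_dehomFst_add_rootMultiplicity_dehomSnd_le hg hg0 u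
    omega
  have he1 := rootMultiplicity_dehomFst_le_one hg hh hg0 hh0 hsq u (by omega)
  rw [hm] at hDm
  rcases Nat.le_one_iff_eq_zero_or_eq_one.1 he1 with he | he
  · refine .inr ⟨m, by omega, hmD, ?_⟩
    rw [lct₀_evalFun_add_eq_of_lt_two_mul hD hg hh hg0 hh0 hsq hm he hDm, Nat.sub_zero]
    ring_nf
  · obtain ⟨k, rfl⟩ : ∃ k, m = k + 1 := ⟨m - 1, by omega⟩
    refine .inl ⟨k, by omega, hmD, ?_⟩
    rw [lct₀_evalFun_add_eq_of_lt_two_mul hD hg hh hg0 hh0 hsq hm he hDm, Nat.add_sub_cancel]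
    push_cast
    ring_nf

lemma lct₀_evalFun_add_mem {g h : MvPolynomial (Fin 2) ℂ} {D : ℕ} (hD : 2 ≤ D)
    (hg : g.IsHomogeneous D) (hh : h.IsHomogeneous (D + 1)) (hg0 : g ≠ 0) (hh0 : h ≠ 0)
    (hsq : Squarefree (g + h)) :
    lct₀ (evalFun (g + h)) = 2 / D ∨
    (∃ k : ℕ, D / 2 ≤ k ∧ k + 1 ≤ D ∧
      lct₀ (evalFun (g + h)) = (2 * k + 1) / (k * (D + 1) + 1)) ∨
    ∃ k : ℕ, (D + 2) / 2 ≤ k ∧ k ≤ D ∧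
      lct₀ (evalFun (g + h)) = (2 * k + 1) / (k * (D + 1)) := by
  by_cases h1 : ∃ u, D < 2 * (dehomFst g).rootMultiplicity u
  · obtain ⟨u, hu⟩ := h1
    exact .inr (lct₀_evalFun_add_mem_of_lt_two_mul hD hg hh hg0 hh0 hsq hu)
  by_cases h2 : D < 2 * (dehomSnd g).rootMultiplicity 0
  · rw [← dehomFst_swapVars] at h2
    have := lct₀_evalFun_add_mem_of_lt_two_mul hD hg.swapVars hh.swapVars (by simpa using hg0)
      (by simpa using hh0) (by rw [← map_add]; exact hsq.swapVars) h2
    rw [← map_add, evalFun_swapVars, lct₀_comp_swap] at this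
    exact .inr this
  · push Not at h1 h2
    exact .inl (lct₀_evalFun_add_eq_two_div hD hg hh hg0 hh0 hsq h1 h2)

/-- A repeated factor of a sum of forms of consecutive degrees divides both forms. -/
lemma MvPolynomial.squarefree_add_of_isHomogeneous {g h : MvPolynomial (Fin 2) ℂ} {D : ℕ}
    (hg : g.IsHomogeneous D) (hh : h.IsHomogeneous (D + 1)) (h0 : g + h ≠ 0)
    (H : ∀ p, Irreducible p → p ∣ g → p ∣ h → ¬ p * p ∣ g + h) : Squarefree (g + h) := by
  rw [squarefree_iff_irreducible_sq_not_dvd_of_ne_zero h0]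
  intro p hp hpp
  have hder : ∀ i, p ∣ pderiv i (g + h) := by
    obtain ⟨q, hq⟩ := hpp
    intro i
    rw [hq, Derivation.leibniz, Derivation.leibniz]
    simp only [smul_eq_mul]
    refine dvd_add ⟨p * pderiv i q, by ring⟩ ⟨q * (pderiv i p + pderiv i p), by ring⟩
  have hE : p ∣ D • g + (D + 1) • h := by
    rw [← hg.sum_X_mul_pderiv, ← hh.sum_X_mul_pderiv, ← Finset.sum_add_distrib]
    refine Finset.dvd_sum fun i _ => ?_
    rw [← mul_add, ← map_add]
    exact (hder i).mul_left _
  have hs : p ∣ g + h := (dvd_mul_right p p).trans hpp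
  have hph : p ∣ h := by
    have := dvd_sub hE (hs.mul_left (D : MvPolynomial (Fin 2) ℂ))
    convert this using 1
    simp only [nsmul_eq_mul]
    push_cast
    ring
  exact H p hp ((dvd_add_left hph).1 hs) hph hpp

lemma exists_of_isHomogeneous_add {g h : MvPolynomial (Fin 2) ℂ} {D : ℕ}
    (hg : g.IsHomogeneous D) (hh : h.IsHomogeneous (D + 1)) (hg0 : g ≠ 0) (hh0 : h ≠ 0) :
    (g + h).totalDegree = D + 1 ∧ (∀ i < D, homogeneousComponent i (g + h) = 0) ∧
      homogeneousComponent D (g + h) ≠ 0 := by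
  refine ⟨?_, fun i hi => ?_, ?_⟩
  · rw [totalDegree_add_eq_right_of_totalDegree_lt, hh.totalDegree hh0]
    rw [hh.totalDegree hh0, hg.totalDegree hg0]
    exact Nat.lt_succ_self D
  · rw [map_add, homogeneousComponent_of_mem hg, homogeneousComponent_of_mem hh,
      if_neg (by omega), if_neg (by omega), add_zero]
  · rw [map_add, homogeneousComponent_of_mem hg, homogeneousComponent_of_mem hh,
      if_pos rfl, if_neg (by omega), add_zero]
    exact hg0

lemma eq_add_homogeneousComponent {f : MvPolynomial (Fin 2) ℂ} {D : ℕ}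
    (hf : f.totalDegree = D + 1) (hlow : ∀ i < D, homogeneousComponent i f = 0) :
    homogeneousComponent D f + homogeneousComponent (D + 1) f = f := by
  conv_rhs => rw [← sum_homogeneousComponent f, hf, Finset.sum_range_succ, Finset.sum_range_succ,
    Finset.sum_eq_zero fun i hi => hlow i (Finset.mem_range.1 hi), zero_add]

lemma homogeneousComponent_totalDegree_ne_zero {f : MvPolynomial (Fin 2) ℂ} {D : ℕ}
    (hf : f.totalDegree = D + 1) : homogeneousComponent (D + 1) f ≠ 0 := by
  intro h
  have hf' : f.support.Nonempty := by
    rw [Finset.nonempty_iff_ne_empty, Ne, support_eq_empty]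
    rintro rfl
    simp at hf
  obtain ⟨s, hs, hs'⟩ := Finset.exists_mem_eq_sup f.support hf' fun s => s.sum fun _ e => e
  have := congrArg (coeff s) h
  rw [coeff_homogeneousComponent, if_pos, coeff_zero] at this
  · exact mem_support_iff.1 hs this
  · rw [← hf, totalDegree, hs']
    rfl

lemma MvPolynomial.X_dvd_of_irreducible_of_dvd_X_pow {p : MvPolynomial (Fin 2) ℂ}
    (hp : Irreducible p) {i : Fin 2} {n : ℕ} (h : p ∣ X i ^ n) : X i ∣ p :=
  hp.dvd_symm (X_prime.irreducible) (hp.prime.dvd_of_dvd_pow h)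

lemma MvPolynomial.not_X_zero_dvd {f : MvPolynomial (Fin 2) ℂ} (hf : eval ![0, 1] f ≠ 0) :
    ¬ X 0 ∣ f := by
  rintro ⟨q, rfl⟩
  simp at hf

lemma MvPolynomial.not_X_one_dvd {f : MvPolynomial (Fin 2) ℂ} (hf : eval ![1, 0] f ≠ 0) :
    ¬ X 1 ∣ f := by
  rintro ⟨q, rfl⟩
  simp at hf

lemma isHomogeneous_X_one_pow_mul_X_zero_pow {m D : ℕ} (hm : m ≤ D) :
    (X 1 ^ m * X 0 ^ (D - m) : MvPolynomial (Fin 2) ℂ).IsHomogeneous D := by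
  have := (isHomogeneous_X_pow (R := ℂ) (1 : Fin 2) m).mul (isHomogeneous_X_pow 0 (D - m))
  rwa [Nat.add_sub_cancel' hm] at this

lemma X_one_pow_mul_X_zero_pow_ne_zero (m n : ℕ) :
    (X 1 ^ m * X 0 ^ n : MvPolynomial (Fin 2) ℂ) ≠ 0 :=
  mul_ne_zero (pow_ne_zero _ (X_ne_zero _)) (pow_ne_zero _ (X_ne_zero _))

lemma isHomogeneous_X_zero_pow_add_X_one_pow (n : ℕ) :
    (X 0 ^ n + X 1 ^ n : MvPolynomial (Fin 2) ℂ).IsHomogeneous n :=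
  (isHomogeneous_X_pow 0 n).add (isHomogeneous_X_pow 1 n)

lemma eval_X_zero_pow_add_X_one_pow_ne_zero {n : ℕ} (hn : n ≠ 0) :
    eval ![0, 1] (X 0 ^ n + X 1 ^ n : MvPolynomial (Fin 2) ℂ) ≠ 0 ∧
      eval ![1, 0] (X 0 ^ n + X 1 ^ n : MvPolynomial (Fin 2) ℂ) ≠ 0 := by
  simp [hn]

lemma X_zero_pow_add_X_one_pow_ne_zero {n : ℕ} (hn : n ≠ 0) :
    (X 0 ^ n + X 1 ^ n : MvPolynomial (Fin 2) ℂ) ≠ 0 := fun h =>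
  (eval_X_zero_pow_add_X_one_pow_ne_zero hn).1 (by rw [h, map_zero])

lemma rootMultiplicity_zero_dehomFst_X_one_pow_mul (m n : ℕ) :
    (dehomFst (X 1 ^ m * X 0 ^ n)).rootMultiplicity 0 = m := by
  have := Polynomial.rootMultiplicity_X_sub_C_pow (0 : ℂ) m
  simpa [dehomFst] using this

lemma add_ne_zero_of_isHomogeneous {g h : MvPolynomial (Fin 2) ℂ} {D : ℕ}
    (hg : g.IsHomogeneous D) (hh : h.IsHomogeneous (D + 1)) (hg0 : g ≠ 0) (hh0 : h ≠ 0) :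
    g + h ≠ 0 := by
  intro h0
  have := (exists_of_isHomogeneous_add hg hh hg0 hh0).1
  rw [h0] at this
  simp at this

/-- Square-free polynomials of degree `D + 1` and multiplicity `D` at the origin. -/
def IsMultPredCurve (D : ℕ) (f : MvPolynomial (Fin 2) ℂ) : Prop :=
  Squarefree f ∧ f.totalDegree = D + 1 ∧ (∀ i < D, homogeneousComponent i f = 0) ∧
    homogeneousComponent D f ≠ 0

lemma exists_isMultPredCurve_lct₀_eq_two_div {D : ℕ} (hD : 2 ≤ D) :
    ∃ f, IsMultPredCurve D f ∧ lct₀ (evalFun f) = 2 / D := by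
  have hg := isHomogeneous_X_zero_pow_add_X_one_pow D
  have hh := isHomogeneous_X_pow (R := ℂ) (0 : Fin 2) (D + 1)
  have hg0 := X_zero_pow_add_X_one_pow_ne_zero (n := D) (by omega)
  have hh0 : (X 0 ^ (D + 1) : MvPolynomial (Fin 2) ℂ) ≠ 0 := pow_ne_zero _ (X_ne_zero _)
  have hsq := squarefree_add_of_isHomogeneous hg hh (add_ne_zero_of_isHomogeneous hg hh hg0 hh0)
    fun p hp hpg hph _ => not_X_zero_dvd (eval_X_zero_pow_add_X_one_pow_ne_zero (by omega)).1
      ((X_dvd_of_irreducible_of_dvd_X_pow hp hph).trans hpg)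
  have hroot : ∀ u, ((Polynomial.X : Polynomial ℂ) ^ D + 1).rootMultiplicity u ≤ 1 := by
    intro u
    have := Polynomial.separable_X_pow_sub_C (n := D) (-1 : ℂ)
      (by exact_mod_cast (by omega : D ≠ 0)) (by simp)
    simpa using Polynomial.rootMultiplicity_le_one_of_separable this u
  refine ⟨_, ⟨hsq, exists_of_isHomogeneous_add hg hh hg0 hh0⟩,
    lct₀_evalFun_add_eq_two_div hD hg hh hg0 hh0 hsq (fun u => ?_) ?_⟩
  · have := hroot u
    simp only [dehomFst, map_add, map_pow, aeval_X, Matrix.cons_val_zero, Matrix.cons_val_one,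
      one_pow, add_comm (1 : Polynomial ℂ)]
    omega
  · have := hroot 0
    simp only [dehomSnd, map_add, map_pow, aeval_X, Matrix.cons_val_zero, Matrix.cons_val_one,
      one_pow]
    omega

lemma exists_isMultPredCurve_lct₀_eq_div_mul {D k : ℕ} (hD : 2 ≤ D) (hk : (D + 2) / 2 ≤ k)
    (hkD : k ≤ D) :
    ∃ f, IsMultPredCurve D f ∧ lct₀ (evalFun f) = (2 * k + 1) / (k * (D + 1)) := by
  have hg := isHomogeneous_X_one_pow_mul_X_zero_pow hkD
  have hh := isHomogeneous_X_zero_pow_add_X_one_pow (D + 1)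
  have hg0 := X_one_pow_mul_X_zero_pow_ne_zero k (D - k)
  have hh0 := X_zero_pow_add_X_one_pow_ne_zero (n := D + 1) (by omega)
  have hev := eval_X_zero_pow_add_X_one_pow_ne_zero (n := D + 1) (by omega)
  have hsq := squarefree_add_of_isHomogeneous hg hh (add_ne_zero_of_isHomogeneous hg hh hg0 hh0)
    fun p hp hpg hph _ => (hp.prime.dvd_or_dvd hpg).elim
      (fun h1 => not_X_one_dvd hev.2 ((X_dvd_of_irreducible_of_dvd_X_pow hp h1).trans hph))
      (fun h1 => not_X_zero_dvd hev.1 ((X_dvd_of_irreducible_of_dvd_X_pow hp h1).trans hph))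
  refine ⟨_, ⟨hsq, exists_of_isHomogeneous_add hg hh hg0 hh0⟩, ?_⟩
  rw [lct₀_evalFun_add_eq_of_lt_two_mul (u := 0) (m := k) (e := 0) hD hg hh hg0 hh0 hsq
    (rootMultiplicity_zero_dehomFst_X_one_pow_mul _ _) ?_ (by omega), Nat.sub_zero]
  · ring_nf
  · exact Polynomial.rootMultiplicity_eq_zero (by simp [dehomFst])

lemma exists_isMultPredCurve_lct₀_eq_div_mul_add_one {D k : ℕ} (hD : 2 ≤ D) (hk : D / 2 ≤ k)
    (hkD : k + 1 ≤ D) :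
    ∃ f, IsMultPredCurve D f ∧ lct₀ (evalFun f) = (2 * k + 1) / (k * (D + 1) + 1) := by
  have hg := isHomogeneous_X_one_pow_mul_X_zero_pow hkD
  have hh : (X 1 * (X 0 ^ D + X 1 ^ D) : MvPolynomial (Fin 2) ℂ).IsHomogeneous (D + 1) := by
    rw [add_comm D]
    exact (isHomogeneous_X ℂ 1).mul (isHomogeneous_X_zero_pow_add_X_one_pow D)
  have hg0 := X_one_pow_mul_X_zero_pow_ne_zero (k + 1) (D - (k + 1))
  have hs0 := X_zero_pow_add_X_one_pow_ne_zero (n := D) (by omega)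
  have hh0 := mul_ne_zero (X_ne_zero (R := ℂ) (1 : Fin 2)) hs0
  have hev := eval_X_zero_pow_add_X_one_pow_ne_zero (n := D) (by omega)
  have hsq : Squarefree ((X 1 ^ (k + 1) * X 0 ^ (D - (k + 1)) + X 1 * (X 0 ^ D + X 1 ^ D) :
      MvPolynomial (Fin 2) ℂ)) := by
    refine squarefree_add_of_isHomogeneous hg hh (add_ne_zero_of_isHomogeneous hg hh hg0 hh0)
      fun p hp hpg hph hpp => ?_
    rcases hp.prime.dvd_or_dvd hpg with h1 | h1 <;>
      replace h1 := X_dvd_of_irreducible_of_dvd_X_pow hp h1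
    · have h2 : X 1 * X 1 ∣ (X 1 ^ (k + 1) * X 0 ^ (D - (k + 1)) : MvPolynomial (Fin 2) ℂ) := by
        rw [← sq]
        exact (pow_dvd_pow _ (by omega)).mul_right _
      have h3 := (dvd_add_right h2).1 ((mul_dvd_mul h1 h1).trans hpp)
      exact not_X_one_dvd hev.2 ((mul_dvd_mul_iff_left (X_ne_zero _)).1 h3)
    · refine not_X_zero_dvd ?_ (h1.trans hph)
      rw [map_mul]
      exact mul_ne_zero (by simp) hev.1
  refine ⟨_, ⟨hsq, exists_of_isHomogeneous_add hg hh hg0 hh0⟩, ?_⟩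
  rw [lct₀_evalFun_add_eq_of_lt_two_mul (u := 0) (m := k + 1) (e := 1) hD hg hh hg0 hh0 hsq
    (rootMultiplicity_zero_dehomFst_X_one_pow_mul _ _) ?_ (by omega), Nat.add_sub_cancel]
  · push_cast
    ring_nf
  · have hne := dehomFst_ne_zero hh hh0
    rw [map_mul] at hne ⊢
    rw [Polynomial.rootMultiplicity_mul hne, Polynomial.rootMultiplicity_eq_zero
      (p := dehomFst (X 0 ^ D + X 1 ^ D)) (by simp [dehomFst, show D ≠ 0 by omega])]
    have := Polynomial.rootMultiplicity_X_sub_C_pow (0 : ℂ) 1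
    simpa [dehomFst] using this

theorem lct_values_at_mult_d_sub_one (d : ℕ) (hd : 3 ≤ d)
    (Λ : Set ℝ)
    (hΛ : Λ = { t : ℝ | ∃ f : MvPolynomial (Fin 2) ℂ, Squarefree f ∧
      f.totalDegree = d ∧ (∀ i < d - 1, homogeneousComponent i f = 0) ∧
      homogeneousComponent (d - 1) f ≠ 0 ∧ lct₀ (evalFun f) = t }) :
    Λ = {(2 : ℝ) / (d - 1)} ∪
      { t : ℝ | ∃ k : ℕ, (d - 1) / 2 ≤ k ∧ k ≤ d - 2 ∧
        t = (2 * k + 1) / (k * d + 1) } ∪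
      { t : ℝ | ∃ k : ℕ, (d + 1) / 2 ≤ k ∧ k ≤ d - 1 ∧
        t = (2 * k + 1) / (k * d) } := by
  obtain ⟨D, rfl⟩ : ∃ D, d = D + 1 := ⟨d - 1, by omega⟩
  have hD : 2 ≤ D := by omega
  subst hΛ
  ext t
  simp only [Nat.add_sub_cancel, Nat.cast_add, Nat.cast_one, add_sub_cancel_right,
    Set.mem_ofPred_eq, Set.mem_union, Set.mem_singleton_iff, or_assoc]
  constructor
  · rintro ⟨f, hsq, hdeg, hlow, hg0, rfl⟩
    have hf := eq_add_homogeneousComponent hdeg hlow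
    have := lct₀_evalFun_add_mem hD (homogeneousComponent_isHomogeneous D f)
      (homogeneousComponent_isHomogeneous (D + 1) f) hg0
      (homogeneousComponent_totalDegree_ne_zero hdeg) (by rwa [hf])
    rw [hf] at this
    rcases this with h | ⟨k, h1, h2, h⟩ | ⟨k, h1, h2, h⟩
    · exact .inl h
    · exact .inr (.inl ⟨k, h1, by omega, h⟩)
    · exact .inr (.inr ⟨k, h1, h2, h⟩)
  · have key : (∃ f, IsMultPredCurve D f ∧ lct₀ (evalFun f) = t) →
        ∃ f : MvPolynomial (Fin 2) ℂ, Squarefree f ∧ f.totalDegree = D + 1 ∧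
          (∀ i < D, homogeneousComponent i f = 0) ∧ homogeneousComponent D f ≠ 0 ∧
          lct₀ (evalFun f) = t := by
      rintro ⟨f, ⟨h1, h2, h3, h4⟩, h5⟩
      exact ⟨f, h1, h2, h3, h4, h5⟩
    rintro (rfl | ⟨k, h1, h2, rfl⟩ | ⟨k, h1, h2, rfl⟩)
    · exact key (exists_isMultPredCurve_lct₀_eq_two_div hD)
    · exact key (exists_isMultPredCurve_lct₀_eq_div_mul_add_one hD h1 (by omega))
    · exact key (exists_isMultPredCurve_lct₀_eq_div_mul hD h1 h2)
end

section
/- For every integer k ≥ 1, the A_k singularity f(x,y) = x² + y^{k+1} satisfies lct₀(f) = (k+3)/(2(k+1)). -/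
open MeasureTheory

open Metric Set Filter Topology

/-- If `r` is at most the mean of `a` and `b`, part of the larger factor's power in
`(a * b) ^ (-2 * c)` can be traded for a power of `r`. -/
lemma mul_rpow_le_rpow_mul_add {a b r c α : ℝ} (ha : 0 ≤ a) (hb : 0 ≤ b) (hr : 0 < r)
    (hab : 2 * r ≤ a + b) (hc : 0 < c) (hα : 0 ≤ α) (hαc : α ≤ 2 * c) :
    (a * b) ^ (-2 * c) ≤ r ^ (-α) * (a ^ (-(4 * c - α)) + b ^ (-(4 * c - α))) := by
  wlog h : a ≤ b generalizing a b
  · rw [mul_comm a b, add_comm (a ^ _)]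
    exact this hb ha (by linarith) (le_of_not_ge h)
  rcases ha.eq_or_lt with rfl | ha'
  · rw [zero_mul, Real.zero_rpow (by linarith)]
    positivity
  have hb' : 0 < b := ha'.trans_le h
  calc (a * b) ^ (-2 * c) = b ^ (-α) * (a ^ (-2 * c) * b ^ (-(2 * c - α))) := by
        rw [Real.mul_rpow ha hb, mul_left_comm, ← Real.rpow_add hb']
        ring_nf
    _ ≤ r ^ (-α) * (a ^ (-2 * c) * a ^ (-(2 * c - α))) := by
        gcongr ?_ * (_ * ?_)
        · exact Real.rpow_le_rpow_of_nonpos hr (by linarith) (by linarith)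
        · exact Real.rpow_le_rpow_of_nonpos ha' h (by linarith)
    _ = r ^ (-α) * a ^ (-(4 * c - α)) := by
        rw [← Real.rpow_add ha']
        ring_nf
    _ ≤ _ := by
        gcongr
        exact le_add_of_nonneg_right (by positivity)

lemma norm_sq_sub_sq_rpow_le {x w : ℂ} (hw : w ≠ 0) {c α : ℝ} (hc : 0 < c) (hα : 0 ≤ α)
    (hαc : α ≤ 2 * c) :
    ‖x ^ 2 - w ^ 2‖ ^ (-2 * c) ≤
      ‖w‖ ^ (-α) * (‖x - w‖ ^ (-(4 * c - α)) + ‖x - -w‖ ^ (-(4 * c - α))) := by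
  have hfac : x ^ 2 - w ^ 2 = (x - w) * (x - -w) := by ring
  rw [hfac, norm_mul]
  refine mul_rpow_le_rpow_mul_add (norm_nonneg _) (norm_nonneg _) (norm_pos_iff.2 hw) ?_ hc hα hαc
  have h := norm_sub_le (x - -w) (x - w)
  have h2 : (x - -w) - (x - w) = 2 * w := by ring
  rw [h2, norm_mul, Complex.norm_two] at h
  linarith

lemma setLIntegral_ball_norm_rpow_lt_top {β : ℝ} (hβ : β < 2) (R : ℝ) :
    ∫⁻ x in ball (0 : ℂ) R, ENNReal.ofReal (‖x‖ ^ (-β)) < ⊤ := by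
  refine Integrable.lintegral_lt_top (integrableOn_ball_of_norm_le_rpow (C := 1) (α := β)
    (by simp) (by simpa using hβ) (Eventually.of_forall fun x => ?_) ?_)
  · rw [one_mul, Real.norm_of_nonneg (by positivity)]
  · exact (measurable_norm.pow_const (-β)).aestronglyMeasurable

lemma setLIntegral_ball_comp_sub_le (g : ℂ → ENNReal) {w : ℂ} (hw : ‖w‖ ≤ 1) :
    ∫⁻ x in ball (0 : ℂ) 1, g (x - w) ≤ ∫⁻ x in ball (0 : ℂ) 2, g x := by
  rw [← lintegral_indicator measurableSet_ball, ← lintegral_indicator measurableSet_ball,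
    ← lintegral_sub_right_eq_self ((ball 0 2).indicator g) w]
  refine lintegral_mono fun x => ?_
  by_cases hx : x ∈ ball (0 : ℂ) 1
  · have hxw : x - w ∈ ball (0 : ℂ) 2 := by
      rw [mem_ball_zero_iff] at hx ⊢
      linarith [norm_sub_le x w]
    rw [indicator_of_mem hx, indicator_of_mem hxw]
  · rw [indicator_of_notMem hx]
    exact zero_le

lemma setLIntegral_ball_norm_sq_sub_sq_rpow_le {w : ℂ} (hw : w ≠ 0) (hw1 : ‖w‖ ≤ 1) {c α : ℝ}
    (hc : 0 < c) (hα : 0 ≤ α) (hαc : α ≤ 2 * c) :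
    ∫⁻ x in ball (0 : ℂ) 1, ENNReal.ofReal (‖x ^ 2 - w ^ 2‖ ^ (-2 * c)) ≤
      ENNReal.ofReal (‖w‖ ^ (-α)) *
        (2 * ∫⁻ x in ball (0 : ℂ) 2, ENNReal.ofReal (‖x‖ ^ (-(4 * c - α)))) := by
  set g : ℂ → ENNReal := fun x => ENNReal.ofReal (‖x‖ ^ (-(4 * c - α))) with hg
  have hgm : Measurable g := (measurable_norm.pow_const _).ennreal_ofReal
  calc ∫⁻ x in ball (0 : ℂ) 1, ENNReal.ofReal (‖x ^ 2 - w ^ 2‖ ^ (-2 * c))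
      ≤ ∫⁻ x in ball (0 : ℂ) 1, ENNReal.ofReal (‖w‖ ^ (-α)) * (g (x - w) + g (x - -w)) := by
        refine lintegral_mono fun x => ?_
        simp only [hg]
        rw [← ENNReal.ofReal_add (by positivity) (by positivity),
          ← ENNReal.ofReal_mul (by positivity)]
        exact ENNReal.ofReal_le_ofReal (norm_sq_sub_sq_rpow_le hw hc hα hαc)
    _ = ENNReal.ofReal (‖w‖ ^ (-α)) * ((∫⁻ x in ball (0 : ℂ) 1, g (x - w)) +
          ∫⁻ x in ball (0 : ℂ) 1, g (x - -w)) := by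
        rw [lintegral_const_mul _ (by fun_prop), lintegral_add_left (by fun_prop)]
    _ ≤ _ := by
        rw [two_mul]
        exact mul_le_mul_right (add_le_add (setLIntegral_ball_comp_sub_le g hw1)
          (setLIntegral_ball_comp_sub_le g (by rwa [norm_neg]))) _

lemma integrableOn_ball_norm_sq_add_pow_rpow {n : ℕ} (hn : 2 ≤ n) {c : ℝ} (hc : 0 < c)
    (hcn : c < 1 / 2 + 1 / n) :
    IntegrableOn (fun p : ℂ × ℂ => ‖p.1 ^ 2 + p.2 ^ n‖ ^ (-2 * c)) (ball 0 1) := by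
  have hn' : (2 : ℝ) ≤ n := by exact_mod_cast hn
  have hinv : 1 / (n : ℝ) ≤ 1 / 2 := one_div_le_one_div_of_le (by norm_num) hn'
  have hpos : 0 < 1 / (n : ℝ) := by positivity
  obtain ⟨α, hα1, hα2⟩ : ∃ α, max 0 (4 * c - 2) < α ∧ α < min (4 * (1 / (n : ℝ))) (2 * c) :=
    exists_between (max_lt (lt_min (by linarith) (by linarith))
      (lt_min (by linarith) (by linarith)))
  obtain ⟨hα0, hαc⟩ := max_lt_iff.1 hα1
  obtain ⟨hαn, hαc'⟩ := lt_min_iff.1 hα2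
  have hmeas : Measurable fun p : ℂ × ℂ => ‖p.1 ^ 2 + p.2 ^ n‖ ^ (-2 * c) :=
    Measurable.pow_const (by fun_prop) _
  refine ⟨hmeas.aestronglyMeasurable, ?_⟩
  rw [hasFiniteIntegral_iff_ofReal (Eventually.of_forall fun p => by positivity),
    ← Prod.mk_zero_zero, ← ball_prod_same, Measure.volume_eq_prod, ← Measure.prod_restrict,
    lintegral_prod_symm' _ hmeas.ennreal_ofReal]
  set K := 2 * ∫⁻ x in ball (0 : ℂ) 2, ENNReal.ofReal (‖x‖ ^ (-(4 * c - α)))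
  have hK : K < ⊤ := ENNReal.mul_lt_top (by simp)
    (setLIntegral_ball_norm_rpow_lt_top (by linarith) 2)
  have hγ : n / 2 * α < 2 := by
    have : (n : ℝ) * α < n * (4 * (1 / (n : ℝ))) := by gcongr
    have h2 : (n : ℝ) * (4 * (1 / (n : ℝ))) = 4 := by field_simp
    linarith
  calc _ ≤ ∫⁻ y in ball (0 : ℂ) 1, ENNReal.ofReal (‖y‖ ^ (-(n / 2 * α))) * K := by
        refine lintegral_mono_ae ?_
        have hne : ∀ᵐ y : ℂ ∂volume.restrict (ball 0 1), y ≠ 0 :=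
          ae_restrict_of_ae (Measure.ae_ne volume 0)
        filter_upwards [ae_restrict_mem measurableSet_ball, hne] with y hy hy0
        obtain ⟨w, hw⟩ := IsAlgClosed.exists_pow_nat_eq (-y ^ n) (n := 2) (by norm_num)
        have hw0 : w ≠ 0 := by
          rintro rfl
          exact pow_ne_zero n hy0 (by simpa using hw.symm)
        have hwn : ‖w‖ ^ 2 = ‖y‖ ^ n := by rw [← norm_pow, hw, norm_neg, norm_pow]
        have hy1 : ‖y‖ ≤ 1 := (mem_ball_zero_iff.1 hy).le
        have hw1 : ‖w‖ ≤ 1 := by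
          rw [← sq_le_one_iff₀ (norm_nonneg _), hwn]
          exact pow_le_one₀ (norm_nonneg _) hy1
        have hwy : ‖w‖ ^ (-α) = ‖y‖ ^ (-(n / 2 * α)) := by
          have h1 : ‖w‖ ^ (-α) = (‖w‖ ^ 2) ^ (-α / 2) := by
            rw [← Real.rpow_natCast, ← Real.rpow_mul (norm_nonneg _)]
            push_cast
            ring_nf
          rw [h1, hwn, ← Real.rpow_natCast, ← Real.rpow_mul (norm_nonneg _)]
          ring_nf
        have hsub : ∀ x : ℂ, x ^ 2 + y ^ n = x ^ 2 - w ^ 2 := fun x => by rw [hw]; ring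
        simp only [hsub, ← hwy]
        exact setLIntegral_ball_norm_sq_sub_sq_rpow_le hw0 hw1 hc hα0.le hαc'.le
    _ = (∫⁻ y in ball (0 : ℂ) 1, ENNReal.ofReal (‖y‖ ^ (-(n / 2 * α)))) * K :=
        lintegral_mul_const _ (measurable_norm.pow_const _).ennreal_ofReal
    _ < ⊤ := ENNReal.mul_lt_top (setLIntegral_ball_norm_rpow_lt_top hγ 1) hK

/-- A lower bound for the integral coming from a quasi-homogeneous neighbourhood of size `t`. -/
lemma mul_rpow_le_setIntegral_norm_sq_add_pow_rpow {n : ℕ} {c ε t : ℝ} (hc : 0 ≤ c) (ht : 0 < t)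
    (htε : 2 * t ^ n < ε) (htε' : t ^ 2 < ε)
    (h : IntegrableOn (fun p : ℂ × ℂ => ‖p.1 ^ 2 + p.2 ^ n‖ ^ (-2 * c)) (ball 0 ε)) :
    3 * Real.pi ^ 2 * 5 ^ (-2 * c) * t ^ (-(4 * n * c - 2 * n - 4)) ≤
      ∫ p in ball (0 : ℂ × ℂ) ε, ‖p.1 ^ 2 + p.2 ^ n‖ ^ (-2 * c) := by
  set E : Set (ℂ × ℂ) := (ball 0 (2 * t ^ n) \ closedBall 0 (t ^ n)) ×ˢ ball 0 (t ^ 2) with hE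
  have hEm : MeasurableSet E :=
    (measurableSet_ball.diff measurableSet_closedBall).prod measurableSet_ball
  have hsub : E ⊆ ball 0 ε := by
    rw [← Prod.mk_zero_zero, ← ball_prod_same]
    exact prod_mono (sdiff_subset.trans (ball_subset_ball htε.le)) (ball_subset_ball htε'.le)
  have hball : ∀ r : ℝ, 0 ≤ r → volume.real (ball (0 : ℂ) r) = r ^ 2 * Real.pi := fun r hr => by
    simp [Measure.real, Complex.volume_ball, hr]
  have hcball : ∀ r : ℝ, 0 ≤ r → volume.real (closedBall (0 : ℂ) r) = r ^ 2 * Real.pi :=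
    fun r hr => by simp [Measure.real, Complex.volume_closedBall, hr]
  have htn : 0 < t ^ n := by positivity
  have hvol : volume.real E = 3 * (t ^ n) ^ 2 * Real.pi * ((t ^ 2) ^ 2 * Real.pi) := by
    rw [hE, Measure.volume_eq_prod, measureReal_prod_prod,
      measureReal_sdiff (closedBall_subset_ball (by linarith)) measurableSet_closedBall,
      hball _ (by positivity), hball _ (by positivity), hcball _ (by positivity)]
    ring
  have hEfin : volume E ≠ ⊤ := ((measure_mono hsub).trans_lt measure_ball_lt_top).ne
  have hlow : ∀ p ∈ E, (5 * (t ^ n) ^ 2) ^ (-2 * c) ≤ ‖p.1 ^ 2 + p.2 ^ n‖ ^ (-2 * c) := by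
    rintro ⟨x, y⟩ ⟨⟨hx2, hx1⟩, hy⟩
    simp only [mem_ball_zero_iff, mem_closedBall_zero_iff, not_le] at hx1 hx2 hy
    have hyn : ‖y ^ n‖ ≤ (t ^ n) ^ 2 := by
      rw [norm_pow, ← pow_mul, mul_comm n 2, pow_mul]
      gcongr
    have hxl : (t ^ n) ^ 2 < ‖x ^ 2‖ := by
      rw [norm_pow]
      gcongr
    have hxu : ‖x ^ 2‖ ≤ (2 * t ^ n) ^ 2 := by
      rw [norm_pow]
      gcongr
    refine Real.rpow_le_rpow_of_nonpos ?_ ?_ (by linarith)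
    · have := norm_sub_le_norm_add (x ^ 2) (y ^ n)
      dsimp only
      linarith
    · have := norm_add_le (x ^ 2) (y ^ n)
      dsimp only
      linarith
  calc _ = (5 * (t ^ n) ^ 2) ^ (-2 * c) * volume.real E := by
        have hpow : ((t ^ n) ^ 2) ^ (-2 * c) = t ^ (-(4 * n * c)) := by
          rw [← pow_mul, ← Real.rpow_natCast, ← Real.rpow_mul ht.le]
          push_cast
          ring_nf
        have hexp : -(4 * n * c - 2 * n - 4) = -(4 * n * c) + ((2 * n + 4 : ℕ) : ℝ) := by
          push_cast
          ring
        rw [hvol, Real.mul_rpow (by norm_num) (by positivity), hpow, hexp, Real.rpow_add ht,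
          Real.rpow_natCast]
        ring
    _ ≤ ∫ p in E, ‖p.1 ^ 2 + p.2 ^ n‖ ^ (-2 * c) :=
        setIntegral_ge_of_const_le_real hEm hEfin hlow (h.mono_set hsub)
    _ ≤ _ := setIntegral_mono_set h (Eventually.of_forall fun p => by positivity)
        hsub.eventuallyLE

lemma le_of_integrableOn_ball_norm_sq_add_pow_rpow {n : ℕ} (hn : 1 ≤ n) {c ε : ℝ} (hc : 0 ≤ c)
    (hε : 0 < ε)
    (h : IntegrableOn (fun p : ℂ × ℂ => ‖p.1 ^ 2 + p.2 ^ n‖ ^ (-2 * c)) (ball 0 ε)) :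
    c ≤ 1 / 2 + 1 / n := by
  by_contra! hlt
  have hn' : (0 : ℝ) < n := by exact_mod_cast hn
  have hs : 0 < 4 * n * c - 2 * n - 4 := by
    have h1 : 4 * n * (1 / 2 + 1 / (n : ℝ)) < 4 * n * c := by gcongr
    have h2 : 4 * n * (1 / 2 + 1 / (n : ℝ)) = 2 * n + 4 := by field_simp; ring
    linarith
  have hlim : Tendsto (fun t : ℝ => 3 * Real.pi ^ 2 * 5 ^ (-2 * c) *
      t ^ (-(4 * n * c - 2 * n - 4))) (𝓝[>] 0) atTop :=
    (tendsto_rpow_neg_nhdsGT_zero (neg_neg_of_pos hs)).const_mul_atTop (by positivity)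
  have hsmall : ∀ᶠ t : ℝ in 𝓝[>] 0, 2 * t ^ n < ε ∧ t ^ 2 < ε := by
    refine nhdsWithin_le_nhds (Filter.Eventually.and ?_ ?_)
    · exact (show Continuous fun t : ℝ => 2 * t ^ n by fun_prop).continuousAt.eventually_lt_const
        (by simpa [show n ≠ 0 by omega] using hε)
    · exact (show Continuous fun t : ℝ => t ^ 2 by fun_prop).continuousAt.eventually_lt_const
        (by simpa using hε)
  obtain ⟨t, hbig, ⟨ht1, ht2⟩, ht⟩ :=
    ((hlim.eventually_gt_atTop _).and (hsmall.and self_mem_nhdsWithin)).exists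
  exact hbig.not_ge (mul_rpow_le_setIntegral_norm_sq_add_pow_rpow hc ht ht1 ht2 h)

theorem lct_A_k (k : ℕ) (hk : 1 ≤ k) :
    lct₀ (fun p : ℂ × ℂ => p.1 ^ 2 + p.2 ^ (k + 1)) = (k + 3) / (2 * (k + 1)) := by
  have hval : ((k : ℝ) + 3) / (2 * (k + 1)) = 1 / 2 + 1 / (k + 1 : ℕ) := by
    push_cast
    field_simp
    ring
  have hmem : ∀ c : ℝ, 0 < c → c < 1 / 2 + 1 / (k + 1 : ℕ) → c ∈ { c : ℝ | 0 ≤ c ∧ ∃ ε : ℝ,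
      0 < ε ∧ IntegrableOn (fun p : ℂ × ℂ => ‖p.1 ^ 2 + p.2 ^ (k + 1)‖ ^ (-2 * c))
        (ball (0 : ℂ × ℂ) ε) volume } := fun c hc hck =>
    ⟨hc.le, 1, one_pos, integrableOn_ball_norm_sq_add_pow_rpow (by omega) hc hck⟩
  have hpos : (0 : ℝ) < 1 / 2 + 1 / (k + 1 : ℕ) := by positivity
  rw [hval, lct₀]
  refine csSup_eq_of_forall_le_of_forall_lt_exists_gt ?_ ?_ ?_
  · exact ⟨_, hmem _ (half_pos hpos) (half_lt_self hpos)⟩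
  · rintro c ⟨hc, ε, hε, h⟩
    exact le_of_integrableOn_ball_norm_sq_add_pow_rpow (by omega) hc hε h
  · intro w hw
    obtain ⟨c, hc1, hc2⟩ := exists_between (max_lt hw hpos)
    obtain ⟨hwc, hc0⟩ := max_lt_iff.1 hc1
    exact ⟨c, hmem c hc0 hc2, hwc⟩
end

section
/- For every integer k ≥ 4, the D_k singularity f(x,y) = x²y + y^{k-1} satisfies lct₀(f) = k/(2(k-1)). -/
open MeasureTheory

open Metric

lemma Complex.integrableOn_norm_rpow_ball_iff {r : ℝ} (hr : 0 < r) (q : ℝ) :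
    IntegrableOn (fun z : ℂ => ‖z‖ ^ q) (ball 0 r) ↔ -2 < q := by
  rw [integrableOn_fun_norm_addHaar volume (f := fun t : ℝ => t ^ q), Complex.finrank_real_complex]
  have h : Set.EqOn (fun t : ℝ => t ^ (2 - 1) • t ^ q) (fun t : ℝ => t ^ (q + 1))
      (Set.Ioo 0 r) := fun t ht => by
    simp only [Nat.add_one_sub_one, pow_one, smul_eq_mul]
    rw [Real.rpow_add_one ht.1.ne', mul_comm]
  rw [integrableOn_congr_fun h measurableSet_Ioo, intervalIntegral.integrableOn_Ioo_rpow_iff hr]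
  constructor <;> intro h <;> linarith

lemma integrableOn_iff_setLIntegral_ofReal_lt_top {α : Type*} [MeasurableSpace α] {μ : Measure α}
    {f : α → ℝ} {s : Set α} (hf : Measurable f) (h0 : ∀ x, 0 ≤ f x) :
    IntegrableOn f s μ ↔ ∫⁻ x in s, ENNReal.ofReal (f x) ∂μ < ⊤ := by
  rw [lt_top_iff_ne_top, IntegrableOn, lintegral_ofReal_ne_top_iff_integrable
    hf.aestronglyMeasurable (Filter.Eventually.of_forall h0)]

lemma setLIntegral_ball_prod {f : ℂ × ℂ → ENNReal} (hf : Measurable f) (r : ℝ) :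
    ∫⁻ p in ball (0 : ℂ × ℂ) r, f p = ∫⁻ y in ball (0 : ℂ) r, ∫⁻ x in ball (0 : ℂ) r, f (x, y) := by
  rw [show (0 : ℂ × ℂ) = (0, 0) from rfl, ← ball_prod_same, Measure.volume_eq_prod,
    setLIntegral_prod_symm _ hf.aemeasurable]

lemma setLIntegral_ball_add_le (h : ℂ → ENNReal) {w : ℂ} (hw : ‖w‖ ≤ 1) :
    ∫⁻ x in ball (0 : ℂ) 1, h (x + w) ≤ ∫⁻ x in ball (0 : ℂ) 2, h x := by
  rw [← (measurePreserving_add_right volume w).setLIntegral_comp_preimage_emb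
    (MeasurableEquiv.addRight w).measurableEmbedding h (ball 0 2)]
  refine lintegral_mono_set fun x hx => ?_
  simp only [Set.mem_preimage, mem_ball_zero_iff] at hx ⊢
  linarith [norm_add_le x w]

lemma Real.mul_rpow_neg_le {a b w c s : ℝ} (ha : 0 ≤ a) (hb : 0 ≤ b) (hw : 0 < w)
    (hab : 2 * w ≤ a + b) (hc : 0 < c) (hs : 0 ≤ s) (hsc : s ≤ 2 * c) :
    (a * b) ^ (-2 * c) ≤ w ^ (-s) * (a ^ (-(4 * c - s)) + b ^ (-(4 * c - s))) := by
  wlog h : a ≤ b generalizing a b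
  · rw [mul_comm a, add_comm (a ^ _)]
    exact this hb ha (by linarith) (le_of_not_ge h)
  rcases ha.eq_or_lt with rfl | ha
  · rw [zero_mul, Real.zero_rpow (by linarith)]
    positivity
  have hb' : 0 < b := ha.trans_le h
  calc (a * b) ^ (-2 * c) = b ^ (-s) * (a ^ (-2 * c) * b ^ (-(2 * c - s))) := by
        rw [Real.mul_rpow ha.le hb, mul_left_comm, ← Real.rpow_add hb']
        ring_nf
    _ ≤ w ^ (-s) * (a ^ (-2 * c) * a ^ (-(2 * c - s))) := by
        gcongr ?_ * (_ * ?_)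
        · exact Real.rpow_le_rpow_of_nonpos hw (by linarith) (by linarith)
        · exact Real.rpow_le_rpow_of_nonpos ha h (by linarith)
    _ = w ^ (-s) * a ^ (-(4 * c - s)) := by
        rw [← Real.rpow_add ha]
        ring_nf
    _ ≤ _ := by
        gcongr
        exact le_add_of_nonneg_right (by positivity)

lemma norm_D_rpow_le {m : ℕ} {x y w : ℂ} {c s : ℝ} (hy : y ≠ 0) (hw : w ^ 2 = -y ^ m)
    (hc : 0 < c) (hs : 0 ≤ s) (hsc : s ≤ 2 * c) :
    ‖x ^ 2 * y + y ^ (m + 1)‖ ^ (-2 * c) ≤ ‖y‖ ^ (-2 * c - m * s / 2) *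
      (‖x + w‖ ^ (-(4 * c - s)) + ‖x + -w‖ ^ (-(4 * c - s))) := by
  have hy' : 0 < ‖y‖ := norm_pos_iff.2 hy
  have hw0 : w ≠ 0 := by
    rintro rfl
    exact pow_ne_zero m hy (by simpa using hw.symm)
  have hfac : x ^ 2 * y + y ^ (m + 1) = y * ((x + w) * (x + -w)) := by
    linear_combination y * hw
  have hnorm : ‖w‖ ^ (-s) = ‖y‖ ^ (-(m * s / 2)) := by
    have h2 : ‖w‖ ^ (2 : ℝ) = ‖y‖ ^ (m : ℝ) := by
      rw [Real.rpow_two, Real.rpow_natCast, ← norm_pow, hw, norm_neg, norm_pow]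
    rw [show -s = 2 * (-(s / 2)) by ring, Real.rpow_mul (norm_nonneg _), h2,
      ← Real.rpow_mul (norm_nonneg _)]
    ring_nf
  have htri : 2 * ‖w‖ ≤ ‖x + w‖ + ‖x + -w‖ := by
    have := norm_sub_le (x + w) (x + -w)
    rwa [show x + w - (x + -w) = 2 * w by ring, norm_mul, Complex.norm_ofNat] at this
  rw [hfac, norm_mul, norm_mul, Real.mul_rpow hy'.le (by positivity), sub_eq_add_neg,
    Real.rpow_add hy', ← hnorm, mul_assoc]
  gcongr
  exact Real.mul_rpow_neg_le (norm_nonneg _) (norm_nonneg _) (norm_pos_iff.2 hw0) htri hc hs hsc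

lemma setLIntegral_D_rpow_le {m : ℕ} {y : ℂ} {c s : ℝ} (hy : ‖y‖ < 1)
    (hc : 0 < c) (hs : 0 ≤ s) (hsc : s ≤ 2 * c) :
    ∫⁻ x in ball (0 : ℂ) 1, ENNReal.ofReal (‖x ^ 2 * y + y ^ (m + 1)‖ ^ (-2 * c)) ≤
      ENNReal.ofReal (‖y‖ ^ (-2 * c - m * s / 2)) *
        (2 * ∫⁻ x in ball (0 : ℂ) 2, ENNReal.ofReal (‖x‖ ^ (-(4 * c - s)))) := by
  rcases eq_or_ne y 0 with rfl | hy0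
  · simp [hc.ne']
  obtain ⟨w, hw⟩ := IsAlgClosed.exists_pow_nat_eq (-y ^ m) two_pos
  have hw1 : ‖w‖ ≤ 1 := by
    rw [← pow_le_one_iff_of_nonneg (norm_nonneg _) two_ne_zero, ← norm_pow, hw, norm_neg, norm_pow]
    exact pow_le_one₀ (norm_nonneg _) hy.le
  calc _ ≤ ∫⁻ x in ball (0 : ℂ) 1, ENNReal.ofReal (‖y‖ ^ (-2 * c - m * s / 2)) *
        (ENNReal.ofReal (‖x + w‖ ^ (-(4 * c - s))) +
          ENNReal.ofReal (‖x + -w‖ ^ (-(4 * c - s)))) := by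
        refine lintegral_mono fun x => ?_
        rw [← ENNReal.ofReal_add (by positivity) (by positivity),
          ← ENNReal.ofReal_mul (by positivity)]
        exact ENNReal.ofReal_le_ofReal (norm_D_rpow_le hy0 hw hc hs hsc)
    _ ≤ _ := by
        rw [lintegral_const_mul _ (by fun_prop), lintegral_add_left (by fun_prop), two_mul]
        exact mul_le_mul_right (add_le_add
          (setLIntegral_ball_add_le (fun x => ENNReal.ofReal (‖x‖ ^ (-(4 * c - s)))) hw1)
          (setLIntegral_ball_add_le (fun x => ENNReal.ofReal (‖x‖ ^ (-(4 * c - s))))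
            (by rwa [norm_neg]))) _

lemma integrableOn_D_rpow {m : ℕ} {c : ℝ} (hc : 1 / 2 < c)
    (hcm : 2 * c * (m + 1) < m + 2) :
    IntegrableOn (fun p : ℂ × ℂ => ‖p.1 ^ 2 * p.2 + p.2 ^ (m + 1)‖ ^ (-2 * c)) (ball 0 1) := by
  have hm : (0 : ℝ) ≤ m := m.cast_nonneg
  have hc1 : c < 1 := by nlinarith
  obtain ⟨s, hs, hsc, hsm⟩ : ∃ s : ℝ, 4 * c - 2 < s ∧ s < 2 * c ∧ -2 < -2 * c - m * s / 2 := by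
    set d : ℝ := m + 2 - 2 * c * (m + 1) with hd
    have hdpos : 0 < d := by linarith
    refine ⟨4 * c - 2 + min (1 - c) (d / (m + 1)), ?_, ?_, ?_⟩
    · have : 0 < min (1 - c) (d / (m + 1)) := lt_min (by linarith) (by positivity)
      linarith
    · linarith [min_le_left (1 - c) (d / (m + 1))]
    · have h1 : (m + 1) * min (1 - c) (d / (m + 1)) ≤ d := by
        rw [← le_div_iff₀' (by positivity)]
        exact min_le_right _ _
      have : 0 < min (1 - c) (d / (m + 1)) := lt_min (by linarith) (by positivity)
      nlinarith
  rw [integrableOn_iff_setLIntegral_ofReal_lt_top (by fun_prop) (fun p => by positivity),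
    setLIntegral_ball_prod (by fun_prop)]
  have hfin {q r : ℝ} (hr : 0 < r) (hq : -2 < q) :
      ∫⁻ z in ball (0 : ℂ) r, ENNReal.ofReal (‖z‖ ^ q) < ⊤ := by
    rw [← integrableOn_iff_setLIntegral_ofReal_lt_top (by fun_prop) (fun p => by positivity)]
    exact (Complex.integrableOn_norm_rpow_ball_iff hr q).2 hq
  refine (setLIntegral_mono (by fun_prop) fun y hy => setLIntegral_D_rpow_le
    (mem_ball_zero_iff.1 hy) (by linarith) (by linarith) hsc.le).trans_lt ?_
  rw [lintegral_mul_const _ (by fun_prop)]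
  exact ENNReal.mul_lt_top (hfin one_pos hsm)
    (ENNReal.mul_lt_top ENNReal.ofNat_lt_top (hfin two_pos (by linarith)))

lemma le_setLIntegral_D_rpow {m : ℕ} (hm : 2 ≤ m) {r c : ℝ} {y : ℂ} (hy : ‖y‖ < r) (hr : r ≤ 1)
    (hc : 0 < c) (hcm : m < 2 * c * (m + 1)) :
    ENNReal.ofReal (2 ^ (-2 * c) * Real.pi * ‖y‖ ^ (m - 2 * c * (m + 1))) ≤
      ∫⁻ x in ball (0 : ℂ) r, ENNReal.ofReal (‖x ^ 2 * y + y ^ (m + 1)‖ ^ (-2 * c)) := by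
  rcases eq_or_ne y 0 with rfl | hy0
  · rw [norm_zero, Real.zero_rpow (by linarith)]
    simp
  have hy' : 0 < ‖y‖ := norm_pos_iff.2 hy0
  have hsq : √(‖y‖ ^ m) ≤ r := by
    refine Real.sqrt_le_iff.2 ⟨by linarith, ?_⟩
    calc ‖y‖ ^ m ≤ ‖y‖ ^ 2 := pow_le_pow_of_le_one hy'.le (by linarith) hm
      _ ≤ r ^ 2 := by gcongr
  calc _ = ∫⁻ x in ball (0 : ℂ) √(‖y‖ ^ m), ENNReal.ofReal ((2 * ‖y‖ ^ (m + 1)) ^ (-2 * c)) := by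
        rw [setLIntegral_const, Complex.volume_ball, ← ENNReal.ofReal_pow (by positivity),
          Real.sq_sqrt (by positivity), Real.mul_rpow two_pos.le (by positivity),
          ← NNReal.coe_real_pi, ENNReal.ofReal_mul (by positivity),
          ENNReal.ofReal_mul (by positivity), ENNReal.ofReal_coe_nnreal,
          ENNReal.ofReal_mul (by positivity), sub_eq_add_neg, Real.rpow_add hy',
          ENNReal.ofReal_mul (by positivity), Real.rpow_natCast, ← Real.rpow_natCast _ (m + 1),
          ← Real.rpow_mul hy'.le]
        push_cast
        ring_nf
    _ ≤ ∫⁻ x in ball (0 : ℂ) √(‖y‖ ^ m),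
          ENNReal.ofReal (‖x ^ 2 * y + y ^ (m + 1)‖ ^ (-2 * c)) := by
        refine setLIntegral_mono (by fun_prop) fun x hx => ENNReal.ofReal_le_ofReal ?_
        have hx : ‖x ^ 2‖ < ‖y ^ m‖ := by
          rw [norm_pow, norm_pow]
          exact (Real.lt_sqrt (norm_nonneg _)).1 (mem_ball_zero_iff.1 hx)
        have hfac : x ^ 2 * y + y ^ (m + 1) = y * (x ^ 2 + y ^ m) := by ring
        have hne : x ^ 2 + y ^ m ≠ 0 := fun h => by
          rw [eq_neg_of_add_eq_zero_left h, norm_neg] at hx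
          exact hx.false
        rw [hfac]
        refine Real.rpow_le_rpow_of_nonpos (norm_pos_iff.2 (mul_ne_zero hy0 hne)) ?_ (by linarith)
        rw [norm_mul, pow_succ' ‖y‖, ← norm_pow]
        nlinarith [norm_add_le (x ^ 2) (y ^ m)]
    _ ≤ _ := lintegral_mono_set (ball_subset_ball hsq)

lemma le_of_integrableOn_D_rpow {m : ℕ} (hm : 2 ≤ m) {r c : ℝ} (hr : 0 < r)
    (h : IntegrableOn (fun p : ℂ × ℂ => ‖p.1 ^ 2 * p.2 + p.2 ^ (m + 1)‖ ^ (-2 * c)) (ball 0 r)) :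
    2 * c * (m + 1) ≤ m + 2 := by
  by_contra! hcm
  have hm0 : (0 : ℝ) ≤ m := m.cast_nonneg
  have hc : 0 < c := by
    by_contra! hc
    nlinarith
  have h := h.mono_set (ball_subset_ball (min_le_left r 1))
  have hr' : 0 < min r 1 := lt_min hr one_pos
  rw [integrableOn_iff_setLIntegral_ofReal_lt_top (by fun_prop) (fun p => by positivity),
    setLIntegral_ball_prod (by fun_prop)] at h
  replace h := (setLIntegral_mono' measurableSet_ball fun y hy => le_setLIntegral_D_rpow hm
    (mem_ball_zero_iff.1 hy) (min_le_right r 1) hc (by linarith)).trans_lt h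
  rw [← integrableOn_iff_setLIntegral_ofReal_lt_top (by fun_prop) (fun p => by positivity),
    IntegrableOn, integrable_const_mul_iff
      (show (2 : ℝ) ^ (-2 * c) * Real.pi ≠ 0 by positivity).isUnit] at h
  linarith [(Complex.integrableOn_norm_rpow_ball_iff hr' _).1 h]

theorem lct_D_k (k : ℕ) (hk : 4 ≤ k) :
    lct₀ (fun p : ℂ × ℂ => p.1 ^ 2 * p.2 + p.2 ^ (k - 1)) = k / (2 * (k - 1)) := by
  obtain ⟨m, rfl⟩ := Nat.exists_eq_add_of_le' (show 2 ≤ k by omega)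
  have hm : 2 ≤ m := by omega
  have hm0 : (0 : ℝ) ≤ m := m.cast_nonneg
  have hval : ((m + 2 : ℕ) : ℝ) / (2 * ((m + 2 : ℕ) - 1)) = (m + 2) / (2 * (m + 1)) := by
    push_cast
    ring_nf
  have hhalf : (1 : ℝ) / 2 < (m + 2) / (2 * (m + 1)) := by
    rw [div_lt_div_iff₀ (by positivity) (by positivity)]
    linarith
  rw [hval, lct₀, show m + 2 - 1 = m + 1 by omega]
  refine csSup_eq_of_forall_le_of_forall_lt_exists_gt ?_ ?_ ?_
  · exact ⟨0, le_rfl, 1, one_pos, by simp [measure_ball_lt_top]⟩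
  · rintro c ⟨-, r, hr, h⟩
    rw [le_div_iff₀ (by positivity)]
    linarith [le_of_integrableOn_D_rpow hm hr h]
  · intro c hc
    obtain ⟨d, hd, hd'⟩ := exists_between (max_lt hhalf hc)
    obtain ⟨hd1, hd2⟩ := max_lt_iff.1 hd
    refine ⟨d, ⟨by linarith, 1, one_pos, integrableOn_D_rpow hd1 ?_⟩, hd2⟩
    rw [lt_div_iff₀ (by positivity)] at hd'
    linarith
end

section
/- The E₆ singularity f(x,y) = x³ + y⁴ satisfies lct₀(f) = 7/12. -/
open MeasureTheory

open Metric Set Filter Topology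

lemma integrableOn_ball_norm_sub_rpow {s : ℝ} (hs : s < 2) (ρ : ℂ) (R : ℝ) :
    IntegrableOn (fun u : ℂ => ‖u - ρ‖ ^ (-s)) (ball 0 R) := by
  have h0 : IntegrableOn (fun v : ℂ => ‖v‖ ^ (-s)) (ball 0 (R + ‖ρ‖)) := by
    refine integrableOn_ball_of_norm_le_rpow (C := 1) (α := s) ?_ ?_ ?_ ?_
    · simp
    · simpa using hs
    · refine ae_of_all _ fun x => ?_
      rw [Real.norm_of_nonneg (by positivity), one_mul]
    · exact (by fun_prop : Measurable fun v : ℂ => ‖v‖ ^ (-s)).aestronglyMeasurable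
  have h1 := ((measurePreserving_sub_right (volume : Measure ℂ) ρ).integrableOn_comp_preimage
    (MeasurableEquiv.subRight ρ).measurableEmbedding).2 h0
  refine h1.mono_set fun u hu => ?_
  simp only [mem_preimage, mem_ball_zero_iff] at hu ⊢
  linarith [norm_sub_le u ρ]

lemma mul_rpow_neg_le_of_half_le {s a b c : ℝ} (hs : 0 < s) (ha : 0 ≤ a) (hb : 1 / 2 ≤ b)
    (hc : 1 / 2 ≤ c) : (a * b * c) ^ (-s) ≤ 4 ^ s * a ^ (-s) := by
  rcases ha.eq_or_lt with rfl | ha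
  · simp [Real.zero_rpow (neg_ne_zero.2 hs.ne')]
  have h : a / 4 ≤ a * b * c := by
    have : 1 / 4 ≤ b * c := by nlinarith
    nlinarith
  calc (a * b * c) ^ (-s) ≤ (a / 4) ^ (-s) :=
        Real.rpow_le_rpow_of_nonpos (by positivity) h (by linarith)
    _ = 4 ^ s * a ^ (-s) := by
        rw [Real.div_rpow ha.le (by norm_num), Real.rpow_neg (by norm_num : (0 : ℝ) ≤ 4)]
        field_simp

lemma mul_rpow_neg_le_sum {E : Type*} [SeminormedAddCommGroup E] {s : ℝ} (hs : 0 < s)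
    {u x y z : E} (hxy : 1 ≤ ‖x - y‖) (hyz : 1 ≤ ‖y - z‖) (hxz : 1 ≤ ‖x - z‖) :
    (‖u - x‖ * ‖u - y‖ * ‖u - z‖) ^ (-s) ≤
      4 ^ s * (‖u - x‖ ^ (-s) + ‖u - y‖ ^ (-s) + ‖u - z‖ ^ (-s)) := by
  have key : ∀ v w : E, 1 ≤ ‖v - w‖ → 1 ≤ ‖u - v‖ + ‖u - w‖ := fun v w h => by
    have := norm_sub_le (u - w) (u - v)
    rw [sub_sub_sub_cancel_left] at this
    linarith
  have h1 := key x y hxy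
  have h2 := key y z hyz
  have h3 := key x z hxz
  have px : 0 ≤ (4 : ℝ) ^ s * ‖u - x‖ ^ (-s) := by positivity
  have py : 0 ≤ (4 : ℝ) ^ s * ‖u - y‖ ^ (-s) := by positivity
  have pz : 0 ≤ (4 : ℝ) ^ s * ‖u - z‖ ^ (-s) := by positivity
  rw [mul_add, mul_add]
  by_cases hx : ‖u - x‖ < 1 / 2
  · have := mul_rpow_neg_le_of_half_le hs (norm_nonneg (u - x))
      (by linarith : 1 / 2 ≤ ‖u - y‖) (by linarith : 1 / 2 ≤ ‖u - z‖)
    linarith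
  by_cases hy : ‖u - y‖ < 1 / 2
  · have := mul_rpow_neg_le_of_half_le hs (norm_nonneg (u - y))
      (by linarith : 1 / 2 ≤ ‖u - x‖) (by linarith : 1 / 2 ≤ ‖u - z‖)
    rw [mul_comm ‖u - y‖] at this
    linarith
  · have := mul_rpow_neg_le_of_half_le hs (norm_nonneg (u - z))
      (not_lt.1 hx) (not_lt.1 hy)
    rw [mul_assoc, mul_comm] at this
    linarith

lemma exists_cube_add_one_factorization : ∃ x y z : ℂ,
    (∀ u : ℂ, u ^ 3 + 1 = (u - x) * (u - y) * (u - z)) ∧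
      1 ≤ ‖x - y‖ ∧ 1 ≤ ‖y - z‖ ∧ 1 ≤ ‖x - z‖ := by
  have h3 : ((√3 : ℝ) : ℂ) ^ 2 = 3 := by
    rw [← Complex.ofReal_pow, Real.sq_sqrt (by norm_num)]; norm_num
  have hI := Complex.I_sq
  refine ⟨-1, 1 / 2 + (√3 : ℝ) / 2 * Complex.I, 1 / 2 - (√3 : ℝ) / 2 * Complex.I,
    fun u => ?_, ?_, ?_, ?_⟩
  · linear_combination (u + 1) / 4 * (-Complex.I ^ 2 * h3 - 3 * hI) * (-1)
  · refine le_trans ?_ (Complex.abs_re_le_norm _)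
    simp
    norm_num
  · refine le_trans ?_ (Complex.abs_im_le_norm _)
    have : (1 : ℝ) ≤ |√3| := (Real.one_le_sqrt.2 (by norm_num)).trans (le_abs_self _)
    simpa using this
  · refine le_trans ?_ (Complex.abs_re_le_norm _)
    simp
    norm_num

lemma integrable_norm_cube_add_one_rpow {c : ℝ} (h1 : 1 / 3 < c) (h2 : c < 1) :
    Integrable (fun u : ℂ => ‖u ^ 3 + 1‖ ^ (-2 * c)) := by
  have hm : Measurable (fun u : ℂ => ‖u ^ 3 + 1‖ ^ (-2 * c)) := by fun_prop
  rw [← integrableOn_univ, ← union_compl_self (ball (0 : ℂ) 2)]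
  refine IntegrableOn.union ?_ ?_
  · obtain ⟨x, y, z, hf, hxy, hyz, hxz⟩ := exists_cube_add_one_factorization
    have hi := fun ρ => integrableOn_ball_norm_sub_rpow (s := 2 * c) (by linarith) ρ 2
    refine Integrable.mono' ((((hi x).add (hi y)).add (hi z)).const_mul (4 ^ (2 * c)))
      hm.aestronglyMeasurable (ae_of_all _ fun u => ?_)
    rw [Real.norm_of_nonneg (by positivity), hf, norm_mul, norm_mul, neg_mul]
    exact mul_rpow_neg_le_sum (by linarith) hxy hyz hxz
  · have hi : Integrable (fun u : ℂ => (1 + ‖u‖) ^ (-(6 * c))) :=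
      integrable_one_add_norm (by simp; linarith)
    refine Integrable.mono' (hi.const_mul (4 ^ (2 * c))).integrableOn
      hm.aestronglyMeasurable ((ae_restrict_iff' measurableSet_ball.compl).2
      (ae_of_all _ fun u hu => ?_))
    have hu : 2 ≤ ‖u‖ := by simpa using hu
    have hb : (1 + ‖u‖) ^ 3 / 4 ≤ ‖u ^ 3 + 1‖ := by
      have := norm_sub_le_norm_add (u ^ 3) 1
      rw [norm_pow, norm_one] at this
      nlinarith [sq_nonneg (‖u‖ - 2)]
    rw [Real.norm_of_nonneg (by positivity)]
    calc ‖u ^ 3 + 1‖ ^ (-2 * c) ≤ ((1 + ‖u‖) ^ 3 / 4) ^ (-2 * c) :=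
          Real.rpow_le_rpow_of_nonpos (by positivity) hb (by linarith)
      _ = 4 ^ (2 * c) * (1 + ‖u‖) ^ (-(6 * c)) := by
          rw [Real.div_rpow (by positivity) (by norm_num), ← Real.rpow_natCast,
            ← Real.rpow_mul (by positivity), neg_mul, Real.rpow_neg (by norm_num : (0 : ℝ) ≤ 4),
            div_inv_eq_mul, mul_comm]
          congr 2
          push_cast
          ring

lemma Complex.measurePreserving_mul_left {a : ℂ} (ha : ‖a‖ = 1) :
    MeasurePreserving (fun u : ℂ => a * u) := by
  have := (rotation ⟨a, by simpa [Submonoid.unitSphere] using ha⟩).measurePreserving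
  exact this

lemma Complex.mul_eq_norm_smul {b : ℂ} (hb : b ≠ 0) (u : ℂ) :
    b * u = (b / ‖b‖) * (‖b‖ • u) := by
  have : (‖b‖ : ℂ) ≠ 0 := by simpa using hb
  rw [Complex.real_smul]
  field_simp

lemma Complex.integrable_comp_mul_left_iff {b : ℂ} (hb : b ≠ 0) (g : ℂ → ℝ) :
    Integrable (fun u => g (b * u)) ↔ Integrable g := by
  have ha : ‖b / ‖b‖‖ = 1 := by simp [hb]
  have ha0 : b / ‖b‖ ≠ 0 := by simp [hb]
  simp_rw [Complex.mul_eq_norm_smul hb]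
  rw [integrable_comp_smul_iff volume (fun v => g (b / ‖b‖ * v)) (norm_ne_zero_iff.2 hb)]
  exact (Complex.measurePreserving_mul_left ha).integrable_comp_emb
    (Homeomorph.mulLeft₀ _ ha0).measurableEmbedding

lemma Complex.integral_comp_mul_left {b : ℂ} (hb : b ≠ 0) (g : ℂ → ℝ) :
    ∫ u, g (b * u) = (‖b‖ ^ 2)⁻¹ * ∫ u, g u := by
  have ha : ‖b / ‖b‖‖ = 1 := by simp [hb]
  have ha0 : b / ‖b‖ ≠ 0 := by simp [hb]
  simp_rw [Complex.mul_eq_norm_smul hb]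
  rw [Measure.integral_comp_smul volume (fun v => g (b / ‖b‖ * v)),
    (Complex.measurePreserving_mul_left ha).integral_comp
      (Homeomorph.mulLeft₀ _ ha0).measurableEmbedding]
  simp

lemma norm_mul_cube_add_rpow (b u : ℂ) (s : ℝ) :
    ‖(b * u) ^ 3 + b ^ 3‖ ^ s = (‖b‖ ^ 3) ^ s * ‖u ^ 3 + 1‖ ^ s := by
  rw [← Real.mul_rpow (by positivity) (by positivity), ← norm_pow, ← norm_mul]
  congr 2
  ring

lemma integrable_norm_cube_add_cube_rpow {c : ℝ} (h1 : 1 / 3 < c) (h2 : c < 1) {b : ℂ}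
    (hb : b ≠ 0) : Integrable (fun x : ℂ => ‖x ^ 3 + b ^ 3‖ ^ (-2 * c)) := by
  rw [← Complex.integrable_comp_mul_left_iff hb]
  simp_rw [norm_mul_cube_add_rpow]
  exact (integrable_norm_cube_add_one_rpow h1 h2).const_mul _

lemma integral_norm_cube_add_cube_rpow (c : ℝ) {b : ℂ} (hb : b ≠ 0) :
    ∫ x : ℂ, ‖x ^ 3 + b ^ 3‖ ^ (-2 * c) =
      (∫ u : ℂ, ‖u ^ 3 + 1‖ ^ (-2 * c)) * ‖b‖ ^ (2 - 6 * c) := by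
  have h := Complex.integral_comp_mul_left hb fun x => ‖x ^ 3 + b ^ 3‖ ^ (-2 * c)
  simp_rw [norm_mul_cube_add_rpow] at h
  rw [integral_const_mul] at h
  have hb' : 0 < ‖b‖ := norm_pos_iff.2 hb
  have e : ‖b‖ ^ (2 - 6 * c) = ‖b‖ ^ 2 * (‖b‖ ^ 3) ^ (-2 * c) := by
    rw [← Real.rpow_natCast, ← Real.rpow_natCast, ← Real.rpow_mul hb'.le, ← Real.rpow_add hb']
    congr 1
    push_cast
    ring
  rw [e, mul_left_comm, mul_comm (∫ u : ℂ, _), h, mul_inv_cancel_left₀ (by positivity)]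

lemma exists_cube_eq_pow_four (y : ℂ) : ∃ b : ℂ, b ^ 3 = y ^ 4 ∧ ‖b‖ = ‖y‖ ^ (4 / 3 : ℝ) := by
  obtain ⟨b, hb⟩ := IsAlgClosed.exists_pow_nat_eq (y ^ 4) (by norm_num : 0 < 3)
  refine ⟨b, hb, ?_⟩
  have h : ‖b‖ ^ 3 = ‖y‖ ^ 4 := by rw [← norm_pow, hb, norm_pow]
  calc ‖b‖ = (‖b‖ ^ 3) ^ (1 / 3 : ℝ) := by
        rw [← Real.rpow_natCast, ← Real.rpow_mul (norm_nonneg b)]; norm_num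
    _ = ‖y‖ ^ (4 / 3 : ℝ) := by
        rw [h, ← Real.rpow_natCast, ← Real.rpow_mul (norm_nonneg y)]; norm_num

lemma integrableOn_ball_E6 {c : ℝ} (h1 : 1 / 3 < c) (h2 : c < 7 / 12) :
    IntegrableOn (fun p : ℂ × ℂ => ‖p.1 ^ 3 + p.2 ^ 4‖ ^ (-2 * c)) (ball (0 : ℂ × ℂ) 1) := by
  have hm : Measurable (fun p : ℂ × ℂ => ‖p.1 ^ 3 + p.2 ^ 4‖ ^ (-2 * c)) := by fun_prop
  have hfib : ∀ y : ℂ, y ≠ 0 → Integrable (fun x : ℂ => ‖x ^ 3 + y ^ 4‖ ^ (-2 * c)) ∧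
      ∫ x : ℂ, ‖x ^ 3 + y ^ 4‖ ^ (-2 * c) =
        (∫ u : ℂ, ‖u ^ 3 + 1‖ ^ (-2 * c)) * ‖y‖ ^ (-(8 * c - 8 / 3)) := fun y hy => by
    obtain ⟨b, hb, hn⟩ := exists_cube_eq_pow_four y
    have hb0 : b ≠ 0 := by
      rintro rfl
      exact pow_ne_zero 4 hy (by simpa using hb.symm)
    rw [← hb]
    refine ⟨integrable_norm_cube_add_cube_rpow h1 (by linarith) hb0, ?_⟩
    rw [integral_norm_cube_add_cube_rpow c hb0, hn, ← Real.rpow_mul (norm_nonneg y)]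
    congr 2
    ring
  have hae : ∀ᵐ y : ℂ ∂volume.restrict (ball 0 1), y ≠ 0 :=
    ae_restrict_of_ae (Measure.ae_ne volume 0)
  rw [← Prod.mk_zero_zero, ← ball_prod_same, IntegrableOn, Measure.volume_eq_prod,
    ← Measure.prod_restrict, integrable_prod_iff' hm.aestronglyMeasurable]
  refine ⟨hae.mono fun y hy => (hfib y hy).1.integrableOn, ?_⟩
  have hint := (integrableOn_ball_norm_sub_rpow (s := 8 * c - 8 / 3) (by linarith) 0 1).const_mul
    (∫ u : ℂ, ‖u ^ 3 + 1‖ ^ (-2 * c))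
  refine Integrable.mono' hint
    (hm.norm.stronglyMeasurable.integral_prod_left').aestronglyMeasurable (hae.mono fun y hy => ?_)
  have hpos : ∀ x : ℂ, 0 ≤ ‖x ^ 3 + y ^ 4‖ ^ (-2 * c) := fun x => by positivity
  simp_rw [Real.norm_of_nonneg (hpos _)]
  rw [Real.norm_of_nonneg (integral_nonneg hpos), sub_zero, ← (hfib y hy).2]
  exact setIntegral_le_integral (hfib y hy).1 (ae_of_all _ hpos)

lemma le_of_integrableOn_E6 {c ε : ℝ} (hε : 0 < ε)
    (h : IntegrableOn (fun p : ℂ × ℂ => ‖p.1 ^ 3 + p.2 ^ 4‖ ^ (-2 * c)) (ball (0 : ℂ × ℂ) ε)) :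
    c ≤ 7 / 12 := by
  by_contra! hc
  set M := ∫ p in ball (0 : ℂ × ℂ) ε, ‖p.1 ^ 3 + p.2 ^ 4‖ ^ (-2 * c)
  set K : ℝ := 3 ^ (-2 * c) * ((1 / 2) ^ 2 * Real.pi * ((1 / 4) ^ 2 * Real.pi)) with hK
  have hKpos : 0 < K := by positivity
  have hbound : ∀ t : ℝ, 0 < t → t < 1 → t < ε / 2 → t ^ (14 - 24 * c) ≤ M / K := by
    intro t ht ht1 htε
    have ht3 : t ^ 3 ≤ t := pow_le_of_le_one ht.le ht1.le (by norm_num)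
    have ht4 : t ^ 4 ≤ t := pow_le_of_le_one ht.le ht1.le (by norm_num)
    set Q := ball (0 : ℂ) (t ^ 4 / 2) ×ˢ ball ((t : ℂ) ^ 3) (t ^ 3 / 4) with hQ
    have hnt : ‖(t : ℂ) ^ 3‖ = t ^ 3 := by simp [abs_of_pos ht]
    have hQm : ∀ p ∈ Q, ‖p.1‖ < t ^ 4 / 2 ∧ 3 / 4 * t ^ 3 < ‖p.2‖ ∧ ‖p.2‖ < 5 / 4 * t ^ 3 := by
      rintro ⟨x, y⟩ ⟨hx, hy⟩
      dsimp only at hx hy ⊢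
      rw [mem_ball_zero_iff] at hx
      rw [mem_ball, dist_eq_norm] at hy
      have i1 := norm_sub_norm_le y ((t : ℂ) ^ 3)
      have i2 := norm_sub_norm_le ((t : ℂ) ^ 3) y
      rw [norm_sub_rev] at i2
      exact ⟨hx, by linarith, by linarith⟩
    have hsub : Q ⊆ ball 0 ε := by
      intro p hp
      obtain ⟨a, b, d⟩ := hQm p hp
      rw [mem_ball_zero_iff, Prod.norm_def, max_lt_iff]
      constructor <;> linarith
    have hlow : ∀ p ∈ Q, (3 * t ^ 12) ^ (-2 * c) ≤ ‖p.1 ^ 3 + p.2 ^ 4‖ ^ (-2 * c) := by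
      intro p hp
      obtain ⟨a, b, d⟩ := hQm p hp
      have j1 : ‖p.1‖ ^ 3 ≤ (t ^ 4 / 2) ^ 3 := by gcongr
      have j2 : ‖p.2‖ ^ 4 ≤ (5 / 4 * t ^ 3) ^ 4 := by gcongr
      have j3 : (3 / 4 * t ^ 3) ^ 4 ≤ ‖p.2‖ ^ 4 := by gcongr
      have ht12 : 0 < t ^ 12 := by positivity
      have k1 := norm_add_le (p.1 ^ 3) (p.2 ^ 4)
      have k2 := norm_sub_le_norm_add (p.2 ^ 4) (p.1 ^ 3)
      rw [norm_pow, norm_pow] at k1 k2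
      rw [add_comm (p.2 ^ 4)] at k2
      ring_nf at j1 j2 j3
      refine Real.rpow_le_rpow_of_nonpos ?_ ?_ (by linarith) <;> linarith
    have hvol : (volume : Measure (ℂ × ℂ)).real Q =
        (1 / 2) ^ 2 * Real.pi * ((1 / 4) ^ 2 * Real.pi) * t ^ 14 := by
      rw [hQ, Measure.volume_eq_prod, measureReal_prod_prod]
      simp only [Measure.real, Complex.volume_ball, ENNReal.toReal_mul, ENNReal.toReal_pow]
      rw [ENNReal.toReal_ofReal (by positivity), ENNReal.toReal_ofReal (by positivity)]
      simp
      ring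
    have hfin : volume Q ≠ ⊤ := ((measure_mono hsub).trans_lt measure_ball_lt_top).ne
    have hle := (setIntegral_ge_of_const_le_real (measurableSet_ball.prod measurableSet_ball)
      hfin hlow (h.mono_set hsub)).trans
      (setIntegral_mono_set h (ae_of_all _ fun p => by positivity) hsub.eventuallyLE)
    rw [le_div_iff₀ hKpos]
    refine le_trans (le_of_eq ?_) hle
    rw [hvol, hK, Real.mul_rpow (by norm_num) (by positivity), ← Real.rpow_natCast t 12,
      ← Real.rpow_mul ht.le, ← Real.rpow_natCast t 14,
      show 14 - 24 * c = ((12 : ℕ) : ℝ) * (-2 * c) + ((14 : ℕ) : ℝ) by push_cast; ring,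
      Real.rpow_add ht]
    ring
  have hlim := tendsto_rpow_neg_nhdsGT_zero (y := 14 - 24 * c) (by linarith)
  have hsmall : ∀ᶠ t : ℝ in 𝓝[>] 0, t ∈ Ioo 0 (min 1 (ε / 2)) :=
    Ioo_mem_nhdsGT (by positivity)
  obtain ⟨t, ht, ht0, ht1⟩ := ((hlim.eventually_gt_atTop (M / K)).and hsmall).exists
  rw [lt_min_iff] at ht1
  exact absurd (hbound t ht0 ht1.1 ht1.2) (not_le.2 ht)

theorem lct_E6 : lct₀ (fun p : ℂ × ℂ => p.1 ^ 3 + p.2 ^ 4) = 7 / 12 := by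
  have hmem : ∀ c : ℝ, 1 / 3 < c → c < 7 / 12 → c ∈ { c : ℝ | 0 ≤ c ∧ ∃ ε : ℝ, 0 < ε ∧
      IntegrableOn (fun p : ℂ × ℂ => ‖p.1 ^ 3 + p.2 ^ 4‖ ^ (-2 * c))
        (ball (0 : ℂ × ℂ) ε) volume } :=
    fun c h1 h2 => ⟨by linarith, 1, one_pos, integrableOn_ball_E6 h1 h2⟩
  refine csSup_eq_of_forall_le_of_forall_lt_exists_gt
    ⟨1 / 2, hmem _ (by norm_num) (by norm_num)⟩
    (fun c ⟨_, ε, hε, h⟩ => le_of_integrableOn_E6 hε h) fun w hw => ?_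
  obtain ⟨c, hc1, hc2⟩ := exists_between (max_lt hw (by norm_num : (1 / 3 : ℝ) < 7 / 12))
  exact ⟨c, hmem c ((le_max_right _ _).trans_lt hc1) hc2, (le_max_left _ _).trans_lt hc1⟩
end

section
/- The E₇ singularity f(x,y) = x³ + x y³ satisfies lct₀(f) = 5/9. -/
open MeasureTheory

open Set Metric

theorem map_mul_left_volume_complex {s : ℂ} (hs : s ≠ 0) :
    Measure.map (fun z : ℂ => s * z) volume = ENNReal.ofReal ((‖s‖ ^ 2)⁻¹) • volume := by
  have hdet : LinearMap.det (Algebra.lmul ℝ ℂ s) = ‖s‖ ^ 2 := by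
    rw [← Algebra.norm_apply, Algebra.norm_complex_apply, Complex.normSq_eq_norm_sq]
  have h := Measure.map_linearMap_addHaar_eq_smul_addHaar (volume : Measure ℂ)
    (f := Algebra.lmul ℝ ℂ s) (by rw [hdet]; positivity)
  rw [hdet, abs_of_nonneg (by positivity)] at h
  exact h

theorem lintegral_comp_mul_left_complex_s9 {s : ℂ} (hs : s ≠ 0) {G : ℂ → ENNReal}
    (hG : Measurable G) :
    ∫⁻ z, G (s * z) = ENNReal.ofReal ((‖s‖ ^ 2)⁻¹) * ∫⁻ z, G z := by
  rw [← smul_eq_mul, ← lintegral_smul_measure, ← map_mul_left_volume_complex hs,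
    lintegral_map hG (measurable_const_mul s)]

theorem map_diagonal_volume_complex {a b : ℂ} (ha : a ≠ 0) (hb : b ≠ 0) :
    Measure.map (fun p : ℂ × ℂ => (a * p.1, b * p.2)) volume =
      ENNReal.ofReal ((‖a‖ ^ 2 * ‖b‖ ^ 2)⁻¹) • volume := by
  have h := Measure.map_prod_map (volume : Measure ℂ) (volume : Measure ℂ)
    (measurable_const_mul a) (measurable_const_mul b)
  rw [map_mul_left_volume_complex ha, map_mul_left_volume_complex hb, Measure.prod_smul_left,
    Measure.prod_smul_right, smul_smul, ← ENNReal.ofReal_mul (by positivity)] at h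
  rw [mul_inv]
  exact h.symm

theorem integrableOn_ball_norm_rpow_complex {t : ℝ} (ht : -2 < t) :
    IntegrableOn (fun z : ℂ => ‖z‖ ^ t) (ball 0 1) := by
  refine (integrableOn_fun_norm_addHaar (f := fun r : ℝ => r ^ t) volume).2 ?_
  have h := (intervalIntegral.integrableOn_Ioo_rpow_iff (s := 1 + t) one_pos).2 (by linarith)
  refine h.congr_fun (fun r hr => ?_) measurableSet_Ioo
  simp [Complex.finrank_real_complex, Real.rpow_add hr.1]

theorem integrable_norm_rpow_mul_one_add_norm_rpow {c : ℝ} (h1 : 1 / 2 < c) (h2 : c < 1) :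
    Integrable (fun z : ℂ => ‖z‖ ^ (-2 * c) * (1 + ‖z‖) ^ (-4 * c)) := by
  have hball := (integrable_indicator_iff measurableSet_ball).2
    (integrableOn_ball_norm_rpow_complex (t := -2 * c) (by linarith))
  have hinf : Integrable (fun z : ℂ => (1 + ‖z‖) ^ (-(4 * c))) :=
    integrable_one_add_norm (by rw [Complex.finrank_real_complex]; norm_num; linarith)
  refine (hball.add hinf).mono' (by fun_prop) (.of_forall fun z => ?_)
  rw [Real.norm_of_nonneg (by positivity), Pi.add_apply, neg_mul 4 c]
  by_cases hz : z ∈ ball (0 : ℂ) 1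
  · rw [indicator_of_mem hz]
    have : (1 + ‖z‖) ^ (-(4 * c)) ≤ 1 :=
      Real.rpow_le_one_of_one_le_of_nonpos (by linarith [norm_nonneg z]) (by linarith)
    exact (mul_le_of_le_one_right (by positivity) this).trans
      (le_add_of_nonneg_right (by positivity))
  · rw [indicator_of_notMem hz, zero_add]
    have : ‖z‖ ^ (-2 * c) ≤ 1 :=
      Real.rpow_le_one_of_one_le_of_nonpos (by simpa using hz) (by linarith)
    exact mul_le_of_le_one_left (by positivity) this

theorem rpow_mul_mul_le_of_le {r a b c : ℝ} (hc : 0 ≤ c) (hr : 0 ≤ r) (ha : r ≤ a) (hb : r ≤ b)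
    (ha' : 1 ≤ r + a) (hb' : 1 ≤ r + b) :
    (r * (a * b)) ^ (-2 * c) ≤ 3 ^ (4 * c) * (r ^ (-2 * c) * (1 + r) ^ (-4 * c)) := by
  have hab : ((1 + r) / 3) ^ 2 ≤ a * b := by
    rw [sq]
    exact mul_le_mul (by linarith) (by linarith) (by linarith) (by linarith)
  have h1 : (a * b) ^ (-2 * c) ≤ (((1 + r) / 3) ^ 2) ^ (-2 * c) :=
    Real.rpow_le_rpow_of_nonpos (by positivity) hab (by linarith)
  have h2 : (((1 + r) / 3) ^ 2) ^ (-2 * c) = 3 ^ (4 * c) * (1 + r) ^ (-4 * c) := by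
    rw [← Real.rpow_natCast, ← Real.rpow_mul (by positivity),
      Real.div_rpow (by positivity) (by norm_num), div_eq_mul_inv, ← Real.rpow_neg (by norm_num)]
    push_cast
    ring_nf
  rw [Real.mul_rpow hr (by nlinarith)]
  calc _ ≤ r ^ (-2 * c) * (3 ^ (4 * c) * (1 + r) ^ (-4 * c)) := by
        rw [← h2]; gcongr
    _ = _ := by ring

theorem integrable_norm_mul_sq_add_one_rpow {c : ℝ} (h1 : 1 / 2 < c) (h2 : c < 1) :
    Integrable (fun u : ℂ => ‖u * (u ^ 2 + 1)‖ ^ (-2 * c)) := by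
  have h := integrable_norm_rpow_mul_one_add_norm_rpow h1 h2
  refine (((h.add (h.comp_sub_right Complex.I)).add (h.comp_add_right Complex.I)).const_mul
    (3 ^ (4 * c))).mono' (Measurable.aestronglyMeasurable (by fun_prop)) (.of_forall fun u => ?_)
  rw [Real.norm_of_nonneg (by positivity)]
  simp only [Pi.add_apply]
  have e : ‖u * (u ^ 2 + 1)‖ = ‖u‖ * (‖u - Complex.I‖ * ‖u + Complex.I‖) := by
    rw [← norm_mul, ← norm_mul]
    congr 2
    linear_combination Complex.I_sq
  have d1 : 1 ≤ ‖u‖ + ‖u - Complex.I‖ := by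
    simpa using norm_sub_le u (u - Complex.I)
  have d2 : 1 ≤ ‖u‖ + ‖u + Complex.I‖ := by
    simpa [add_comm] using norm_sub_le (u + Complex.I) u
  have d3 : 1 ≤ ‖u - Complex.I‖ + ‖u + Complex.I‖ := by
    have := norm_sub_le (u + Complex.I) (u - Complex.I)
    rw [show u + Complex.I - (u - Complex.I) = 2 * Complex.I by ring] at this
    simp at this
    linarith
  have p : ∀ v : ℂ, 0 ≤ ‖v‖ ^ (-2 * c) * (1 + ‖v‖) ^ (-4 * c) := fun v => by positivity
  have k : (0 : ℝ) ≤ 3 ^ (4 * c) := by positivity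
  have hc : 0 ≤ c := by linarith
  have n := norm_nonneg u
  have n1 := norm_nonneg (u - Complex.I)
  have n2 := norm_nonneg (u + Complex.I)
  rw [e]
  by_cases m1 : ‖u‖ ≤ ‖u - Complex.I‖ ∧ ‖u‖ ≤ ‖u + Complex.I‖
  · refine (rpow_mul_mul_le_of_le hc n m1.1 m1.2 d1 d2).trans ?_
    gcongr
    linarith [p (u - Complex.I), p (u + Complex.I)]
  by_cases m2 : ‖u - Complex.I‖ ≤ ‖u‖ ∧ ‖u - Complex.I‖ ≤ ‖u + Complex.I‖
  · rw [mul_left_comm]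
    refine (rpow_mul_mul_le_of_le hc n1 m2.1 m2.2 (by linarith) d3).trans ?_
    gcongr
    linarith [p u, p (u + Complex.I)]
  have m3 : ‖u + Complex.I‖ ≤ ‖u‖ ∧ ‖u + Complex.I‖ ≤ ‖u - Complex.I‖ := by grind
  rw [← mul_assoc, mul_comm]
  refine (rpow_mul_mul_le_of_le hc n2 m3.1 m3.2 (by linarith) (by linarith)).trans ?_
  gcongr
  linarith [p u, p (u - Complex.I)]

theorem lintegral_norm_E7_rpow_fiber {c : ℝ} {y : ℂ} (hy : y ≠ 0) :
    ∫⁻ x : ℂ, ENNReal.ofReal (‖x ^ 3 + x * y ^ 3‖ ^ (-2 * c)) =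
      ENNReal.ofReal (‖y‖ ^ (3 - 9 * c)) *
        ∫⁻ u : ℂ, ENNReal.ofReal (‖u * (u ^ 2 + 1)‖ ^ (-2 * c)) := by
  obtain ⟨s, hs⟩ := IsAlgClosed.exists_pow_nat_eq (y ^ 3) (n := 2) two_pos
  have hs0 : s ≠ 0 := by
    rintro rfl
    exact pow_ne_zero 3 hy (by simpa using hs.symm)
  have hy' : 0 < ‖y‖ := norm_pos_iff.2 hy
  have hs' : 0 < ‖s‖ := norm_pos_iff.2 hs0
  have hn : ‖s‖ = ‖y‖ ^ (3 / 2 : ℝ) := by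
    have h : ‖s‖ ^ 2 = ‖y‖ ^ 3 := by rw [← norm_pow, hs, norm_pow]
    rw [← Real.sqrt_sq hs'.le, h, Real.sqrt_eq_rpow, ← Real.rpow_natCast, ← Real.rpow_mul hy'.le]
    norm_num
  have key := lintegral_comp_mul_left_complex_s9 (inv_ne_zero hs0)
    (G := fun u => ENNReal.ofReal (‖u * (u ^ 2 + 1)‖ ^ (-2 * c))) (by fun_prop)
  have hpt : ∀ x : ℂ, ENNReal.ofReal (‖x ^ 3 + x * y ^ 3‖ ^ (-2 * c)) =
      ENNReal.ofReal ((‖s‖ ^ 3) ^ (-2 * c)) *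
        ENNReal.ofReal (‖s⁻¹ * x * ((s⁻¹ * x) ^ 2 + 1)‖ ^ (-2 * c)) := by
    intro x
    rw [← ENNReal.ofReal_mul (by positivity), ← Real.mul_rpow (by positivity) (by positivity),
      ← norm_pow, ← norm_mul, ← hs]
    congr 3
    field_simp
  simp_rw [hpt]
  rw [lintegral_const_mul _ (by fun_prop), key, ← mul_assoc,
    ← ENNReal.ofReal_mul (by positivity), norm_inv, inv_pow, inv_inv, hn]
  congr 2
  simp only [← Real.rpow_natCast, ← Real.rpow_mul hy'.le, ← Real.rpow_add hy']
  congr 1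
  push_cast
  ring

theorem integrableOn_norm_E7_rpow {c : ℝ} (h1 : 1 / 2 < c) (h2 : c < 5 / 9) :
    IntegrableOn (fun p : ℂ × ℂ => ‖p.1 ^ 3 + p.1 * p.2 ^ 3‖ ^ (-2 * c)) (ball 0 1) := by
  refine ⟨Measurable.aestronglyMeasurable (by fun_prop), ?_⟩
  rw [hasFiniteIntegral_iff_ofReal (.of_forall fun p => by positivity),
    ← Prod.mk_zero_zero, ← ball_prod_same, Measure.volume_eq_prod, ← Measure.prod_restrict,
    lintegral_prod_symm _ (by fun_prop)]
  have hK := (integrable_norm_mul_sq_add_one_rpow h1 (by linarith)).lintegral_lt_top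
  have hY := (integrableOn_ball_norm_rpow_complex (t := 3 - 9 * c) (by linarith)).lintegral_lt_top
  refine lt_of_le_of_lt ?_ (ENNReal.mul_lt_top hY hK)
  rw [← lintegral_mul_const _ (by fun_prop)]
  refine lintegral_mono_ae (ae_restrict_of_ae ?_)
  filter_upwards [Measure.ae_ne volume (0 : ℂ)] with y hy
  exact (setLIntegral_le_lintegral _ _).trans (lintegral_norm_E7_rpow_fiber hy).le

theorem not_integrableOn_norm_E7_rpow {c ε : ℝ} (hc : 5 / 9 ≤ c) (hε : 0 < ε) :
    ¬ IntegrableOn (fun p : ℂ × ℂ => ‖p.1 ^ 3 + p.1 * p.2 ^ 3‖ ^ (-2 * c)) (ball 0 ε) := by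
  intro hint
  set F : ℂ × ℂ → ENNReal :=
    fun p => ENNReal.ofReal (‖p.1 ^ 3 + p.1 * p.2 ^ 3‖ ^ (-2 * c)) with hF
  have hFm : Measurable F := by fun_prop
  have hfin : ∫⁻ p in ball 0 ε, F p ≠ ⊤ := hint.lintegral_lt_top.ne
  set T : ℂ × ℂ → ℂ × ℂ := fun p => (8⁻¹ * p.1, 4⁻¹ * p.2) with hT
  have hTm : Measurable T := by fun_prop
  have hFT : ∀ p, 1024 * F p ≤ F (T p) := by
    intro p
    have e : ‖(T p).1 ^ 3 + (T p).1 * (T p).2 ^ 3‖ = 512⁻¹ * ‖p.1 ^ 3 + p.1 * p.2 ^ 3‖ := by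
      rw [show (512⁻¹ : ℝ) = ‖(512⁻¹ : ℂ)‖ by simp, ← norm_mul]
      congr 1
      simp only [hT]
      ring
    have k : (1024 : ℝ) ≤ (512⁻¹) ^ (-2 * c) := by
      rw [show (512⁻¹ : ℝ) = 2 ^ (-9 : ℝ) by norm_num [Real.rpow_neg], ← Real.rpow_mul two_pos.le,
        show (1024 : ℝ) = 2 ^ (10 : ℝ) by norm_num]
      exact Real.rpow_le_rpow_of_exponent_le one_le_two (by linarith)
    simp only [hF]
    rw [e, Real.mul_rpow (by positivity) (by positivity), ENNReal.ofReal_mul (by positivity)]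
    gcongr
    simpa using ENNReal.ofReal_le_ofReal k
  have hmap : Measure.map T volume = (1024 : ENNReal) • volume := by
    rw [hT, map_diagonal_volume_complex (by norm_num) (by norm_num)]
    norm_num
  have hle : 1024 * ∫⁻ p in T ⁻¹' ball 0 ε, F p ≤ 1024 * ∫⁻ p in ball 0 ε, F p := by
    rw [← lintegral_const_mul _ hFm, ← smul_eq_mul (1024 : ENNReal), ← lintegral_smul_measure,
      ← Measure.restrict_smul, ← hmap, setLIntegral_map measurableSet_ball hFm hTm]
    exact lintegral_mono hFT
  replace hle := (ENNReal.mul_le_mul_iff_right (by norm_num) (by norm_num)).1 hle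
  set U : Set (ℂ × ℂ) :=
    {p | (ε < ‖p.1‖ ∧ ‖p.1‖ < 8 * ε) ∧ ‖p.2‖ < 4 * ε ∧ p.1 ^ 3 + p.1 * p.2 ^ 3 ≠ 0} with hU
  have hUo : IsOpen U := by
    rw [hU]
    simp only [ofPred_and]
    exact ((isOpen_lt (by fun_prop) (by fun_prop)).inter
      (isOpen_lt (by fun_prop) (by fun_prop))).inter
      ((isOpen_lt (by fun_prop) (by fun_prop)).inter (isOpen_ne_fun (by fun_prop) (by fun_prop)))
  have hUne : U.Nonempty := by
    refine ⟨((2 * ε : ℝ), 0), ⟨?_, ?_⟩, ?_, ?_⟩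
    · rw [Complex.norm_of_nonneg (by positivity)]; linarith
    · rw [Complex.norm_of_nonneg (by positivity)]; linarith
    · simpa using hε
    · simp [hε.ne']
  have hUpos : 0 < ∫⁻ p in U, F p := by
    rw [setLIntegral_pos_iff hFm, inter_eq_right.2]
    · exact hUo.measure_pos _ hUne
    · intro p hp
      have := norm_pos_iff.2 hp.2.2
      simp only [hF, Function.mem_support, ne_eq, ENNReal.ofReal_eq_zero, not_le]
      positivity
  have hsub : ball 0 ε ∪ U ⊆ T ⁻¹' ball 0 ε := by
    rw [union_subset_iff]
    constructor <;> intro p hp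
    · simp only [mem_preimage, mem_ball_zero_iff, Prod.norm_def, max_lt_iff, hT, norm_mul] at hp ⊢
      norm_num
      constructor <;> linarith [hp.1, hp.2]
    · simp only [mem_preimage, mem_ball_zero_iff, Prod.norm_def, max_lt_iff, hT, norm_mul]
      norm_num
      constructor <;> linarith [hp.1.2, hp.2.1]
  have hdisj : Disjoint (ball 0 ε) U := by
    rw [Set.disjoint_left]
    intro p hp hpU
    rw [mem_ball_zero_iff] at hp
    linarith [norm_fst_le p, hpU.1.1]
  have hsum : (∫⁻ p in ball 0 ε, F p) + ∫⁻ p in U, F p ≤ ∫⁻ p in ball 0 ε, F p := by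
    rw [← lintegral_union hUo.measurableSet hdisj]
    exact (lintegral_mono_set hsub).trans hle
  exact absurd hsum (not_le.2 (ENNReal.lt_add_right hfin hUpos.ne'))

theorem lct_E7 : lct₀ (fun p : ℂ × ℂ => p.1 ^ 3 + p.1 * p.2 ^ 3) = 5 / 9 := by
  have hmem : ∀ c : ℝ, 1 / 2 < c → c < 5 / 9 → c ∈ { c : ℝ | 0 ≤ c ∧ ∃ ε : ℝ, 0 < ε ∧
      IntegrableOn (fun p : ℂ × ℂ => ‖p.1 ^ 3 + p.1 * p.2 ^ 3‖ ^ (-2 * c))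
        (ball (0 : ℂ × ℂ) ε) volume } :=
    fun c h1 h2 => ⟨by linarith, 1, one_pos, integrableOn_norm_E7_rpow h1 h2⟩
  refine csSup_eq_of_forall_le_of_forall_lt_exists_gt ?_ ?_ ?_
  · exact ⟨11 / 20, hmem _ (by norm_num) (by norm_num)⟩
  · rintro c ⟨-, ε, hε, hint⟩
    by_contra! hc
    exact not_integrableOn_norm_E7_rpow hc.le hε hint
  · intro w hw
    obtain ⟨c, h1, h2⟩ := exists_between (max_lt hw (by norm_num : (1 / 2 : ℝ) < 5 / 9))
    exact ⟨c, hmem c ((le_max_right _ _).trans_lt h1) h2, (le_max_left _ _).trans_lt h1⟩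
end

section
/- The E₈ singularity f(x,y) = x³ + y⁵ satisfies lct₀(f) = 8/15. -/
open MeasureTheory

open Set Metric

/-- A partial-fraction bound for the modulus of `1 / (u ^ 3 - 1)` raised to a power. -/
lemma norm_cube_sub_one_rpow_le {s : ℝ} (hs : 0 < s) {ω : ℂ} (hω : ω ^ 2 + ω + 1 = 0) (u : ℂ) :
    ‖u ^ 3 - 1‖ ^ (-s) ≤ ‖u - 1‖ ^ (-s) + ‖u - ω‖ ^ (-s) + ‖u - ω ^ 2‖ ^ (-s) := by
  have hω3 : ω ^ 3 = 1 := by linear_combination (ω - 1) * hω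
  have hn : ‖ω‖ = 1 := Complex.norm_eq_one_of_pow_eq_one hω3 (by norm_num)
  have hfac : u ^ 3 - 1 = (u - 1) * (u - ω) * (u - ω ^ 2) := by
    linear_combination (u ^ 2 - u * ω) * hω + hω3
  have key : ∀ x y z t : ℝ, 0 ≤ x → 0 ≤ y → 0 ≤ z → 0 ≤ t → t ≤ (x + y + z) / 3 →
      t ^ s ≤ x ^ s + y ^ s + z ^ s := by
    intro x y z t hx hy hz ht h
    have hx' := Real.rpow_nonneg hx s
    have hy' := Real.rpow_nonneg hy s
    have hz' := Real.rpow_nonneg hz s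
    have : t ≤ x ∨ t ≤ y ∨ t ≤ z := by
      by_contra! hcon
      linarith [hcon.1, hcon.2.1, hcon.2.2]
    rcases this with h | h | h <;> linarith [Real.rpow_le_rpow ht h hs.le]
  by_cases h0 : u ^ 3 - 1 = 0
  · rw [h0, norm_zero, Real.zero_rpow (by linarith)]
    positivity
  have h1 : u - 1 ≠ 0 := fun h ↦ h0 (by rw [hfac, h]; ring)
  have h2 : u - ω ≠ 0 := fun h ↦ h0 (by rw [hfac, h]; ring)
  have h3 : u - ω ^ 2 ≠ 0 := fun h ↦ h0 (by rw [hfac, h]; ring)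
  have hpf : (u ^ 3 - 1)⁻¹ =
      ((u - 1)⁻¹ + ω * (u - ω)⁻¹ + ω ^ 2 * (u - ω ^ 2)⁻¹) / 3 := by
    have hid : (u - ω) * (u - ω ^ 2) + ω * ((u - 1) * (u - ω ^ 2))
        + ω ^ 2 * ((u - 1) * (u - ω)) = 3 := by
      linear_combination (u ^ 2 - 2 * u * ω) * hω + 3 * hω3
    rw [hfac]
    field_simp
    linear_combination -hid
  have := key ‖u - 1‖⁻¹ ‖u - ω‖⁻¹ ‖u - ω ^ 2‖⁻¹ ‖u ^ 3 - 1‖⁻¹ (by positivity) (by positivity)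
    (by positivity) (by positivity) (by
      rw [← norm_inv, hpf, norm_div]
      have h3 : ‖(3 : ℂ)‖ = 3 := by simp
      rw [h3]
      gcongr
      refine (norm_add₃_le).trans ?_
      simp [hn])
  simpa only [Real.inv_rpow (norm_nonneg _), ← Real.rpow_neg (norm_nonneg _)] using this

lemma locallyIntegrable_norm_sub_rpow {s : ℝ} (hs : s < 2) (a : ℂ) :
    LocallyIntegrable (fun u : ℂ ↦ ‖u - a‖ ^ (-s)) := by
  rw [locallyIntegrable_iff]
  intro k hk
  obtain ⟨R, hR, hkR⟩ := hk.isBounded.subset_ball_lt 0 a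
  refine IntegrableOn.mono_set ?_ hkR
  have h0 : IntegrableOn (fun u : ℂ ↦ ‖u‖ ^ (-s)) (ball 0 R) := by
    refine integrableOn_ball_of_norm_le_rpow (C := 1) (α := s) (by simp) (by simpa using hs) ?_ ?_
    · refine Filter.Eventually.of_forall fun u ↦ ?_
      rw [Real.norm_of_nonneg (by positivity), one_mul]
    · exact (by fun_prop : Measurable fun u : ℂ ↦ ‖u‖ ^ (-s)).aestronglyMeasurable
  have := (measurePreserving_sub_right (volume : Measure ℂ) a).integrableOn_comp_preimage
    (measurableEmbedding_subRight a) |>.2 h0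
  have hpre : (fun u ↦ u - a) ⁻¹' ball 0 R = ball a R := by
    ext u
    simp [dist_eq_norm]
  rw [hpre] at this
  exact this

lemma integrable_norm_cube_sub_one_rpow {s : ℝ} (h1 : 2 / 3 < s) (h2 : s < 2) :
    Integrable (fun u : ℂ ↦ ‖u ^ 3 - 1‖ ^ (-s)) := by
  obtain ⟨ω, hω⟩ : ∃ ω : ℂ, ω ^ 2 + ω + 1 = 0 := by
    obtain ⟨t, ht⟩ := IsAlgClosed.exists_pow_nat_eq (-3 : ℂ) (n := 2) (by norm_num)
    exact ⟨(-1 + t) / 2, by linear_combination ht / 4⟩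
  have hmeas : Measurable (fun u : ℂ ↦ ‖u ^ 3 - 1‖ ^ (-s)) := by fun_prop
  rw [← integrableOn_univ, ← union_compl_self (closedBall (0 : ℂ) 2)]
  refine IntegrableOn.union ?_ ?_
  · have hc := isCompact_closedBall (0 : ℂ) 2
    have hl := fun a ↦ (locallyIntegrable_norm_sub_rpow h2 a).integrableOn_isCompact hc
    refine Integrable.mono' (((hl 1).add (hl ω)).add (hl (ω ^ 2))) hmeas.aestronglyMeasurable ?_
    refine Filter.Eventually.of_forall fun u ↦ ?_
    rw [Real.norm_of_nonneg (by positivity)]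
    exact norm_cube_sub_one_rpow_le (by linarith) hω u
  · have hj : Integrable (fun u : ℂ ↦ (1 + ‖u‖) ^ (-(3 * s))) :=
      integrable_one_add_norm (by simp; linarith)
    refine Integrable.mono' (hj.integrableOn.const_mul (4 ^ s)) hmeas.aestronglyMeasurable ?_
    refine (ae_restrict_iff' (measurableSet_closedBall.compl)).2
      (Filter.Eventually.of_forall fun u hu ↦ ?_)
    have hu : 2 < ‖u‖ := by simpa using hu
    rw [Real.norm_of_nonneg (by positivity)]
    have hlow : (1 + ‖u‖) ^ 3 / 4 ≤ ‖u ^ 3 - 1‖ := by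
      have := norm_sub_norm_le (u ^ 3) 1
      rw [norm_pow, norm_one] at this
      nlinarith [mul_pos (sub_pos.2 hu) (sub_pos.2 hu), mul_pos (mul_pos (sub_pos.2 hu)
        (sub_pos.2 hu)) (sub_pos.2 hu)]
    calc ‖u ^ 3 - 1‖ ^ (-s) ≤ ((1 + ‖u‖) ^ 3 / 4) ^ (-s) :=
          Real.rpow_le_rpow_of_nonpos (by positivity) hlow (by linarith)
      _ = 4 ^ s * (1 + ‖u‖) ^ (-(3 * s)) := by
          rw [Real.div_rpow (by positivity) (by norm_num), ← Real.rpow_natCast,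
            ← Real.rpow_mul (by positivity), Real.rpow_neg (by norm_num : (0 : ℝ) ≤ 4)]
          push_cast
          rw [mul_neg, div_inv_eq_mul, mul_comm]

/-- Multiplication by a complex number is a rotation composed with a real scaling. -/
lemma Complex.exists_circle_mul_eq (w : ℂ) :
    ∃ a : Circle, ∀ x : ℂ, w * x = ‖w‖ • rotation a x := by
  refine ⟨Circle.exp w.arg, fun x ↦ ?_⟩
  rw [rotation_apply, Complex.real_smul, Circle.coe_exp, ← mul_assoc,
    Complex.norm_mul_exp_arg_mul_I]

lemma Complex.integrable_comp_mul_left {h : ℂ → ℝ} (hh : Integrable h) {w : ℂ} (hw : w ≠ 0) :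
    Integrable (fun x ↦ h (w * x)) := by
  obtain ⟨a, ha⟩ := Complex.exists_circle_mul_eq w
  simp only [ha]
  exact (rotation a).measurePreserving.integrable_comp_of_integrable
    (hh.comp_smul (norm_ne_zero_iff.2 hw))

lemma Complex.integral_comp_mul_left_s10 (h : ℂ → ℝ) (w : ℂ) :
    ∫ x, h (w * x) = (‖w‖ ^ 2)⁻¹ * ∫ x, h x := by
  obtain ⟨a, ha⟩ := Complex.exists_circle_mul_eq w
  simp only [ha]
  rw [(rotation a).measurePreserving.integral_comp
    (rotation a).toHomeomorph.measurableEmbedding (fun x ↦ h (‖w‖ • x)),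
    Measure.integral_comp_smul, Complex.finrank_real_complex, abs_of_nonneg (by positivity),
    smul_eq_mul]

lemma integrable_and_integral_norm_cube_add {s : ℝ} (h1 : 2 / 3 < s) (h2 : s < 2)
    {z : ℂ} (hz : z ≠ 0) :
    Integrable (fun x : ℂ ↦ ‖x ^ 3 + z‖ ^ (-s)) ∧
      ∫ x : ℂ, ‖x ^ 3 + z‖ ^ (-s) = ‖z‖ ^ (2 / 3 - s) * ∫ u : ℂ, ‖u ^ 3 - 1‖ ^ (-s) := by
  obtain ⟨w, hw⟩ := IsAlgClosed.exists_pow_nat_eq (-z) (n := 3) (by norm_num)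
  have hw0 : w ≠ 0 := by
    rintro rfl
    exact hz (by linear_combination hw)
  have hnz : ‖z‖ = ‖w‖ ^ 3 := by rw [← norm_pow, hw, norm_neg]
  have hpos : 0 < ‖w‖ := norm_pos_iff.2 hw0
  have heq : (fun x : ℂ ↦ ‖x ^ 3 + z‖ ^ (-s)) =
      fun x ↦ ‖z‖ ^ (-s) * ‖(w⁻¹ * x) ^ 3 - 1‖ ^ (-s) := by
    ext x
    rw [← Real.mul_rpow (by positivity) (by positivity), ← norm_mul, ← norm_neg (z * _)]
    congr 2
    have : z = -w ^ 3 := by rw [hw, neg_neg]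
    rw [this]
    field_simp
    ring
  have hint := integrable_norm_cube_sub_one_rpow h1 h2
  rw [heq]
  refine ⟨(Complex.integrable_comp_mul_left hint (inv_ne_zero hw0)).const_mul _, ?_⟩
  rw [integral_const_mul,
    Complex.integral_comp_mul_left_s10 (fun u ↦ ‖u ^ 3 - 1‖ ^ (-s)) w⁻¹, ← mul_assoc,
    Real.rpow_sub (by rw [hnz]; positivity), Real.rpow_neg (by positivity)]
  congr 1
  have : ‖z‖ ^ (2 / 3 : ℝ) = ‖w‖ ^ 2 := by
    rw [hnz, ← Real.rpow_natCast, ← Real.rpow_natCast, ← Real.rpow_mul hpos.le]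
    norm_num
  rw [this, norm_inv, inv_pow, inv_inv]
  ring

lemma integrableOn_E8 {c : ℝ} (h1 : 1 / 3 < c) (h2 : c < 8 / 15) :
    IntegrableOn (fun p : ℂ × ℂ ↦ ‖p.1 ^ 3 + p.2 ^ 5‖ ^ (-2 * c)) (ball 0 1) := by
  have hsub : ball (0 : ℂ × ℂ) 1 ⊆ univ ×ˢ ball (0 : ℂ) 1 := by
    rw [← Prod.mk_zero_zero, ← ball_prod_same]
    exact prod_mono_left (subset_univ _)
  refine IntegrableOn.mono_set ?_ hsub
  have hmeas : Measurable (fun p : ℂ × ℂ ↦ ‖p.1 ^ 3 + p.2 ^ 5‖ ^ (-2 * c)) := by fun_prop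
  have hne : ∀ᵐ y : ℂ ∂volume.restrict (ball 0 1), y ≠ 0 :=
    ae_restrict_of_ae (Measure.ae_ne volume 0)
  rw [IntegrableOn, Measure.volume_eq_prod, ← Measure.prod_restrict,
    integrable_prod_iff' hmeas.aestronglyMeasurable, Measure.restrict_univ]
  have hfib := fun (y : ℂ) (hy : y ≠ 0) ↦ integrable_and_integral_norm_cube_add
    (s := 2 * c) (by linarith) (by linarith) (pow_ne_zero 5 hy)
  simp only [neg_mul]
  refine ⟨hne.mono fun y hy ↦ (hfib y hy).1, ?_⟩
  set K := ∫ u : ℂ, ‖u ^ 3 - 1‖ ^ (-(2 * c))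
  have hI : IntegrableOn (fun y : ℂ ↦ ‖y‖ ^ (-(5 * (2 * c - 2 / 3))) * K) (ball 0 1) := by
    refine Integrable.mul_const ?_ K
    refine integrableOn_ball_of_norm_le_rpow (C := 1) (α := 5 * (2 * c - 2 / 3)) (by simp)
      (by simp; linarith) ?_ ?_
    · refine Filter.Eventually.of_forall fun u ↦ ?_
      rw [Real.norm_of_nonneg (by positivity), one_mul]
    · exact (by fun_prop :
        Measurable fun u : ℂ ↦ ‖u‖ ^ (-(5 * (2 * c - 2 / 3)))).aestronglyMeasurable
  refine hI.congr (hne.mono fun y hy ↦ ?_)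
  have hnn : ∀ x : ℂ, ‖‖x ^ 3 + y ^ 5‖ ^ (-(2 * c))‖ = ‖x ^ 3 + y ^ 5‖ ^ (-(2 * c)) :=
    fun x ↦ Real.norm_of_nonneg (by positivity)
  simp only [hnn]
  rw [(hfib y hy).2, norm_pow, ← Real.rpow_natCast, ← Real.rpow_mul (norm_nonneg _)]
  congr 2
  push_cast
  ring

/-- On the product of balls used here, `x ^ 3 + y ^ 5` has modulus comparable to `r ^ 15`. -/
lemma rpow_le_of_mem_prod_ball {c r : ℝ} (hc : 0 ≤ c) (hr : 0 < r) {p : ℂ × ℂ}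
    (hp : p ∈ ball ((3 / 4 * r ^ 5 : ℝ) : ℂ) (r ^ 5 / 4) ×ˢ ball (0 : ℂ) (r ^ 3 / 2)) :
    (2 * r ^ 15) ^ (-2 * c) ≤ ‖p.1 ^ 3 + p.2 ^ 5‖ ^ (-2 * c) := by
  obtain ⟨hx, hy⟩ := hp
  rw [mem_ball, dist_eq_norm] at hx
  rw [mem_ball_zero_iff] at hy
  have hr5 : 0 < r ^ 5 := by positivity
  have hcn : ‖((3 / 4 * r ^ 5 : ℝ) : ℂ)‖ = 3 / 4 * r ^ 5 := by
    rw [Complex.norm_real, Real.norm_of_nonneg (by positivity)]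
  have hx1 : ‖p.1‖ ≤ r ^ 5 := by
    have := norm_sub_norm_le p.1 ((3 / 4 * r ^ 5 : ℝ) : ℂ)
    linarith
  have hx2 : r ^ 5 / 2 ≤ ‖p.1‖ := by
    have := norm_sub_norm_le ((3 / 4 * r ^ 5 : ℝ) : ℂ) p.1
    rw [norm_sub_rev] at this
    linarith
  have hx3 : ‖p.1‖ ^ 3 ≤ r ^ 15 := by
    calc _ ≤ (r ^ 5) ^ 3 := by gcongr
      _ = _ := by ring
  have hx4 : r ^ 15 / 8 ≤ ‖p.1‖ ^ 3 := by
    calc _ = (r ^ 5 / 2) ^ 3 := by ring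
      _ ≤ _ := by gcongr
  have hy5 : ‖p.2‖ ^ 5 ≤ r ^ 15 / 32 := by
    calc _ ≤ (r ^ 3 / 2) ^ 5 := by gcongr
      _ = _ := by ring
  have hr15 : 0 < r ^ 15 := by positivity
  refine Real.rpow_le_rpow_of_nonpos ?_ ?_ (by linarith)
  · have := norm_sub_norm_le (p.1 ^ 3) (-p.2 ^ 5)
    rw [sub_neg_eq_add, norm_neg, norm_pow, norm_pow] at this
    linarith
  · have := norm_add_le (p.1 ^ 3) (p.2 ^ 5)
    rw [norm_pow, norm_pow] at this
    linarith

lemma le_of_integrableOn_E8 {c ε : ℝ} (hc : 0 ≤ c) (hε : 0 < ε)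
    (hint : IntegrableOn (fun p : ℂ × ℂ ↦ ‖p.1 ^ 3 + p.2 ^ 5‖ ^ (-2 * c)) (ball 0 ε)) :
    c ≤ 8 / 15 := by
  by_contra! hcon
  set I := ∫ p in ball (0 : ℂ × ℂ) ε, ‖p.1 ^ 3 + p.2 ^ 5‖ ^ (-2 * c)
  set C : ℝ := 2 ^ (-2 * c) * (Real.pi ^ 2 / 64) with hC
  have hCpos : 0 < C := by positivity
  have hbound : ∀ r : ℝ, 0 < r → r < min 1 ε → C * r ^ (16 - 30 * c) ≤ I := by
    intro r hr hrlt
    have hr1 : r < 1 := hrlt.trans_le (min_le_left _ _)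
    have hrε : r < ε := hrlt.trans_le (min_le_right _ _)
    set S := ball ((3 / 4 * r ^ 5 : ℝ) : ℂ) (r ^ 5 / 4) ×ˢ ball (0 : ℂ) (r ^ 3 / 2)
    have hSmeas : MeasurableSet S := measurableSet_ball.prod measurableSet_ball
    have hS : S ⊆ ball 0 ε := by
      rw [← Prod.mk_zero_zero, ← ball_prod_same]
      have h5 : r ^ 5 ≤ r := pow_le_of_le_one hr.le hr1.le (by norm_num)
      have h3 : r ^ 3 ≤ r := pow_le_of_le_one hr.le hr1.le (by norm_num)
      have h3' : 0 < r ^ 3 := by positivity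
      refine prod_mono (ball_subset_ball' ?_) (ball_subset_ball (by linarith))
      rw [dist_zero_right, Complex.norm_real, Real.norm_of_nonneg (by positivity)]
      linarith
    have hvol : volume.real S = Real.pi ^ 2 / 64 * r ^ 16 := by
      rw [Measure.real, Measure.volume_eq_prod, Measure.prod_prod, Complex.volume_ball,
        Complex.volume_ball]
      simp only [ENNReal.toReal_mul, ENNReal.toReal_pow, ENNReal.coe_toReal, NNReal.coe_real_pi]
      rw [ENNReal.toReal_ofReal (by positivity), ENNReal.toReal_ofReal (by positivity)]
      ring
    have hfin : volume S ≠ ⊤ := (measure_mono hS |>.trans_lt measure_ball_lt_top).ne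
    calc C * r ^ (16 - 30 * c) = (2 * r ^ 15) ^ (-2 * c) * volume.real S := by
          rw [hvol, Real.mul_rpow (by norm_num) (by positivity), hC,
            ← Real.rpow_natCast r 15, ← Real.rpow_natCast r 16, ← Real.rpow_mul hr.le,
            show 16 - 30 * c = ((15 : ℕ) : ℝ) * (-2 * c) + ((16 : ℕ) : ℝ) by push_cast; ring,
            Real.rpow_add hr]
          ring
      _ ≤ ∫ p in S, ‖p.1 ^ 3 + p.2 ^ 5‖ ^ (-2 * c) :=
          setIntegral_ge_of_const_le_real hSmeas hfin
            (fun p hp ↦ rpow_le_of_mem_prod_ball hc hr hp) (hint.mono_set hS)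
      _ ≤ I := setIntegral_mono_set hint
          (Filter.Eventually.of_forall fun p ↦ by positivity) hS.eventuallyLE
  have hlim : Filter.Tendsto (fun r : ℝ ↦ C * r ^ (16 - 30 * c)) (nhdsWithin 0 (Ioi 0))
      Filter.atTop :=
    (tendsto_rpow_neg_nhdsGT_zero (by linarith)).const_mul_atTop hCpos
  obtain ⟨r, hr, hrI⟩ := ((hlim.eventually_gt_atTop I).and
    (Ioo_mem_nhdsGT (lt_min one_pos hε))).exists
  exact absurd (hbound r hrI.1 hrI.2) (not_le.2 hr)

theorem lct_E8 : lct₀ (fun p : ℂ × ℂ => p.1 ^ 3 + p.2 ^ 5) = 8 / 15 := by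
  refine csSup_eq_of_forall_le_of_forall_lt_exists_gt
    ⟨1 / 2, by norm_num, 1, one_pos, integrableOn_E8 (by norm_num) (by norm_num)⟩ ?_ ?_
  · rintro c ⟨hc, ε, hε, hint⟩
    exact le_of_integrableOn_E8 hc hε hint
  · intro b hb
    obtain ⟨c, hc1, hc2⟩ := exists_between (max_lt hb (by norm_num : (1 / 3 : ℝ) < 8 / 15))
    have h3 := (le_max_right b (1 / 3)).trans_lt hc1
    exact ⟨c, ⟨by linarith, 1, one_pos, integrableOn_E8 h3 hc2⟩, (le_max_left _ _).trans_lt hc1⟩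
end

section
/- For every complex number a with 4a³ + 27 ≠ 0, the T_{2,3,6} singularity f(x,y) = a x² y² + x³ + y⁶ satisfies lct₀(f) = 1/2. -/
open MeasureTheory

open Filter Topology Metric

/-- The function `‖z‖ ^ s` is integrable on discs around the origin of `ℂ` when `s > -2`. -/
theorem integrableOn_ball_norm_rpow {s : ℝ} (hs : -2 < s) (R : ℝ) :
    IntegrableOn (fun z : ℂ => ‖z‖ ^ s) (ball 0 R) := by
  rw [integrableOn_fun_norm_addHaar volume (f := fun r : ℝ => r ^ s), Complex.finrank_real_complex]
  rcases le_or_gt R 0 with hR | hR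
  · simp [Set.Ioo_eq_empty_of_le hR]
  · refine ((intervalIntegral.integrableOn_Ioo_rpow_iff (s := s + 1) hR).2
      (by linarith)).congr_fun (fun y hy => ?_) measurableSet_Ioo
    simp [Real.rpow_add hy.1, mul_comm]

/-- A shear `(x, y) ↦ (x - g y, y)` of the plane preserves volume. -/
theorem measurePreserving_shear {g : ℂ → ℂ} (hg : Measurable g) :
    MeasurePreserving (fun p : ℂ × ℂ => (p.1 - g p.2, p.2)) volume volume := by
  have h := (MeasurePreserving.id (volume : Measure ℂ)).skew_product (μc := volume) (μd := volume)
    (g := fun y x => x - g y) (by fun_prop)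
    (ae_of_all _ fun y => (measurePreserving_sub_right volume (g y)).map_eq)
  exact (Measure.measurePreserving_swap.comp h).comp Measure.measurePreserving_swap

theorem integrableOn_norm_sub_sq_rpow_mul {s : ℝ} (hs : -2 < s) (t : ℂ) :
    IntegrableOn (fun p : ℂ × ℂ => ‖p.1 - t * p.2 ^ 2‖ ^ s * ‖p.2‖ ^ s) (ball 0 1) := by
  have h := (integrableOn_ball_norm_rpow hs (1 + ‖t‖)).integrable_indicator measurableSet_ball
  have h' := (integrableOn_ball_norm_rpow hs 1).integrable_indicator measurableSet_ball
  have key := (measurePreserving_shear (g := fun y => t * y ^ 2) (by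
    fun_prop)).integrable_comp_of_integrable (h.mul_prod h')
  refine key.integrableOn.congr_fun (fun p hp => ?_) measurableSet_ball
  rw [mem_ball_zero_iff, Prod.norm_def, max_lt_iff] at hp
  have h2 : p.2 ∈ ball (0 : ℂ) 1 := by simpa using hp.2
  have h1 : p.1 - t * p.2 ^ 2 ∈ ball (0 : ℂ) (1 + ‖t‖) := by
    rw [mem_ball_zero_iff]
    calc ‖p.1 - t * p.2 ^ 2‖ ≤ ‖p.1‖ + ‖t * p.2 ^ 2‖ := norm_sub_le _ _
      _ = ‖p.1‖ + ‖t‖ * ‖p.2‖ ^ 2 := by rw [norm_mul, norm_pow]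
      _ < 1 + ‖t‖ := by
        have := pow_le_one₀ (n := 2) (norm_nonneg p.2) hp.2.le
        nlinarith [norm_nonneg t, hp.1]
  simp [Set.indicator_of_mem h1, Set.indicator_of_mem h2]

/-- If `4 a ^ 3 + 27 ≠ 0`, the cubic `t ^ 3 + a t ^ 2 + 1` has three distinct roots; the
factorization is stated in homogenized form. -/
theorem exists_distinct_factorization {a : ℂ} (ha : 4 * a ^ 3 + 27 ≠ 0) :
    ∃ t₁ t₂ t₃ : ℂ, t₁ ≠ t₂ ∧ t₁ ≠ t₃ ∧ t₂ ≠ t₃ ∧ ∀ x y : ℂ,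
      a * x ^ 2 * y ^ 2 + x ^ 3 + y ^ 6 =
        (x - t₁ * y ^ 2) * (x - t₂ * y ^ 2) * (x - t₃ * y ^ 2) := by
  let P : Cubic ℂ := ⟨1, a, 0, 1⟩
  have hP : P.a ≠ 0 := one_ne_zero
  obtain ⟨t₁, t₂, t₃, h⟩ := (Cubic.splits_iff_roots_eq_three (φ := RingHom.id ℂ) hP).1
    (IsAlgClosed.splits _)
  have hd : P.discr ≠ 0 := by
    simp only [P, Cubic.discr]
    contrapose! ha
    linear_combination -ha
  obtain ⟨h₁₂, h₁₃, h₂₃⟩ := (Cubic.discr_ne_zero_iff_roots_ne hP h).1 hd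
  refine ⟨t₁, t₂, t₃, h₁₂, h₁₃, h₂₃, fun x y => ?_⟩
  have hb := Cubic.b_eq_three_roots hP h
  have hc := Cubic.c_eq_three_roots hP h
  have hd := Cubic.d_eq_three_roots hP h
  simp only [P, RingHom.id_apply, one_mul] at hb hc hd
  linear_combination x ^ 2 * y ^ 2 * hb + x * y ^ 4 * hc + y ^ 6 * hd

/-- If `w₁` has the smallest norm among three numbers and is `2 δ`-separated from `w₂`, then the
product of the three norms is at least `δ ‖w₁‖ ^ 2`. -/
theorem mul_norm_sq_le_norm_mul_mul {w₁ w₂ w₃ : ℂ} {δ : ℝ} (h₂ : ‖w₁‖ ≤ ‖w₂‖)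
    (h₃ : ‖w₁‖ ≤ ‖w₃‖) (hδ : 2 * δ ≤ ‖w₁ - w₂‖) :
    δ * ‖w₁‖ ^ 2 ≤ ‖w₁ * w₂ * w₃‖ := by
  have hδ₂ : δ ≤ ‖w₂‖ := by linarith [norm_sub_le w₁ w₂]
  calc δ * ‖w₁‖ ^ 2 = ‖w₁‖ * δ * ‖w₁‖ := by ring
    _ ≤ ‖w₁‖ * ‖w₂‖ * ‖w₃‖ := by gcongr
    _ = ‖w₁ * w₂ * w₃‖ := by simp

/-- A product of three distinct linear forms is bounded below by `‖s‖` times the square of one of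
its factors. -/
theorem exists_lower_bound {t₁ t₂ t₃ : ℂ} (h₁₂ : t₁ ≠ t₂) (h₁₃ : t₁ ≠ t₃) (h₂₃ : t₂ ≠ t₃) :
    ∃ κ : ℝ, 0 < κ ∧ ∀ x s : ℂ, ∃ t ∈ ({t₁, t₂, t₃} : Finset ℂ),
      κ * ‖s‖ * ‖x - t * s‖ ^ 2 ≤ ‖(x - t₁ * s) * (x - t₂ * s) * (x - t₃ * s)‖ := by
  have hp₁ : 0 < ‖t₁ - t₂‖ := norm_pos_iff.2 (sub_ne_zero.2 h₁₂)
  have hp₂ : 0 < ‖t₁ - t₃‖ := norm_pos_iff.2 (sub_ne_zero.2 h₁₃)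
  have hp₃ : 0 < ‖t₂ - t₃‖ := norm_pos_iff.2 (sub_ne_zero.2 h₂₃)
  obtain ⟨D, hD, hD'⟩ := exists_between (lt_min hp₁ (lt_min hp₂ hp₃))
  rw [lt_min_iff, lt_min_iff] at hD'
  refine ⟨D / 2, by positivity, fun x s => ?_⟩
  have sep : ∀ u v : ℂ, D < ‖u - v‖ → 2 * (D / 2 * ‖s‖) ≤ ‖(x - u * s) - (x - v * s)‖ := by
    intro u v huv
    have : (x - u * s) - (x - v * s) = -((u - v) * s) := by ring
    rw [this, norm_neg, norm_mul]
    nlinarith [norm_nonneg s]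
  obtain ⟨t, ht, hmin⟩ := Finset.exists_min_image ({t₁, t₂, t₃} : Finset ℂ)
    (fun t => ‖x - t * s‖) ⟨t₁, by simp⟩
  refine ⟨t, ht, ?_⟩
  have h₁ := hmin t₁ (by simp)
  have h₂ := hmin t₂ (by simp)
  have h₃ := hmin t₃ (by simp)
  simp only [Finset.mem_insert, Finset.mem_singleton] at ht
  rcases ht with rfl | rfl | rfl
  · exact mul_norm_sq_le_norm_mul_mul h₂ h₃ (sep _ _ hD'.1)
  · rw [mul_comm (x - t₁ * s)]
    exact mul_norm_sq_le_norm_mul_mul h₁ h₃ (sep _ _ (by rw [norm_sub_rev]; exact hD'.1))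
  · rw [mul_comm (_ * _) (x - t * s), ← mul_assoc (x - t * s)]
    exact mul_norm_sq_le_norm_mul_mul h₁ h₂ (sep _ _ (by rw [norm_sub_rev]; exact hD'.2.1))

theorem integrableOn_norm_rpow_of_lt_half {a : ℂ} (ha : 4 * a ^ 3 + 27 ≠ 0) {c : ℝ} (hc₀ : 0 < c)
    (hc : c < 1 / 2) :
    IntegrableOn (fun p : ℂ × ℂ => ‖a * p.1 ^ 2 * p.2 ^ 2 + p.1 ^ 3 + p.2 ^ 6‖ ^ (-2 * c))
      (ball 0 1) := by
  obtain ⟨t₁, t₂, t₃, h₁₂, h₁₃, h₂₃, hf⟩ := exists_distinct_factorization ha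
  obtain ⟨κ, hκ, hbd⟩ := exists_lower_bound h₁₂ h₁₃ h₂₃
  have hint : IntegrableOn (fun p : ℂ × ℂ => κ ^ (-2 * c) * ∑ t ∈ ({t₁, t₂, t₃} : Finset ℂ),
      ‖p.1 - t * p.2 ^ 2‖ ^ (-4 * c) * ‖p.2‖ ^ (-4 * c)) (ball 0 1) :=
    (integrable_finsetSum _ fun t _ =>
      integrableOn_norm_sub_sq_rpow_mul (by linarith) t).const_mul _
  have hy : ∀ᵐ p : ℂ × ℂ, p.2 ≠ 0 :=
    Measure.quasiMeasurePreserving_snd.ae (Measure.ae_ne volume 0)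
  refine hint.mono' (Measurable.pow_const (by fun_prop) _).aestronglyMeasurable ?_
  filter_upwards [ae_restrict_of_ae hy] with p hp
  rw [Real.norm_of_nonneg (by positivity), hf]
  obtain ⟨t, ht, hle⟩ := hbd p.1 (p.2 ^ 2)
  rcases eq_or_ne ((p.1 - t₁ * p.2 ^ 2) * (p.1 - t₂ * p.2 ^ 2) * (p.1 - t₃ * p.2 ^ 2)) 0
    with h0 | h0
  · rw [h0, norm_zero, Real.zero_rpow (by linarith)]
    positivity
  have hw : p.1 - t * p.2 ^ 2 ≠ 0 := by
    simp only [Finset.mem_insert, Finset.mem_singleton] at ht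
    rintro hw
    apply h0
    rcases ht with rfl | rfl | rfl <;> simp [hw]
  have hy' : 0 < ‖p.2‖ := norm_pos_iff.2 hp
  have hw' : 0 < ‖p.1 - t * p.2 ^ 2‖ := norm_pos_iff.2 hw
  rw [norm_pow] at hle
  calc _ ≤ (κ * ‖p.2‖ ^ 2 * ‖p.1 - t * p.2 ^ 2‖ ^ 2) ^ (-2 * c) :=
        Real.rpow_le_rpow_of_nonpos (by positivity) hle (by linarith)
    _ = κ ^ (-2 * c) * (‖p.1 - t * p.2 ^ 2‖ ^ (-4 * c) * ‖p.2‖ ^ (-4 * c)) := by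
        rw [Real.mul_rpow (by positivity) (by positivity),
          Real.mul_rpow (by positivity) (by positivity), ← Real.rpow_natCast_mul hy'.le,
          ← Real.rpow_natCast_mul hw'.le]
        push_cast
        ring_nf
    _ ≤ _ := by
        gcongr
        exact Finset.single_le_sum (f := fun t =>
          ‖p.1 - t * p.2 ^ 2‖ ^ (-4 * c) * ‖p.2‖ ^ (-4 * c)) (fun _ _ => by positivity) ht

/-- On polydiscs of size `(r ^ 2, r)` centred at `(0, r)` the polynomial is nonzero and of
size `r ^ 6`. -/
theorem exists_polydisc_bound (a : ℂ) : ∃ δ : ℝ, 0 < δ ∧ δ ≤ 1 ∧ ∀ r : ℝ, 0 < r →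
    ∀ p ∈ ball (0 : ℂ) (δ * r ^ 2) ×ˢ ball (r : ℂ) (r / 2),
      0 < ‖a * p.1 ^ 2 * p.2 ^ 2 + p.1 ^ 3 + p.2 ^ 6‖ ∧
        ‖a * p.1 ^ 2 * p.2 ^ 2 + p.1 ^ 3 + p.2 ^ 6‖ ≤ 13 * r ^ 6 := by
  have ha := norm_nonneg a
  obtain ⟨δ, hδ, hδ₁, hδ₂⟩ : ∃ δ : ℝ, 0 < δ ∧ δ ≤ 1 / 64 ∧ ‖a‖ * δ ≤ 1 / 64 := by
    refine ⟨1 / (64 * (‖a‖ + 1)), by positivity, ?_, ?_⟩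
    · apply one_div_le_one_div_of_le <;> linarith
    · rw [mul_one_div, div_le_div_iff₀ (by positivity) (by norm_num)]
      linarith
  refine ⟨δ, hδ, by linarith, fun r hr p ⟨hx, hy⟩ => ?_⟩
  rw [mem_ball_zero_iff] at hx
  rw [mem_ball, dist_eq_norm] at hy
  have hnr : ‖(r : ℂ)‖ = r := by simp [abs_of_pos hr]
  have hyu : ‖p.2‖ ≤ 3 / 2 * r := by
    have := norm_sub_norm_le p.2 (r : ℂ)
    linarith
  have hyl : r / 2 ≤ ‖p.2‖ := by
    have := norm_sub_norm_le (r : ℂ) p.2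
    rw [norm_sub_rev] at this
    linarith
  have hrest : ‖a * p.1 ^ 2 * p.2 ^ 2 + p.1 ^ 3‖ ≤ 1 / 128 * r ^ 6 := by
    calc _ ≤ ‖a * p.1 ^ 2 * p.2 ^ 2‖ + ‖p.1 ^ 3‖ := norm_add_le _ _
      _ = ‖a‖ * ‖p.1‖ ^ 2 * ‖p.2‖ ^ 2 + ‖p.1‖ ^ 3 := by
          rw [norm_mul, norm_mul, norm_pow, norm_pow, norm_pow]
      _ ≤ ‖a‖ * (δ * r ^ 2) ^ 2 * (3 / 2 * r) ^ 2 + (δ * r ^ 2) ^ 3 := by gcongr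
      _ = (9 / 4 * ((‖a‖ * δ) * δ) + δ ^ 3) * r ^ 6 := by ring
      _ ≤ (9 / 4 * (1 / 64 * (1 / 64)) + (1 / 64) ^ 3) * r ^ 6 := by gcongr
      _ ≤ 1 / 128 * r ^ 6 := by gcongr; norm_num
  have hu : ‖p.2 ^ 6‖ ≤ (3 / 2 * r) ^ 6 := by rw [norm_pow]; gcongr
  have hl : (r / 2) ^ 6 ≤ ‖p.2 ^ 6‖ := by rw [norm_pow]; gcongr
  have hr6 : 0 < r ^ 6 := by positivity
  constructor
  · have := norm_sub_le_norm_add (p.2 ^ 6) (a * p.1 ^ 2 * p.2 ^ 2 + p.1 ^ 3)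
    rw [add_comm (p.2 ^ 6)] at this
    nlinarith
  · have := norm_add_le (a * p.1 ^ 2 * p.2 ^ 2 + p.1 ^ 3) (p.2 ^ 6)
    nlinarith

theorem not_integrableOn_norm_rpow_of_half_lt (a : ℂ) {c : ℝ} (hc : 1 / 2 < c) {ε : ℝ}
    (hε : 0 < ε) :
    ¬ IntegrableOn (fun p : ℂ × ℂ => ‖a * p.1 ^ 2 * p.2 ^ 2 + p.1 ^ 3 + p.2 ^ 6‖ ^ (-2 * c))
      (ball 0 ε) := by
  intro hint
  obtain ⟨δ, hδ, hδ₁, hbd⟩ := exists_polydisc_bound a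
  set I := ∫ p in ball (0 : ℂ × ℂ) ε,
    ‖a * p.1 ^ 2 * p.2 ^ 2 + p.1 ^ 3 + p.2 ^ 6‖ ^ (-2 * c) with hI
  set K : ℝ := 13 ^ (-2 * c) * (δ ^ 2 * Real.pi ^ 2 / 4) with hK
  have hKpos : 0 < K := by positivity
  have hle : ∀ r : ℝ, 0 < r → r < min 1 (ε / 2) → K * r ^ (6 - 12 * c) ≤ I := by
    intro r hr hrε
    rw [lt_min_iff] at hrε
    set S := ball (0 : ℂ) (δ * r ^ 2) ×ˢ ball (r : ℂ) (r / 2) with hS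
    have hsub : S ⊆ ball (0 : ℂ × ℂ) ε := by
      rintro p ⟨hx, hy⟩
      rw [mem_ball_zero_iff] at hx
      rw [mem_ball, dist_eq_norm] at hy
      have hnr : ‖(r : ℂ)‖ = r := by simp [abs_of_pos hr]
      rw [mem_ball_zero_iff, Prod.norm_def, max_lt_iff]
      constructor
      · nlinarith
      · linarith [norm_sub_norm_le p.2 (r : ℂ)]
    have hvol : volume.real S = δ ^ 2 * Real.pi ^ 2 / 4 * r ^ 6 := by
      rw [hS, Measure.volume_eq_prod, measureReal_prod_prod]
      simp only [measureReal_def, Complex.volume_ball, ENNReal.toReal_mul, ENNReal.toReal_pow,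
        ENNReal.coe_toReal, NNReal.coe_real_pi]
      rw [ENNReal.toReal_ofReal (by positivity), ENNReal.toReal_ofReal (by positivity)]
      ring
    have hfin : volume S ≠ ⊤ := by
      rw [hS, Measure.volume_eq_prod, Measure.prod_prod]
      exact ENNReal.mul_ne_top measure_ball_lt_top.ne measure_ball_lt_top.ne
    have hS_meas : MeasurableSet S := measurableSet_ball.prod measurableSet_ball
    calc K * r ^ (6 - 12 * c) = (13 * r ^ 6) ^ (-2 * c) * volume.real S := by
          rw [hvol, hK, Real.mul_rpow (by positivity) (by positivity),
            ← Real.rpow_natCast_mul hr.le, ← Real.rpow_natCast r 6]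
          have : (6 - 12 * c) = (6 : ℕ) * (-2 * c) + (6 : ℕ) := by push_cast; ring
          rw [this, Real.rpow_add hr]
          ring
      _ ≤ ∫ p in S, ‖a * p.1 ^ 2 * p.2 ^ 2 + p.1 ^ 3 + p.2 ^ 6‖ ^ (-2 * c) :=
          setIntegral_ge_of_const_le_real hS_meas hfin (fun p hp =>
            Real.rpow_le_rpow_of_nonpos (hbd r hr p hp).1 (hbd r hr p hp).2 (by linarith))
            (hint.mono_set hsub)
      _ ≤ I := setIntegral_mono_set hint (ae_of_all _ fun p => by positivity)
          (LE.le.eventuallyLE hsub)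
  have htend : Tendsto (fun r : ℝ => K * r ^ (6 - 12 * c)) (𝓝[>] 0) atTop :=
    (tendsto_rpow_neg_nhdsGT_zero (by linarith)).const_mul_atTop hKpos
  have hsmall : ∀ᶠ r : ℝ in 𝓝[>] 0, r < min 1 (ε / 2) :=
    nhdsWithin_le_nhds (eventually_lt_nhds (by positivity))
  obtain ⟨r, ⟨hr, hrε⟩, hrI⟩ :=
    ((eventually_mem_nhdsWithin.and hsmall).and (htend.eventually_gt_atTop I)).exists
  exact (hle r hr hrε).not_gt hrI

theorem lct_T236 (a : ℂ) (ha : 4 * a ^ 3 + 27 ≠ 0) :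
    lct₀ (fun p : ℂ × ℂ => a * p.1 ^ 2 * p.2 ^ 2 + p.1 ^ 3 + p.2 ^ 6) = 1 / 2 := by
  have hmem : ∀ c : ℝ, 0 < c → c < 1 / 2 → c ∈ { c : ℝ | 0 ≤ c ∧ ∃ ε : ℝ, 0 < ε ∧
      IntegrableOn (fun p : ℂ × ℂ => ‖a * p.1 ^ 2 * p.2 ^ 2 + p.1 ^ 3 + p.2 ^ 6‖ ^ (-2 * c))
        (ball (0 : ℂ × ℂ) ε) volume } := fun c hc₀ hc =>
    ⟨hc₀.le, 1, one_pos, integrableOn_norm_rpow_of_lt_half ha hc₀ hc⟩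
  refine csSup_eq_of_forall_le_of_forall_lt_exists_gt ⟨1 / 4, hmem _ (by norm_num) (by norm_num)⟩
    ?_ fun w hw => ?_
  · rintro c ⟨-, ε, hε, hint⟩
    by_contra! hc
    exact not_integrableOn_norm_rpow_of_half_lt a hc hε hint
  · obtain ⟨c, hwc, hc⟩ := exists_between (max_lt hw (by norm_num : (0 : ℝ) < 1 / 2))
    rw [max_lt_iff] at hwc
    exact ⟨c, hmem c hwc.2 hc, hwc.1⟩
end
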